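/- arXiv:2212.01750 — 8 statements merged into one kernel-verified Lean document; each statement's English description precedes it below -/
import Mathlib

section
/- Let L, G, H be groups with L ∩ G = H such that the subgroup H is malnormal in L. Then for every H^±-separated sequence (a_k)_{k<18} in L \ H there exists a group M such that: (1) G and L are subgroups of M; (2) the unique homomorphism q : L ∗_H G → M extending the identity embedding of L ∪ G into M is surjective and its kernel coincides with the smallest normal subgroup of L ∗_H G containing the set {a₀xa₁x⋯a₁₇x : x ∈ G \ H}; (3) the subgroup G is malnormal in M; (4) the sequence (a_k)_{k<18} is G^±-separated in M; (5) a₀xa₁x⋯a₁₇x = e holds in M for every x ∈ G \ H; (6) lgc₁lgc₂⋯lgcₙ ≠ e in M for every l ∈ L \ H, g ∈ G \ H, n ≥ 1 and c₁,…,cₙ ∈ H. -/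
open scoped Pointwise

namespace AmalgamFormalization

variable {F : Type u} [Group F]

/-- `u ∼ v`: both elements lie in `L` or both lie in `G`. -/
def SameFactor (L G : Subgroup F) (u v : F) : Prop :=
  (u ∈ L ∧ v ∈ L) ∨ (u ∈ G ∧ v ∈ G)

/-- A canonical word: a list of elements of `L ∪ G` in which no two consecutive
entries lie in a common factor. -/
def IsCanonicalWord (L G : Subgroup F) (w : List F) : Prop :=
  (∀ x ∈ w, x ∈ (L : Set F) ∪ (G : Set F)) ∧
    w.Chain' fun a b => ¬ SameFactor L G a b

/-- `w` is a canonical representation of `x`. -/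
def IsCanonicalRep (L G : Subgroup F) (x : F) (w : List F) : Prop :=
  IsCanonicalWord L G w ∧ w.prod = x

/-- `F` is (internally) the free product of its subgroups `L` and `G`
amalgamated over `H = L ⊓ G`: it is generated by `L ∪ G` and no nonempty
alternating (canonical) word of length `≥ 2` represents the identity. -/
def IsAmalgam (L G : Subgroup F) : Prop :=
  L ⊔ G = ⊤ ∧ ∀ w : List F, IsCanonicalWord L G w → 2 ≤ w.length → w.prod ≠ 1

/-- The length of an element: the (common) length of its canonical representations. -/
noncomputable def len (L G : Subgroup F) (x : F) : ℕ :=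
  sInf {n | ∃ w : List F, IsCanonicalRep L G x w ∧ w.length = n}

/-- An element is cyclically reduced if it has length `≤ 1` or admits a canonical
representation whose first and last entries lie in no common factor. -/
def IsCyclicallyReduced (L G : Subgroup F) (x : F) : Prop :=
  len L G x ≤ 1 ∨ ∃ w : List F, IsCanonicalRep L G x w ∧
    ∀ a b : F, w.head? = some a → w.getLast? = some b → ¬ SameFactor L G a b

/-- An element is weakly cyclically reduced if it has length `≤ 1` or admits a canonical
representation `x₁ ⋯ xₙ` with `x₁ * xₙ ∉ H`. -/
def IsWeaklyCyclicallyReduced (L G : Subgroup F) (x : F) : Prop :=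
  len L G x ≤ 1 ∨ ∃ w : List F, IsCanonicalRep L G x w ∧
    ∀ a b : F, w.head? = some a → w.getLast? = some b → a * b ∉ L ⊓ G

/-- A set is half-symmetrized if all its elements are weakly cyclically reduced and it
contains every weakly cyclically reduced conjugate of each of its elements. -/
def IsHalfSymmetrized (L G : Subgroup F) (R : Set F) : Prop :=
  (∀ r ∈ R, IsWeaklyCyclicallyReduced L G r) ∧
    ∀ c : F, ∀ r ∈ R, IsWeaklyCyclicallyReduced L G (c * r * c⁻¹) → c * r * c⁻¹ ∈ R

/-- A set is symmetrized if it is half-symmetrized and closed under inverses. -/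
def IsSymmetrized (L G : Subgroup F) (R : Set F) : Prop :=
  IsHalfSymmetrized L G R ∧ ∀ r ∈ R, r⁻¹ ∈ R

/-- The half-symmetrized hull: the smallest half-symmetrized set containing `R`. -/
def halfSymmetrizedHull (L G : Subgroup F) (R : Set F) : Set F :=
  ⋂₀ {S | R ⊆ S ∧ IsHalfSymmetrized L G S}

/-- The symmetrized hull: the smallest symmetrized set containing `R`. -/
def symmetrizedHull (L G : Subgroup F) (R : Set F) : Set F :=
  ⋂₀ {S | R ⊆ S ∧ IsSymmetrized L G S}

/-- `a ≐ b c` : `a = b * c` and `|b| + |c| - 1 ≤ |a| ≤ |b| + |c|`. -/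
def DotEq (L G : Subgroup F) (a b c : F) : Prop :=
  a = b * c ∧ len L G b + len L G c - 1 ≤ len L G a ∧ len L G a ≤ len L G b + len L G c

/-- `p` is an `R`-piece of `r`. -/
def IsPieceOf (L G : Subgroup F) (R : Set F) (p r : F) : Prop :=
  ∃ q ∈ R, q ≠ r ∧ (∃ x, DotEq L G r p x) ∧ ∃ y, DotEq L G q p y

/-- The small cancellation condition `C'(λ)`. -/
def CondC' (L G : Subgroup F) (R : Set F) (lam : ℝ) : Prop :=
  (∀ r ∈ R, 1 / lam < (len L G r : ℝ)) ∧
    ∀ r ∈ R, ∀ p : F, IsPieceOf L G R p r → (len L G p : ℝ) < lam * (len L G r : ℝ)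

/-- `H` is a malnormal subgroup of `K`. -/
def MalnormalIn (H K : Subgroup F) : Prop :=
  ∀ x ∈ K, x ∉ H → ∀ h ∈ H, x * h * x⁻¹ ∈ H → h = 1

/-- An element `g` is `H`-malnormal: `g ∉ H` and `H ∩ gHg⁻¹ = {e}`. -/
def IsHMalnormal (H : Subgroup F) (g : F) : Prop :=
  g ∉ H ∧ ∀ h ∈ H, g * h * g⁻¹ ∈ H → h = 1

/-- A sequence `(g i)` is `H^±`-separated: `g i ∉ H (g j) H ∪ H (g j)⁻¹ H` for `i ≠ j`. -/
def HPMSeparated (H : Subgroup F) {n : ℕ} (g : Fin n → F) : Prop :=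
  ∀ i j : Fin n, i ≠ j →
    g i ∉ ((H : Set F) * {g j} * (H : Set F)) ∪ ((H : Set F) * {(g j)⁻¹} * (H : Set F))

/-- An element of positive even length is half `H⁻`-separated. -/
def IsHalfHMinusSeparated (L G : Subgroup F) (r : F) : Prop :=
  ∃ (n : ℕ) (x : Fin n → F), IsCanonicalRep L G r (List.ofFn x) ∧
    ∃ ε : Fin n, (ε : ℕ) ≤ 1 ∧
      ∀ i j : Fin n, Even (i : ℕ) → Even (j : ℕ) → i ≠ j →
        (x (ε + i))⁻¹ ∉
          ((L ⊓ G : Subgroup F) : Set F) * {x (ε + j)} * ((L ⊓ G : Subgroup F) : Set F)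

/-- A set is half `H⁻`-separated if each of its elements has positive even length and
is half `H⁻`-separated. -/
def IsHalfHMinusSeparatedSet (L G : Subgroup F) (R : Set F) : Prop :=
  ∀ r ∈ R, 0 < len L G r ∧ Even (len L G r) ∧ IsHalfHMinusSeparated L G r

end AmalgamFormalization

namespace AmalgamFormalization

/-- Tree metrics: an integral geodesic metric satisfying the four point condition. -/
structure TD {V : Type u} (d : V → V → ℕ) : Prop where
  eq0 : ∀ x y, d x y = 0 → x = y
  self : ∀ x, d x x = 0
  comm : ∀ x y, d x y = d y x
  four : ∀ x y z w, d x y + d z w ≤ max (d x z + d y w) (d x w + d y z)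
  geo : ∀ x y k, k ≤ d x y → ∃ z, d x z = k ∧ k + d z y = d x y
  med : ∀ x y z, ∃ m, d x m + d m y = d x y ∧ d y m + d m z = d y z ∧ d x m + d m z = d x z

namespace TD
variable {V : Type u} {d : V → V → ℕ}

theorem tri (h : TD d) (x y z : V) : d x y ≤ d x z + d z y := by
  have := h.four x y z z
  have := h.self z
  have := h.comm y z
  omega

/-- local-to-global principle -/
theorem glue (h : TD d) {x a c y : V} (h1 : d x a + d a c = d x c) (h2 : d a c + d c y = d a y)
    (hne : a ≠ c) : d x a + d a c + d c y = d x y := by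
  have h0 : d a c ≠ 0 := fun h' => hne (h.eq0 _ _ h')
  have h3 := h.four x c a y
  have h4 := h.tri x y c
  have h5 := h.comm c a
  omega

/-- points on a geodesic at equal distance agree -/
theorem uniq (h : TD d) {x y z w : V} (h1 : d x z + d z y = d x y) (h2 : d x w + d w y = d x y)
    (h3 : d x z = d x w) : z = w := by
  apply h.eq0
  have h4 := h.four x y z w
  have h5 := h.four z w x y
  have h6 := h.comm y z
  have h7 := h.comm y w
  have h8 := h.comm x z
  have h9 := h.comm x w
  have h10 := h.comm w y
  omega

end TD

/-- Convex subsets. -/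
def Cvx {V : Type u} (d : V → V → ℕ) (W : Set V) : Prop :=
  ∀ x ∈ W, ∀ y ∈ W, ∀ m, d x m + d m y = d x y → m ∈ W

/-- Existence of gates. -/
theorem exists_gate {V : Type u} {d : V → V → ℕ} (h : TD d) {W : Set V} (hW : Cvx d W)
    (hne : W.Nonempty) (p : V) : ∃ a ∈ W, ∀ x ∈ W, d x a + d a p = d x p := by
  classical
  have hex : ∃ n, ∃ a ∈ W, d a p = n := ⟨_, hne.choose, hne.choose_spec, rfl⟩
  obtain ⟨a, haW, ha⟩ := Nat.find_spec hex
  refine ⟨a, haW, fun x hx => ?_⟩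
  obtain ⟨m, h1, h2, h3⟩ := h.med x a p
  have hm : m ∈ W := hW x hx a haW m h1
  have h4 : Nat.find hex ≤ d m p := Nat.find_min' hex ⟨m, hm, rfl⟩
  have h5 : d a m = 0 := by omega
  have := h.eq0 _ _ h5
  subst this
  exact h3

/-- A system of axes with small overlaps. -/
structure Sys {V : Type u} {F : Type v} [Group F] [MulAction F V] (d : V → V → ℕ)
    (Ax : F → Set V → Prop) : Prop where
  td : TD d
  iso : ∀ (g : F) x y, d (g • x) (g • y) = d x y
  conj : ∀ (g s : F) A, Ax s A → Ax (g * s * g⁻¹) (g • A)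
  line : ∀ s A, Ax s A → ∃ P : ℤ → V, A = Set.range P ∧
    (∀ i j, (d (P i) (P j) : ℤ) = |i - j|) ∧ ∀ i, s • P i = P (i + 36)
  small : ∀ s A t B, Ax s A → Ax t B → ∀ p q, p ∈ A → q ∈ A → p ∈ B → q ∈ B → 5 ≤ d p q →
    s = t ∧ A = B

theorem line_mid {V : Type u} {d : V → V → ℕ} (h : TD d) {P : ℤ → V}
    (hP : ∀ i j, (d (P i) (P j) : ℤ) = |i - j|) (i j : ℤ) (m : V)
    (hm : d (P i) m + d m (P j) = d (P i) (P j)) :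
    m = P (if i ≤ j then i + d (P i) m else i - d (P i) m) := by
  have h1 := hP i j
  split_ifs with hij
  · have h2 := hP i (i + d (P i) m)
    have h3 := hP (i + d (P i) m) j
    rw [abs_of_nonpos (by omega)] at h1
    rw [abs_of_nonpos (by omega)] at h2
    rw [abs_of_nonpos (by omega)] at h3
    exact h.uniq hm (by omega) (by omega)
  · have h2 := hP i (i - d (P i) m)
    have h3 := hP (i - d (P i) m) j
    rw [abs_of_nonneg (by omega)] at h1
    rw [abs_of_nonneg (by omega)] at h2
    rw [abs_of_nonneg (by omega)] at h3
    exact h.uniq hm (by omega) (by omega)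

namespace Sys
variable {V : Type u} {F : Type v} [Group F] [MulAction F V] {d : V → V → ℕ}
    {Ax : F → Set V → Prop}

theorem cvx (S : Sys d Ax) {s : F} {A : Set V} (h : Ax s A) : Cvx d A := by
  obtain ⟨P, rfl, hP, -⟩ := S.line s A h
  rintro _ ⟨i, rfl⟩ _ ⟨j, rfl⟩ m hm
  exact ⟨_, (line_mid S.td hP i j m hm).symm⟩

theorem zpow_line {s : F} {P : ℤ → V} (hs : ∀ i, s • P i = P (i + 36)) (e : ℤ) (i : ℤ) :
    s ^ e • P i = P (i + 36 * e) := by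
  induction e using Int.induction_on generalizing i with
  | zero => simp
  | succ n ih =>
    rw [zpow_add_one, mul_smul, hs, ih]; congr 1; ring
  | pred n ih =>
    have : s⁻¹ • P i = P (i - 36) := by
      rw [inv_smul_eq_iff, hs]; simp
    rw [zpow_sub_one, mul_smul, this, ih]; congr 1; ring

theorem zpow_mem (S : Sys d Ax) {s : F} {A : Set V} (h : Ax s A) (e : ℤ) {p : V} (hp : p ∈ A) :
    s ^ e • p ∈ A := by
  obtain ⟨P, rfl, hP, hs⟩ := S.line s A h
  obtain ⟨i, rfl⟩ := hp
  rw [zpow_line hs]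
  exact ⟨_, rfl⟩

theorem zpow_smul (S : Sys d Ax) {s : F} {A : Set V} (h : Ax s A) (e : ℤ) : s ^ e • A = A := by
  ext x
  rw [Set.mem_smul_set_iff_inv_smul_mem, ← zpow_neg]
  refine ⟨fun hx => ?_, fun hx => S.zpow_mem h _ hx⟩
  have := S.zpow_mem h e hx
  rwa [← mul_smul, ← zpow_add, add_neg_cancel, zpow_zero, one_smul] at this

theorem zpow_dist (S : Sys d Ax) {s : F} {A : Set V} (h : Ax s A) (e : ℤ) (he : e ≠ 0) {p : V}
    (hp : p ∈ A) : 36 ≤ d p (s ^ e • p) := by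
  obtain ⟨P, rfl, hP, hs⟩ := S.line s A h
  obtain ⟨i, rfl⟩ := hp
  rw [zpow_line hs]
  have h1 := hP i (i + 36 * e)
  rcases abs_cases (i - (i + 36 * e)) with h2 | h2 <;> omega

theorem unb (S : Sys d Ax) {s : F} {A : Set V} (h : Ax s A) (n : ℕ) :
    ∃ p ∈ A, ∃ q ∈ A, n ≤ d p q := by
  obtain ⟨P, rfl, hP, hs⟩ := S.line s A h
  refine ⟨_, ⟨0, rfl⟩, _, ⟨n, rfl⟩, ?_⟩
  have h1 := hP 0 n
  rcases abs_cases ((0:ℤ) - n) with h2 | h2 <;> omega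

theorem ax_inj (S : Sys d Ax) {s t : F} {A : Set V} (h : Ax s A) (h' : Ax t A) : s = t := by
  obtain ⟨p, hp, q, hq, hpq⟩ := S.unb h 5
  exact (S.small s A t A h h' p q hp hq hp hq hpq).1

theorem conj_back (S : Sys d Ax) {g s : F} {A : Set V} (h : Ax s A) :
    Ax (g⁻¹ * s * g) (g⁻¹ • A) := by
  simpa using S.conj g⁻¹ s A h

theorem ov (S : Sys d Ax) {s t : F} {A B : Set V} (h : Ax s A) (h' : Ax t B) (hne : A ≠ B)
    {p q : V} (h1 : p ∈ A) (h2 : q ∈ A) (h3 : p ∈ B) (h4 : q ∈ B) : d p q ≤ 4 := by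
  by_contra hc
  exact hne (S.small s A t B h h' p q h1 h2 h3 h4 (by omega)).2

end Sys

section core
variable {V : Type u} {F : Type v} [Group F] [MulAction F V] {d : V → V → ℕ}
    {Ax : F → Set V → Prop}

/-- subgroup generated by the axes elements contained in `W` -/
def NW (Ax : F → Set V → Prop) (W : Set V) : Subgroup F :=
  Subgroup.closure {s | ∃ A, Ax s A ∧ A ⊆ W}

/-- Greendlinger property of an element -/
def Gr (d : V → V → ℕ) (Ax : F → Set V → Prop) (o : V) (n : F) : Prop :=
  ∃ s A, Ax s A ∧ ∃ p ∈ A, ∃ q ∈ A, 24 ≤ d p q ∧ d o p + d p q + d q (n • o) = d o (n • o)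

structure Good (d : V → V → ℕ) (Ax : F → Set V → Prop) (o : V) (W : Set V) : Prop where
  base : o ∈ W
  cvx : Cvx d W
  inv : ∀ n ∈ NW Ax W, ∀ x ∈ W, n • x ∈ W
  thin : ∀ s A, Ax s A → ¬ A ⊆ W → ∀ p ∈ A, ∀ q ∈ A, p ∈ W → q ∈ W → d p q ≤ 8
  gr : ∀ n ∈ NW Ax W, n ≠ 1 → Gr d Ax o n

/-- axes attached to `W` -/
def At (Ax : F → Set V → Prop) (W : Set V) (s : F) (A : Set V) : Prop :=
  Ax s A ∧ ¬ A ⊆ W ∧ ∃ z ∈ A, z ∈ W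

theorem Good.bridge (S : Sys d Ax) {o : V} {W : Set V} (hW : Good d Ax o W) {s : F} {A : Set V}
    (hA : At Ax W s A) {e : ℤ} (he : e ≠ 0) :
    ∃ a ∈ A, a ∈ W ∧ ∃ b ∈ A, b ∈ W ∧ 28 ≤ d a (s ^ e • b) ∧
      (∀ x ∈ W, d x a + d a (s ^ e • b) = d x (s ^ e • b)) ∧
      ∀ x ∈ W, d a (s ^ e • b) + d (s ^ e • b) (s ^ e • x) = d a (s ^ e • x) := by
  obtain ⟨hax, hns, z, hzA, hzW⟩ := hA
  obtain ⟨a, haW, ha⟩ := exists_gate S.td hW.cvx ⟨z, hzW⟩ (s ^ e • z)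
  have haA : a ∈ A := S.cvx hax z hzA _ (S.zpow_mem hax e hzA) a (ha z hzW)
  obtain ⟨b, hbW, hb⟩ := exists_gate S.td hW.cvx ⟨z, hzW⟩ (s ^ (-e) • a)
  have hbA : b ∈ A := S.cvx hax z hzA _ (S.zpow_mem hax (-e) haA) b (hb z hzW)
  have hb' : ∀ x ∈ W, d a (s ^ e • b) + d (s ^ e • b) (s ^ e • x) = d a (s ^ e • x) := by
    intro x hx
    have h1 := hb x hx
    rw [← S.iso (s ^ e) x b, ← S.iso (s ^ e) b, ← S.iso (s ^ e) x, ← mul_smul,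
      ← zpow_add, add_neg_cancel, zpow_zero, one_smul] at h1
    rw [S.td.comm a, S.td.comm (s ^ e • b) (s ^ e • x), S.td.comm a]
    omega
  refine ⟨a, haA, haW, b, hbA, hbW, ?_, ?_, hb'⟩
  · have h1 := S.zpow_dist hax e he hbA
    have h2 := hW.thin s A hax hns b hbA a haA hbW haW
    have h3 := S.td.tri b (s ^ e • b) a
    omega
  · intro x hx
    have h1 := ha x hx
    have h2 := hb' z hzW
    have h3 := S.td.tri x (s ^ e • b) a
    have h4 := S.td.tri x (s ^ e • z) (s ^ e • b)
    omega

/-- Points reached from `W` through the axis `A`. -/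
inductive Reach (Ax : F → Set V → Prop) (W : Set V) : Set V → V → Prop
  | base {s A} {e : ℤ} {y} : At Ax W s A → e ≠ 0 → y ∈ W → Reach Ax W A (s ^ e • y)
  | side {s A t B} {e : ℤ} {y} : At Ax W s A → e ≠ 0 → At Ax W t B → A ≠ B → y ∈ B →
      Reach Ax W A (s ^ e • y)
  | cons {s A B} {e : ℤ} {y} : At Ax W s A → e ≠ 0 → A ≠ B → Reach Ax W B y →
      Reach Ax W A (s ^ e • y)

theorem Reach.at' {W A : Set V} {y : V} (h : Reach Ax W A y) : ∃ s, At Ax W s A := by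
  cases h <;> exact ⟨_, by assumption⟩

theorem key_aux (S : Sys d Ax) {o : V} {W : Set V} (hW : Good d Ax o W) {s : F} {A : Set V}
    (hA : At Ax W s A) {e : ℤ} (he : e ≠ 0) (y : V)
    (hy : ∀ b ∈ A, b ∈ W → (∀ a, (∀ x ∈ W, d a b + d b x = d a x) →
      a ∈ A → ∀ c, d b c + d c a = d b a → d b c + d c y = d b y → d b c ≤ 4)) :
    ∃ a ∈ A, a ∈ W ∧ ∃ c ∈ A, 24 ≤ d a c ∧
      ∀ x ∈ W, d x a + d a c + d c (s ^ e • y) = d x (s ^ e • y) := by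
  obtain ⟨a, haA, haW, b, hbA, hbW, h28, h1, h2⟩ := hW.bridge S hA he
  obtain ⟨c, c1, c2, c3⟩ := S.td.med a (s ^ e • b) (s ^ e • y)
  have hcA : c ∈ A := S.cvx hA.1 a haA _ (S.zpow_mem hA.1 e hbA) c c1
  have hinv : ∀ z : V, s ^ e • (s ^ (-e) • z) = z := fun z => by
    rw [← mul_smul, ← zpow_add, add_neg_cancel, zpow_zero, one_smul]
  have h4 : d (s ^ e • b) c ≤ 4 := by
    have := hy b hbA hbW (s ^ (-e) • a) ?_ (S.zpow_mem hA.1 _ haA) (s ^ (-e) • c) ?_ ?_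
    · rwa [← S.iso (s ^ e), hinv] at this
    · intro x hx
      have := h2 x hx
      rw [← S.iso (s ^ e) _ b, ← S.iso (s ^ e) b x, ← S.iso (s ^ e) _ x, hinv]
      exact this
    · rw [← S.iso (s ^ e) b, ← S.iso (s ^ e) _ (s ^ (-e) • a), ← S.iso (s ^ e) b, hinv, hinv]
      rw [S.td.comm _ c, S.td.comm c a, S.td.comm _ a]; omega
    · rw [← S.iso (s ^ e) b, ← S.iso (s ^ e) _ y, ← S.iso (s ^ e) b, hinv]
      exact c2
  have h5 := S.td.comm c (s ^ e • b)
  refine ⟨a, haA, haW, c, hcA, by omega, fun x hx => ?_⟩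
  apply S.td.glue _ c3
  · rintro rfl
    have := S.td.self a
    omega
  · have h6 := h1 x hx
    have h7 := S.td.tri x c a
    have h8 := S.td.tri x (s ^ e • b) c
    omega

theorem reach_key (S : Sys d Ax) {o : V} {W : Set V} (hW : Good d Ax o W) {A : Set V} {y : V}
    (h : Reach Ax W A y) : ∃ a ∈ A, a ∈ W ∧ ∃ c ∈ A, 24 ≤ d a c ∧
      ∀ x ∈ W, d x a + d a c + d c y = d x y := by
  have T := S.td
  induction h with
  | @base s A e y hA he hy =>
    refine key_aux S hW hA he y ?_
    intro b hbA hbW a ha haA c h1 h2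
    have h3 := ha y hy
    have h4 := T.tri a y c
    have h5 := T.comm a c
    have h6 := T.comm b a
    have h7 := T.comm b c
    omega
  | @side s A t B e y hA he hB hne hy =>
    refine key_aux S hW hA he y ?_
    intro b hbA hbW a ha haA c h1 h2
    obtain ⟨g, hgW, hg⟩ := exists_gate T hW.cvx ⟨_, hW.base⟩ y
    obtain ⟨hBx, -, z, hzB, hzW⟩ := hB
    have hgB : g ∈ B := S.cvx hBx z hzB y hy g (hg z hzW)
    by_cases hgb : b = g
    · subst hgb
      have hcA : c ∈ A := S.cvx hA.1 b hbA a haA c h1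
      have hcB : c ∈ B := S.cvx hBx b hgB y hy c h2
      exact S.ov hA.1 hBx hne hbA hcA hgB hcB
    · have h3 := T.glue (ha g hgW) (hg b hbW) hgb
      have h4 := T.tri a y c
      have h5 := T.comm a c
      have h6 := T.comm b a
      have h7 := T.comm b c
      have h8 := T.tri b y g
      omega
  | @cons s A B e y hA he hne hR ih =>
    obtain ⟨t, hB⟩ := hR.at'
    obtain ⟨a2, ha2B, ha2W, c2, hc2B, h24, h4⟩ := ih
    refine key_aux S hW hA he y ?_
    intro b hbA hbW a ha haA c h1 h2
    have g1 := h4 b hbW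
    by_cases hgb : b = a2
    · subst hgb
      by_contra hlt
      obtain ⟨z, z1, z2⟩ := T.geo b c 5 (by omega)
      have g2 := T.self b
      have hzA : z ∈ A := by
        refine S.cvx hA.1 b hbA a haA z ?_
        have := T.tri z a c
        have := T.tri b a z
        omega
      have hzB : z ∈ B := by
        refine S.cvx hB.1 b ha2B c2 hc2B z ?_
        obtain ⟨z', k1, k2⟩ := T.geo b c2 5 (by omega)
        have e1 := T.tri z' y c2
        have e2 := T.tri b y z'
        have e3 := T.tri z y c
        have e4 := T.tri b y z
        have : z = z' := T.uniq (x := b) (y := y) (by omega) (by omega) (by omega)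
        subst this
        omega
      have := S.ov hA.1 hB.1 hne hbA hzA ha2B hzB
      omega
    · have e1 := T.tri a2 y c2
      have e2 := T.tri b y a2
      have h3 := T.glue (ha a2 ha2W) (y := y) (by omega) hgb
      have h4 := T.tri a y c
      have h5 := T.comm a c
      have h6 := T.comm b a
      have h7 := T.comm b c
      have h8 := T.tri b y a2
      omega

end core
end AmalgamFormalization

namespace AmalgamFormalization
section core2
variable {V : Type u} {F : Type v} [Group F] [MulAction F V] {d : V → V → ℕ}
    {Ax : F → Set V → Prop}

theorem TD.split (T : TD d) {x y m : V} (z : V) (h : d x m + d m y = d x y) :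
    d x m + d m z = d x z ∨ d z m + d m y = d z y := by
  have h1 := T.four x y m z
  have h2 := T.tri x z m
  have h3 := T.tri z y m
  have h4 := T.comm z m
  have h5 := T.comm y m
  have h6 := T.comm z y
  omega

theorem overlap_side (S : Sys d Ax) {o : V} {W : Set V} (hW : Good d Ax o W) {t : F} {B : Set V}
    (hB : Ax t B) (hdis : ∀ z ∈ B, z ∉ W) {s1 : F} {A1 : Set V} (h1 : At Ax W s1 A1) (hne1 : A1 ≠ B)
    {p q : V} (hp : p ∈ A1) (hpB : p ∈ B) (hqB : q ∈ B)
    {s2 : F} {A2 : Set V} (h2 : At Ax W s2 A2) (hne2 : A2 ≠ B) (hq : q ∈ A2) : d p q ≤ 8 := by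
  have T := S.td
  obtain ⟨h1x, -, z1, hz1, hz1W⟩ := h1
  obtain ⟨h2x, -, z2, hz2, hz2W⟩ := h2
  obtain ⟨a, haW, ha⟩ := exists_gate T hW.cvx ⟨_, hW.base⟩ p
  obtain ⟨b, hbW, hb⟩ := exists_gate T hW.cvx ⟨_, hW.base⟩ q
  have haA : a ∈ A1 := S.cvx h1x z1 hz1 p hp a (ha z1 hz1W)
  have hbA : b ∈ A2 := S.cvx h2x z2 hz2 q hq b (hb z2 hz2W)
  by_cases hab : a = b
  · subst hab
    obtain ⟨m, m1, m2, m3⟩ := T.med p a q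
    have k1 := S.ov h1x hB hne1 hp (S.cvx h1x p hp a haA m m1) hpB (S.cvx hB p hpB q hqB m m3)
    have k2 := S.ov h2x hB hne2 hq (S.cvx h2x a hbA q hq m m2) hqB (S.cvx hB p hpB q hqB m m3)
    have := T.comm m q
    omega
  · exfalso
    have k1 := T.glue (x := p) (a := a) (c := b) (y := q)
      (by have := ha b hbW; have := T.comm p a; have := T.comm b a; have := T.comm p b; omega)
      (hb a haW) hab
    have k2 := T.tri a q b
    have k3 := T.tri p q a
    exact hdis a (S.cvx hB p hpB q hqB a (by omega)) haW

theorem overlap_reach (S : Sys d Ax) {o : V} {W : Set V} (hW : Good d Ax o W) {t : F} {B : Set V}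
    (hB : Ax t B) (hdis : ∀ z ∈ B, z ∉ W) {s1 : F} {A1 : Set V} (h1 : At Ax W s1 A1)
    {p q : V} (hp : p ∈ A1) (hpB : p ∈ B) (hqB : q ∈ B)
    {A : Set V} (hR : Reach Ax W A q) (hne : A ≠ A1) (hneB : A ≠ B) : False := by
  have T := S.td
  obtain ⟨s, hA⟩ := hR.at'
  obtain ⟨h1x, -, z1, hz1, hz1W⟩ := h1
  obtain ⟨a, haA, haW, c, hcA, h24, hk⟩ := reach_key S hW hR
  obtain ⟨g, hgW, hg⟩ := exists_gate T hW.cvx ⟨_, hW.base⟩ p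
  have hgA : g ∈ A1 := S.cvx h1x z1 hz1 p hp g (hg z1 hz1W)
  have g1 := hk g hgW
  have g0 := hk a haW
  have g00 := T.self a
  by_cases hga : g = a
  · subst hga
    obtain ⟨m, m1, m2, m3⟩ := T.med p g q
    have hmA1 : m ∈ A1 := S.cvx h1x p hp g hgA m m1
    have hmB : m ∈ B := S.cvx hB p hpB q hqB m m3
    -- m is close to g
    have hgm : d g m ≤ 4 := by
      by_contra hlt
      obtain ⟨z, z1, z2⟩ := T.geo g m 5 (by omega)
      obtain ⟨z', k1, k2⟩ := T.geo g c 5 (by omega)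
      have e1 := T.tri z' q c
      have e2 := T.tri g q z'
      have e3 := T.tri z q m
      have e4 := T.tri g q z
      have : z = z' := T.uniq (x := g) (y := q) (by omega) (by omega) (by omega)
      subst this
      have hz1 : z ∈ A1 := S.cvx h1x g hgA m hmA1 z (by omega)
      have hz2 : z ∈ A := S.cvx hA.1 g haA c hcA z (by omega)
      have := S.ov hA.1 h1x hne haA hz2 hgA hz1
      omega
    have hcB : c ∈ B := by
      refine S.cvx hB m hmB q hqB c ?_
      have := T.four g c m q
      have := T.four m c g q
      have := T.comm g m
      have := T.comm g c
      have := T.tri m q c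
      have := T.tri g c m
      have := T.comm c m
      have := T.comm c q
      omega
    have hmA : m ∈ A := by
      refine S.cvx hA.1 g haA c hcA m ?_
      have := T.four g c m q
      have := T.four m c g q
      have := T.tri g c m
      have := T.comm c m
      have := T.comm c q
      have := T.comm g m
      have := T.comm g c
      omega
    have := S.ov hA.1 hB hneB hmA hcA hmB hcB
    have := T.tri g c m
    omega
  · have k1 := T.glue (x := p) (a := g) (c := a) (y := q)
      (by have := hg a haW; have := T.comm p g; have := T.comm a g; have := T.comm p a; omega)
      (by have := T.tri a q c; have := T.tri g q a; omega) hga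
    have k2 := T.tri g q a
    have k3 := T.tri p q g
    exact hdis g (S.cvx hB p hpB q hqB g (by omega)) hgW

/-- the enlarged group -/
def NE (Ax : F → Set V → Prop) (W : Set V) : Subgroup F :=
  Subgroup.closure ({n | n ∈ NW Ax W} ∪ {s | ∃ A, At Ax W s A})

def ZE (Ax : F → Set V → Prop) (W : Set V) : Set V :=
  {z | z ∈ W ∨ ∃ s A, At Ax W s A ∧ z ∈ A}

def WE (Ax : F → Set V → Prop) (W : Set V) : Set V :=
  {y | ∃ n ∈ NE Ax W, ∃ z ∈ ZE Ax W, y = n • z}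

def Pt (Ax : F → Set V → Prop) (W : Set V) (y : V) : Prop :=
  y ∈ W ∨ (∃ s A, At Ax W s A ∧ y ∈ A) ∨ ∃ A, Reach Ax W A y

theorem At.conj (S : Sys d Ax) {o : V} {W : Set V} (hW : Good d Ax o W) {s : F} {A : Set V}
    (h : At Ax W s A) {k : F} (hk : k ∈ NW Ax W) : At Ax W (k * s * k⁻¹) (k • A) := by
  obtain ⟨h1, h2, z, hz, hzW⟩ := h
  refine ⟨S.conj k s A h1, fun hc => h2 fun x hx => ?_, k • z, Set.smul_mem_smul_set hz,
    hW.inv k hk z hzW⟩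
  have := hW.inv k⁻¹ (inv_mem hk) (k • x) (hc (Set.smul_mem_smul_set hx))
  rwa [inv_smul_smul] at this

theorem conj_zpow_smul {s k : F} (e : ℤ) (y : V) :
    k • (s ^ e • y) = (k * s * k⁻¹) ^ e • (k • y) := by
  rw [conj_zpow]; simp [mul_smul]

theorem Reach.conj (S : Sys d Ax) {o : V} {W : Set V} (hW : Good d Ax o W) {A : Set V} {y : V}
    (h : Reach Ax W A y) {k : F} (hk : k ∈ NW Ax W) : Reach Ax W (k • A) (k • y) := by
  induction h with
  | base hA he hy => rw [conj_zpow_smul]; exact .base (hA.conj S hW hk) he (hW.inv k hk _ hy)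
  | side hA he hB hne hy =>
    rw [conj_zpow_smul]
    exact .side (hA.conj S hW hk) he (hB.conj S hW hk) (by simpa using hne)
      (Set.smul_mem_smul_set hy)
  | cons hA he hne hR ih =>
    rw [conj_zpow_smul]
    exact .cons (hA.conj S hW hk) he (by simpa using hne) ih

theorem Pt.conj (S : Sys d Ax) {o : V} {W : Set V} (hW : Good d Ax o W) {y : V}
    (h : Pt Ax W y) {k : F} (hk : k ∈ NW Ax W) : Pt Ax W (k • y) := by
  rcases h with h | ⟨s, A, hA, h⟩ | ⟨A, h⟩
  · exact .inl (hW.inv k hk y h)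
  · exact .inr (.inl ⟨_, _, hA.conj S hW hk, Set.smul_mem_smul_set h⟩)
  · exact .inr (.inr ⟨_, h.conj S hW hk⟩)

/-- decomposing a point reached through `A` -/
theorem Reach.tail {W A : Set V} {y : V} (h : Reach Ax W A y) :
    ∃ s, At Ax W s A ∧ ∃ e : ℤ, e ≠ 0 ∧ ∃ y', y = s ^ e • y' ∧
      (y' ∈ W ∨ (∃ t B, At Ax W t B ∧ A ≠ B ∧ y' ∈ B) ∨ ∃ B, A ≠ B ∧ Reach Ax W B y') := by
  cases h with
  | base hA he hy => exact ⟨_, hA, _, he, _, rfl, .inl hy⟩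
  | side hA he hB hne hy => exact ⟨_, hA, _, he, _, rfl, .inr (.inl ⟨_, _, hB, hne, hy⟩)⟩
  | cons hA he hne hR => exact ⟨_, hA, _, he, _, rfl, .inr (.inr ⟨_, hne, hR⟩)⟩

theorem Pt.of_tail {W A : Set V} {y : V} {s : F} {e : ℤ} (hA : At Ax W s A) (h : 
      (y ∈ W ∨ (∃ t B, At Ax W t B ∧ A ≠ B ∧ y ∈ B) ∨ ∃ B, A ≠ B ∧ Reach Ax W B y)) :
    Pt Ax W (s ^ e • y) := by
  by_cases he : e = 0
  · subst he
    rw [zpow_zero, one_smul]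
    rcases h with h | ⟨t, B, hB, hne, hy⟩ | ⟨B, hne, hR⟩
    · exact .inl h
    · exact .inr (.inl ⟨_, _, hB, hy⟩)
    · exact .inr (.inr ⟨_, hR⟩)
  · rcases h with h | ⟨t, B, hB, hne, hy⟩ | ⟨B, hne, hR⟩
    · exact .inr (.inr ⟨_, .base hA he h⟩)
    · exact .inr (.inr ⟨_, .side hA he hB hne hy⟩)
    · exact .inr (.inr ⟨_, .cons hA he hne hR⟩)

theorem Pt.zpow (S : Sys d Ax) {W : Set V} {y : V}
    (h : Pt Ax W y) {s : F} {A : Set V} (hA : At Ax W s A) (e : ℤ) : Pt Ax W (s ^ e • y) := by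
  rcases h with h | ⟨t, B, hB, h⟩ | ⟨B, h⟩
  · exact .of_tail hA (.inl h)
  · by_cases hAB : A = B
    · subst hAB
      exact .inr (.inl ⟨_, _, hA, S.zpow_mem hA.1 e h⟩)
    · exact .of_tail hA (.inr (.inl ⟨_, _, hB, hAB, h⟩))
  · by_cases hAB : A = B
    · subst hAB
      obtain ⟨s', hA', e', he', y', rfl, hy'⟩ := h.tail
      have : s' = s := S.ax_inj hA'.1 hA.1
      subst this
      rw [← mul_smul, ← zpow_add]
      exact .of_tail hA hy'
    · exact .of_tail hA (.inr (.inr ⟨_, hAB, h⟩))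

/-- an inductive principle for `NE` -/
theorem NE_ind {W : Set V} {X : Type*} [MulAction F X] (Q : X → Prop)
    (h1 : ∀ k ∈ NW Ax W, ∀ y, Q y → Q (k • y))
    (h2 : ∀ s A, At Ax W s A → ∀ (e : ℤ) y, Q y → Q (s ^ e • y)) :
    ∀ n ∈ NE Ax W, ∀ y, Q y → Q (n • y) := by
  have : ∀ n ∈ NE Ax W, ∀ y, Q y ↔ Q (n • y) := by
    intro n hn
    induction hn using Subgroup.closure_induction with
    | mem g hg =>
      intro y
      rcases hg with hg | ⟨A, hA⟩
      · exact ⟨h1 g hg y, fun h => by simpa using h1 g⁻¹ (inv_mem hg) _ h⟩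
      · exact ⟨fun h => by simpa using h2 g A hA 1 y h,
          fun h => by simpa using h2 g A hA (-1) _ h⟩
    | one => simp
    | mul a b _ _ ha hb => intro y; rw [mul_smul]; exact (hb y).trans (ha _)
    | inv a _ ha => intro y; simpa using (ha (a⁻¹ • y)).symm
  exact fun n hn y => (this n hn y).1

theorem WE_pt (S : Sys d Ax) {o : V} {W : Set V} (hW : Good d Ax o W) {y : V}
    (hy : y ∈ WE Ax W) : Pt Ax W y := by
  obtain ⟨n, hn, z, hz, rfl⟩ := hy
  refine NE_ind (Pt Ax W) (fun k hk y h => h.conj S hW hk) (fun s A hA e y h => h.zpow S hA e)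
    n hn z ?_
  rcases hz with hz | hz
  · exact .inl hz
  · exact .inr (.inl hz)

theorem WE_inv {W : Set V} {n : F} (hn : n ∈ NE Ax W) {y : V} (hy : y ∈ WE Ax W) :
    n • y ∈ WE Ax W := by
  obtain ⟨n', hn', z, hz, rfl⟩ := hy
  exact ⟨n * n', mul_mem hn hn', z, hz, by rw [mul_smul]⟩

theorem NW_le_NE {W : Set V} : NW Ax W ≤ NE Ax W :=
  fun _ hx => Subgroup.subset_closure (.inl hx)

theorem At.mem_NE {W A : Set V} {s : F} (h : At Ax W s A) : s ∈ NE Ax W :=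
  Subgroup.subset_closure (.inr ⟨A, h⟩)

/-- thinness and classification of axes in the enlarged set -/
theorem WE_thin (S : Sys d Ax) {o : V} {W : Set V} (hW : Good d Ax o W) {t : F} {B : Set V}
    (hB : Ax t B) {p q : V} (hpB : p ∈ B) (hqB : q ∈ B) (hp : p ∈ WE Ax W) (hq : q ∈ WE Ax W)
    (hpq : 9 ≤ d p q) : B ⊆ WE Ax W ∧ t ∈ NE Ax W := by
  by_contra hcon
  -- no translate of `B` meets `W` or is attached
  have key : ∀ n ∈ NE Ax W, ¬ (n • B ⊆ WE Ax W ∧ n * t * n⁻¹ ∈ NE Ax W) := by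
    rintro n hn ⟨h1, h2⟩
    refine hcon ⟨fun x hx => ?_, ?_⟩
    · have := WE_inv (inv_mem hn) (h1 (Set.smul_mem_smul_set hx))
      rwa [inv_smul_smul] at this
    · have := mul_mem (mul_mem (inv_mem hn) h2) hn
      simpa [mul_assoc] using this
  have hat : ∀ n ∈ NE Ax W, ∀ s, ¬ At Ax W s (n • B) := by
    intro n hn s hs
    refine key n hn ⟨fun x hx => ⟨1, one_mem _, x, .inr ⟨_, _, hs, hx⟩, by simp⟩, ?_⟩
    rw [← S.ax_inj hs.1 (S.conj n t B hB)]
    exact hs.mem_NE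
  have hdis : ∀ n ∈ NE Ax W, ∀ z ∈ n • B, z ∉ W := by
    intro n hn z hz hzW
    by_cases hsub : n • B ⊆ W
    · refine key n hn ⟨fun x hx => ⟨1, one_mem _, x, .inl (hsub hx), by simp⟩, ?_⟩
      exact NW_le_NE (Subgroup.subset_closure ⟨_, S.conj n t B hB, hsub⟩)
    · exact hat n hn _ ⟨S.conj n t B hB, hsub, z, hz, hzW⟩
  obtain ⟨n, hn, z, hz, rfl⟩ := hp
  have hn' := inv_mem hn
  have hzB : z ∈ n⁻¹ • B := by
    rw [Set.mem_smul_set_iff_inv_smul_mem, inv_inv]; exact hpB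
  have hqB' : n⁻¹ • q ∈ n⁻¹ • B := Set.smul_mem_smul_set hqB
  have hq' := WE_inv hn' hq
  rw [← S.iso n⁻¹, inv_smul_smul] at hpq
  rcases hz with hz | ⟨s1, A1, hA1, hz⟩
  · exact hdis _ hn' z hzB hz
  have hne : ∀ m ∈ NE Ax W, ∀ s A, At Ax W s A → A ≠ m • B := by
    rintro m hm s A hA rfl
    exact hat _ hm _ hA
  rcases WE_pt S hW hq' with h | ⟨s2, A2, hA2, h⟩ | ⟨A, hR⟩
  · exact hdis _ hn' _ hqB' h
  · have := overlap_side S hW (S.conj _ _ _ hB) (hdis _ hn') hA1 (hne _ hn' _ _ hA1) hz hzB hqB' hA2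
      (hne _ hn' _ _ hA2) h
    omega
  · obtain ⟨s, hA, e, he, y', hy', htail⟩ := hR.tail
    by_cases hAA : A = A1
    · subst hAA
      have hm : s ^ (-e) * n⁻¹ ∈ NE Ax W := mul_mem (zpow_mem hA.mem_NE _) hn'
      have e1 : s ^ (-e) • z ∈ (s ^ (-e) * n⁻¹) • B := by
        rw [mul_smul]; exact Set.smul_mem_smul_set hzB
      have e2 : y' ∈ (s ^ (-e) * n⁻¹) • B := by
        have : y' = s ^ (-e) • n⁻¹ • q := by rw [hy', ← mul_smul, ← zpow_add]; simp
        rw [this, mul_smul]; exact Set.smul_mem_smul_set hqB'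
      have e3 : s ^ (-e) • z ∈ A := S.zpow_mem hA.1 _ hz
      rcases htail with h | ⟨t', B', hB', hne', h⟩ | ⟨B', hne', h⟩
      · exact hdis _ hm _ e2 h
      · have := overlap_side S hW (S.conj _ _ _ hB) (hdis _ hm) hA (hne _ hm _ _ hA) e3 e1 e2 hB'
          (hne _ hm _ _ hB') h
        rw [hy', ← S.iso (s ^ (-e)), ← mul_smul _ _ y', ← zpow_add] at hpq
        simp only [neg_add_cancel, zpow_zero, one_smul] at hpq
        omega
      · obtain ⟨_, hB'⟩ := h.at'
        exact overlap_reach S hW (S.conj _ _ _ hB) (hdis _ hm) hA e3 e1 e2 h hne'.symm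
          (hne _ hm _ _ hB')
    · exact overlap_reach S hW (S.conj _ _ _ hB) (hdis _ hn') hA1 hz hzB hqB' hR hAA
          (hne _ hn' _ _ hA)

/-- reduced words -/
inductive Ch (Ax : F → Set V → Prop) (W : Set V) : Set V → F → Prop
  | base {s A} {e : ℤ} {k} : At Ax W s A → e ≠ 0 → k ∈ NW Ax W → Ch Ax W A (s ^ e * k)
  | cons {s A B} {e : ℤ} {n} : At Ax W s A → e ≠ 0 → A ≠ B → Ch Ax W B n → Ch Ax W A (s ^ e * n)

theorem Ch.reach {o : V} {W A : Set V} (hW : Good d Ax o W) {n : F} (h : Ch Ax W A n) :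
    Reach Ax W A (n • o) := by
  induction h with
  | base hA he hk => rw [mul_smul]; exact .base hA he (hW.inv _ hk _ hW.base)
  | cons hA he hne _ ih => rw [mul_smul]; exact .cons hA he hne ih

theorem conj_zpow_mul {s k : F} (e : ℤ) (y : F) :
    k * (s ^ e * y) = (k * s * k⁻¹) ^ e * (k * y) := by
  rw [conj_zpow]; group

theorem Ch.conj (S : Sys d Ax) {o : V} {W : Set V} (hW : Good d Ax o W) {A : Set V} {n : F}
    (h : Ch Ax W A n) {k : F} (hk : k ∈ NW Ax W) : Ch Ax W (k • A) (k * n) := by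
  induction h with
  | base hA he hy => rw [conj_zpow_mul]; exact .base (hA.conj S hW hk) he (mul_mem hk hy)
  | cons hA he hne hR ih =>
    rw [conj_zpow_mul]
    exact .cons (hA.conj S hW hk) he (by simpa using hne) ih

theorem Ch.of_tail {W A : Set V} {n s : F} {e : ℤ} (hA : At Ax W s A) (h : 
      (n ∈ NW Ax W ∨ ∃ B, A ≠ B ∧ Ch Ax W B n)) :
    s ^ e * n ∈ NW Ax W ∨ ∃ A, Ch Ax W A (s ^ e * n) := by
  by_cases he : e = 0
  · subst he
    rw [zpow_zero, one_mul]
    rcases h with h | ⟨B, hne, hR⟩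
    · exact .inl h
    · exact .inr ⟨_, hR⟩
  · rcases h with h | ⟨B, hne, hR⟩
    · exact .inr ⟨_, .base hA he h⟩
    · exact .inr ⟨_, .cons hA he hne hR⟩

theorem NE_ch (S : Sys d Ax) {o : V} {W : Set V} (hW : Good d Ax o W) {n : F}
    (hn : n ∈ NE Ax W) : n ∈ NW Ax W ∨ ∃ A, Ch Ax W A n := by
  have := NE_ind (X := F) (fun n => n ∈ NW Ax W ∨ ∃ A, Ch Ax W A n)
    (fun k hk y h => ?_) (fun s A hA e y h => ?_) n hn 1 (.inl (one_mem _))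
  · simpa using this
  · rcases h with h | ⟨A, h⟩
    · exact .inl (mul_mem hk h)
    · exact .inr ⟨_, h.conj S hW hk⟩
  · rw [smul_eq_mul]
    rcases h with h | ⟨B, h⟩
    · exact Ch.of_tail hA (.inl h)
    · by_cases hAB : A = B
      · subst hAB
        cases h with
        | base hA' he hk =>
          rw [← S.ax_inj hA.1 hA'.1, ← mul_assoc, ← zpow_add]
          exact Ch.of_tail hA (.inl hk)
        | cons hA' he hne hR =>
          rw [← S.ax_inj hA.1 hA'.1, ← mul_assoc, ← zpow_add]
          exact Ch.of_tail hA (.inr ⟨_, hne, hR⟩)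
      · exact Ch.of_tail hA (.inr ⟨_, hAB, h⟩)

theorem ZE_cvx (S : Sys d Ax) {o : V} {W : Set V} (hW : Good d Ax o W) : Cvx d (ZE Ax W) := by
  have T := S.td
  have hz : ∀ x ∈ ZE Ax W, ∃ z ∈ W, ∀ m, d x m + d m z = d x z → m ∈ ZE Ax W := by
    rintro x (hx | ⟨s, A, hA, hx⟩)
    · exact ⟨x, hx, fun m hm => .inl (hW.cvx x hx x hx m hm)⟩
    · obtain ⟨z, hz, hzW⟩ := hA.2.2
      exact ⟨z, hzW, fun m hm => .inr ⟨s, A, hA, S.cvx hA.1 x hx z hz m hm⟩⟩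
  intro x hx y hy m hm
  obtain ⟨z1, h1, k1⟩ := hz x hx
  obtain ⟨z2, h2, k2⟩ := hz y hy
  rcases T.split z1 hm with h | h
  · exact k1 m h
  · rcases T.split z2 h with h | h
    · exact .inl (hW.cvx z1 h1 z2 h2 m h)
    · refine k2 m ?_
      rw [T.comm y m, T.comm m z2, T.comm y z2]; omega

theorem WE_cvx (S : Sys d Ax) {o : V} {W : Set V} (hW : Good d Ax o W) : Cvx d (WE Ax W) := by
  have T := S.td
  have hZ : ∀ z ∈ ZE Ax W, z ∈ WE Ax W := fun z hz => ⟨1, one_mem _, z, hz, by simp⟩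
  have ho : o ∈ ZE Ax W := .inl hW.base
  have key : ∀ n ∈ NE Ax W, ∀ x ∈ ZE Ax W, ∀ y ∈ ZE Ax W, ∀ m,
      d x m + d m (n • y) = d x (n • y) → m ∈ WE Ax W := by
    intro n hn
    induction hn using Subgroup.closure_induction with
    | mem g hg =>
      intro x hx y hy m hm
      rcases hg with hg | ⟨A, hA⟩
      · refine hZ _ (ZE_cvx S hW x hx _ ?_ m hm)
        rcases hy with hy | ⟨s, B, hB, hy⟩
        · exact .inl (hW.inv g hg y hy)
        · exact .inr ⟨_, _, hB.conj S hW hg, Set.smul_mem_smul_set hy⟩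
      · obtain ⟨z, hz, hzW⟩ := hA.2.2
        rcases T.split (g • z) hm with h | h
        · refine hZ _ (ZE_cvx S hW x hx _ (.inr ⟨_, _, hA, ?_⟩) m h)
          simpa using S.zpow_mem hA.1 1 hz
        · have : g⁻¹ • m ∈ WE Ax W := by
            refine hZ _ (ZE_cvx S hW z (.inl hzW) y hy _ ?_)
            rw [← S.iso g z, ← S.iso g _ y, ← S.iso g z, smul_inv_smul]; exact h
          simpa using WE_inv hA.mem_NE this
    | one => intro x hx y hy m hm; rw [one_smul] at hm; exact hZ _ (ZE_cvx S hW x hx y hy m hm)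
    | mul a b ha' hb' ha hb =>
      intro x hx y hy m hm
      rcases T.split (a • o) hm with h | h
      · exact ha x hx o ho m h
      · have : a⁻¹ • m ∈ WE Ax W := by
          refine hb o ho y hy _ ?_
          rw [← S.iso a o, ← S.iso a _ (b • y), ← S.iso a o, smul_inv_smul, ← mul_smul]; exact h
        simpa using WE_inv ha' this
    | inv a ha' ha =>
      intro x hx y hy m hm
      have : a • m ∈ WE Ax W := by
        refine ha y hy x hx _ ?_
        rw [← S.iso a⁻¹ y, ← S.iso a⁻¹ _ (a • x), ← S.iso a⁻¹ y, inv_smul_smul, inv_smul_smul]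
        rw [T.comm _ m, T.comm m x, T.comm _ x]; omega
      simpa using WE_inv (inv_mem ha') this
  rintro _ ⟨n, hn, x, hx, rfl⟩ _ ⟨n', hn', y, hy, rfl⟩ m hm
  have : n⁻¹ • m ∈ WE Ax W := by
    refine key (n⁻¹ * n') (mul_mem (inv_mem hn) hn') x hx y hy _ ?_
    rw [← S.iso n x, ← S.iso n _ ((n⁻¹ * n') • y), ← S.iso n x, smul_inv_smul, ← mul_smul,
      mul_inv_cancel_left]
    exact hm
  simpa using WE_inv hn this

theorem WE_good (S : Sys d Ax) {o : V} {W : Set V} (hW : Good d Ax o W) : Good d Ax o (WE Ax W) := by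
  have hle : NW Ax (WE Ax W) ≤ NE Ax W := by
    refine (Subgroup.closure_le _).2 ?_
    rintro t ⟨B, hB, hsub⟩
    obtain ⟨p, hp, q, hq, hpq⟩ := S.unb hB 9
    exact (WE_thin S hW hB hp hq (hsub hp) (hsub hq) hpq).2
  refine ⟨⟨1, one_mem _, o, .inl hW.base, by simp⟩, WE_cvx S hW,
    fun n hn x hx => WE_inv (hle hn) hx, ?_, ?_⟩
  · intro s A hA hns p hp q hq hpW hqW
    by_contra hlt
    exact hns (WE_thin S hW hA hp hq hpW hqW (by omega)).1
  · intro n hn h1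
    rcases NE_ch S hW (hle hn) with h | ⟨A, h⟩
    · exact hW.gr n h h1
    · have hR := h.reach hW
      obtain ⟨s, hA⟩ := hR.at'
      obtain ⟨a, ha, haW, c, hc, h24, hk⟩ := reach_key S hW hR
      exact ⟨s, A, hA.1, a, ha, c, hc, h24, hk o hW.base⟩

/-- adding an orbit of leaves -/
theorem leaf_good (S : Sys d Ax) {o : V} {W : Set V} (hW : Good d Ax o W)
    (hno : ∀ s A, ¬ At Ax W s A) (u w : V) (hw : w ∈ W) (huw : d w u = 1) :
    Good d Ax o (W ∪ {y | ∃ n ∈ NW Ax W, y = n • u}) := by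
  have T := S.td
  set W' : Set V := W ∪ {y | ∃ n ∈ NW Ax W, y = n • u}
  have hpar : ∀ y ∈ W', ∃ z ∈ W, d z y ≤ 1 := by
    rintro y (hy | ⟨n, hn, rfl⟩)
    · exact ⟨y, hy, by rw [T.self]; omega⟩
    · exact ⟨n • w, hW.inv n hn w hw, by rw [S.iso, huw]⟩
  have hmid : ∀ x ∈ W', ∀ y ∈ W', ∀ m, d x m + d m y = d x y → m ∈ W ∨ m = x ∨ m = y := by
    intro x hx y hy m hm
    obtain ⟨z, hz, hzx⟩ := hpar x hx
    obtain ⟨z', hz', hzy⟩ := hpar y hy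
    have aux : ∀ a b, a ∈ W → d a b ≤ 1 → d b m + d m a = d b a → m ∈ W ∨ m = b := by
      intro a b ha hab h
      have h1 := T.comm a b
      by_cases h0 : d m a = 0
      · exact .inl (T.eq0 _ _ h0 ▸ ha)
      · exact .inr (T.eq0 _ _ (by omega)).symm
    rcases T.split z hm with h | h
    · rcases aux z x hz hzx h with h | h
      · exact .inl h
      · exact .inr (.inl h)
    · rcases T.split z' h with h | h
      · exact .inl (hW.cvx z hz z' hz' m h)
      · rcases aux z' y hz' hzy (by rw [T.comm y m, T.comm m z', T.comm y z']; omega) with h | h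
        · exact .inl h
        · exact .inr (.inr h)
  have hthin : ∀ s A, Ax s A → ¬ A ⊆ W → ∀ p ∈ A, ∀ q ∈ A, p ∈ W' → q ∈ W' → d p q ≤ 8 := by
    intro s A hA hns p hp q hq hpW hqW
    by_contra hlt
    obtain ⟨m, h1, h2⟩ := T.geo p q 1 (by omega)
    have hm : m ∈ A := S.cvx hA p hp q hq m (by omega)
    rcases hmid p hpW q hqW m (by omega) with h | h | h
    · exact hno s A ⟨hA, hns, m, hm, h⟩
    · subst h; rw [T.self] at h1; omega
    · subst h; rw [T.self] at h2; omega
  have hle : NW Ax W' ≤ NW Ax W := by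
    refine (Subgroup.closure_le _).2 ?_
    rintro t ⟨B, hB, hsub⟩
    by_cases hBW : B ⊆ W
    · exact Subgroup.subset_closure ⟨B, hB, hBW⟩
    · obtain ⟨p, hp, q, hq, hpq⟩ := S.unb hB 9
      have := hthin t B hB hBW p hp q hq (hsub hp) (hsub hq)
      omega
  refine ⟨.inl hW.base, ?_, ?_, ?_, fun n hn => hW.gr n (hle hn)⟩
  · intro x hx y hy m hm
    rcases hmid x hx y hy m hm with h | rfl | rfl
    · exact .inl h
    · exact hx
    · exact hy
  · rintro n hn x (hx | ⟨n', hn', rfl⟩)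
    · exact .inl (hW.inv n (hle hn) x hx)
    · exact .inr ⟨n * n', mul_mem (hle hn) hn', by rw [mul_smul]⟩
  · intro s A hA hns
    exact hthin s A hA fun h => hns (h.trans Set.subset_union_left)

theorem init_good (S : Sys d Ax) (o : V) : Good d Ax o {o} := by
  have T := S.td
  have hle : NW Ax ({o} : Set V) ≤ ⊥ := by
    refine (Subgroup.closure_le _).2 ?_
    rintro t ⟨B, hB, hsub⟩
    obtain ⟨p, hp, q, hq, hpq⟩ := S.unb hB 9
    have e1 : p = o := hsub hp
    have e2 : q = o := hsub hq
    rw [e1, e2, T.self] at hpq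
    omega
  refine ⟨rfl, ?_, ?_, ?_, ?_⟩
  · rintro x rfl y rfl m hm
    rw [T.self] at hm
    exact (T.eq0 _ _ (by omega)).symm
  · intro n hn x hx
    have : n = 1 := hle hn
    rw [this, one_smul]; exact hx
  · rintro s A hA - p hp q hq rfl rfl
    rw [T.self]; omega
  · intro n hn h1
    exact absurd (hle hn) h1

theorem chain_good (S : Sys d Ax) (o : V) (c : Set (Set V)) (hc : ∀ W ∈ c, Good d Ax o W)
    (hch : IsChain (· ⊆ ·) c) (hne : c.Nonempty) : Good d Ax o (⋃₀ c) := by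
  have dir : ∀ x ∈ ⋃₀ c, ∀ y ∈ ⋃₀ c, ∃ W ∈ c, x ∈ W ∧ y ∈ W := by
    rintro x ⟨W, hW, hx⟩ y ⟨W', hW', hy⟩
    rcases hch.total hW hW' with h | h
    · exact ⟨W', hW', h hx, hy⟩
    · exact ⟨W, hW, hx, h hy⟩
  have hmono : ∀ W W' : Set V, W ⊆ W' → NW Ax W ≤ NW Ax W' := fun W W' h =>
    Subgroup.closure_mono fun s ⟨A, hA, hs⟩ => ⟨A, hA, hs.trans h⟩
  have hthin : ∀ s A, Ax s A → ¬ (∃ W ∈ c, A ⊆ W) → ∀ p ∈ A, ∀ q ∈ A, p ∈ ⋃₀ c → q ∈ ⋃₀ c →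
      d p q ≤ 8 := by
    intro s A hA hns p hp q hq hpW hqW
    obtain ⟨W, hW, h1, h2⟩ := dir p hpW q hqW
    exact (hc W hW).thin s A hA (fun h => hns ⟨W, hW, h⟩) p hp q hq h1 h2
  have hN : ∀ n ∈ NW Ax (⋃₀ c), ∃ W ∈ c, n ∈ NW Ax W := by
    intro n hn
    induction hn using Subgroup.closure_induction with
    | mem g hg =>
      obtain ⟨A, hA, hsub⟩ := hg
      by_cases h : ∃ W ∈ c, A ⊆ W
      · obtain ⟨W, hW, h⟩ := h
        exact ⟨W, hW, Subgroup.subset_closure ⟨A, hA, h⟩⟩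
      · obtain ⟨p, hp, q, hq, hpq⟩ := S.unb hA 9
        have := hthin g A hA h p hp q hq (hsub hp) (hsub hq)
        omega
    | one => obtain ⟨W, hW⟩ := hne; exact ⟨W, hW, one_mem _⟩
    | mul a b _ _ ha hb =>
      obtain ⟨W, hW, h1⟩ := ha
      obtain ⟨W', hW', h2⟩ := hb
      rcases hch.total hW hW' with h | h
      · exact ⟨W', hW', mul_mem (hmono _ _ h h1) h2⟩
      · exact ⟨W, hW, mul_mem h1 (hmono _ _ h h2)⟩
    | inv a _ ha => obtain ⟨W, hW, h1⟩ := ha; exact ⟨W, hW, inv_mem h1⟩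
  refine ⟨?_, ?_, ?_, ?_, ?_⟩
  · obtain ⟨W, hW⟩ := hne; exact ⟨W, hW, (hc W hW).base⟩
  · intro x hx y hy m hm
    obtain ⟨W, hW, h1, h2⟩ := dir x hx y hy
    exact ⟨W, hW, (hc W hW).cvx x h1 y h2 m hm⟩
  · rintro n hn x ⟨W', hW', hx⟩
    obtain ⟨W, hW, h1⟩ := hN n hn
    rcases hch.total hW hW' with h | h
    · exact ⟨W', hW', (hc W' hW').inv n (hmono _ _ h h1) x hx⟩
    · exact ⟨W, hW, (hc W hW).inv n h1 x (h hx)⟩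
  · intro s A hA hns
    exact hthin s A hA fun ⟨W, hW, h⟩ => hns (h.trans (Set.subset_sUnion_of_mem hW))
  · intro n hn h1
    obtain ⟨W, hW, h2⟩ := hN n hn
    exact (hc W hW).gr n h2 h1

/-- Greendlinger's lemma for systems of axes. -/
theorem greendlinger (S : Sys d Ax) (o : V) (n : F)
    (hn : n ∈ Subgroup.closure {s | ∃ A, Ax s A}) (h1 : n ≠ 1) : Gr d Ax o n := by
  have T := S.td
  obtain ⟨W, -, hmax⟩ := zorn_subset_nonempty {W | Good d Ax o W}
    (fun c hc hch hne => ⟨⋃₀ c, chain_good S o c (fun W hW => hc hW) hch hne,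
      fun s hs => Set.subset_sUnion_of_mem hs⟩) {o} (init_good S o)
  have hW : Good d Ax o W := hmax.prop
  have hno : ∀ s A, ¬ At Ax W s A := by
    intro s A hA
    have hsub : W ⊆ WE Ax W := fun x hx => ⟨1, one_mem _, x, .inl hx, by simp⟩
    have h2 := hmax.le_of_ge (WE_good S hW) hsub
    exact hA.2.1 fun x hx => h2 ⟨1, one_mem _, x, .inr ⟨s, A, hA, hx⟩, by simp⟩
  have huniv : ∀ x, x ∈ W := by
    intro x
    by_contra hx
    obtain ⟨a, ha, hg⟩ := exists_gate T hW.cvx ⟨o, hW.base⟩ x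
    have h0 : d a x ≠ 0 := fun h => hx (T.eq0 _ _ h ▸ ha)
    obtain ⟨u, u1, u2⟩ := T.geo a x 1 (by omega)
    have hu : u ∉ W := by
      intro hu
      have := hg u hu
      have := T.comm u a
      omega
    have h2 := hmax.le_of_ge (leaf_good S hW hno u a ha u1) Set.subset_union_left
    exact hu (h2 (.inr ⟨1, one_mem _, by simp⟩))
  refine hW.gr n (Subgroup.closure_mono ?_ hn) h1
  rintro s ⟨A, hA⟩
  exact ⟨A, hA, fun x _ => huniv x⟩

end core2
end AmalgamFormalization

namespace AmalgamFormalization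
section core3
variable {V : Type u} {T : SimpleGraph V}

theorem tree_adj (hT : T.IsTree) (o : V) {u v : V} (h : T.Adj u v) :
    T.dist o u = T.dist o v + 1 ∨ T.dist o v = T.dist o u + 1 := by
  have h1 := hT.dist_ne_of_adj o h
  have h2 := hT.connected.dist_triangle (u := o) (v := v) (w := u)
  have h3 := hT.connected.dist_triangle (u := o) (v := u) (w := v)
  have h4 := SimpleGraph.dist_eq_one_iff_adj.mpr h
  have h5 := SimpleGraph.dist_eq_one_iff_adj.mpr h.symm
  omega

theorem tree_uniq (hT : T.IsTree) (o : V) {x y z : V} (hy : T.Adj x y) (hz : T.Adj x z)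
    (h1 : T.dist o x = T.dist o y + 1) (h2 : T.dist o x = T.dist o z + 1) : y = z := by
  obtain ⟨p, hp⟩ := hT.connected.exists_walk_length_eq_dist o y
  obtain ⟨q, hq⟩ := hT.connected.exists_walk_length_eq_dist o z
  have e1 : (p.concat hy.symm).IsPath := SimpleGraph.Walk.isPath_of_length_eq_dist _ (by simp [*])
  have e2 : (q.concat hz.symm).IsPath := SimpleGraph.Walk.isPath_of_length_eq_dist _ (by
    simp [hq, h2])
  have := (hT.isAcyclic.subsingleton_path o x).elim ⟨_, e1⟩ ⟨_, e2⟩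
  have h3 : (p.concat hy.symm) = (q.concat hz.symm) := by simpa using this
  have h4 := congrArg SimpleGraph.Walk.penultimate h3
  simpa using h4

theorem tree_closer (hT : T.IsTree) {x y : V} (h : x ≠ y) :
    ∃ z, T.Adj x z ∧ T.dist y x = T.dist y z + 1 := by
  obtain ⟨p, hp⟩ := hT.connected.exists_walk_length_eq_dist x y
  cases p with
  | nil => exact absurd rfl h
  | cons h' q =>
    rename_i z
    refine ⟨z, h', ?_⟩
    have h1 := tree_adj hT y h'
    have h2 := SimpleGraph.dist_le q
    rw [SimpleGraph.dist_comm] at h2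
    rw [SimpleGraph.dist_comm, SimpleGraph.Walk.length_cons] at hp
    omega

theorem tree_split (hT : T.IsTree) (x y : V) : ∀ (n : ℕ) (a c : V), T.dist y c = n → T.Adj a c →
    T.dist x c = T.dist x a + 1 → T.dist y a = T.dist y c + 1 →
    T.dist x y = T.dist x a + 1 + T.dist y c := by
  intro n
  induction n with
  | zero =>
    intro a c hn hac h1 h2
    have : y = c := (hT.connected.dist_eq_zero_iff).mp hn
    subst this
    omega
  | succ n ih =>
    intro a c hn hac h1 h2
    have hcy : c ≠ y := by rintro rfl; simp at hn
    obtain ⟨z, hz, hz2⟩ := tree_closer hT hcy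
    have hza : z ≠ a := by rintro rfl; omega
    have h3 := tree_adj hT x hz
    have h4 : T.dist x z = T.dist x c + 1 := by
      rcases h3 with h3 | h3
      · exact absurd (tree_uniq hT x hz hac.symm h3 (by omega)) hza
      · exact h3
    have := ih c z (by omega) hz h4 (by omega)
    omega

theorem tree_line (hT : T.IsTree) (P : ℤ → V) (h1 : ∀ i, T.Adj (P i) (P (i + 1)))
    (h2 : ∀ i, P i ≠ P (i + 2)) (i j : ℤ) : (T.dist (P i) (P j) : ℤ) = |i - j| := by
  have key : ∀ (i : ℤ) (n : ℕ), T.dist (P i) (P (i + n)) = n ∧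
      T.dist (P i) (P (i + n + 1)) = n + 1 := by
    intro i n
    induction n with
    | zero => simpa using h1 i
    | succ n ih =>
      obtain ⟨ih1, ih2⟩ := ih
      have e : i + ((n + 1 : ℕ) : ℤ) = i + n + 1 := by push_cast; ring
      rw [e]
      refine ⟨ih2, ?_⟩
      rcases tree_adj hT (P i) (h1 (i + n + 1)) with h | h
      · exfalso
        have := tree_uniq hT (P i) (h1 (i + n + 1)) (h1 (i + n)).symm h (by omega)
        exact h2 (i + n) (by rw [← this]; congr 1; ring)
      · omega
  rcases le_total i j with h | h
  · have := (key i (j - i).toNat).1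
    rw [show i + ((j - i).toNat : ℤ) = j by omega] at this
    rw [this, abs_of_nonpos (by omega)]; omega
  · have := (key j (i - j).toNat).1
    rw [show j + ((i - j).toNat : ℤ) = i by omega, SimpleGraph.dist_comm] at this
    rw [this, abs_of_nonneg (by omega)]; omega

theorem tree_induct (hT : T.IsTree) (x : V) (p : V → Prop) (h0 : p x)
    (hs : ∀ a c, T.Adj a c → p a → p c) (y : V) : p y := by
  obtain ⟨w⟩ := hT.connected.preconnected x y
  induction w with
  | nil => exact h0
  | cons h q ih => exact ih (hs _ _ h h0)

theorem tree_four (hT : T.IsTree) (x y z w : V) :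
    T.dist x y + T.dist z w ≤ max (T.dist x z + T.dist y w) (T.dist x w + T.dist y z) := by
  have key : ∀ w, T.dist x y + T.dist z w ≤ max (T.dist x z + T.dist y w) (T.dist x w + T.dist y z)
    ∧ T.dist x z + T.dist y w ≤ max (T.dist x y + T.dist z w) (T.dist x w + T.dist y z)
    ∧ T.dist x w + T.dist y z ≤ max (T.dist x y + T.dist z w) (T.dist x z + T.dist y w) := by
    refine tree_induct hT x _ ?_ ?_
    · have h1 : T.dist y x = T.dist x y := T.dist_comm
      have h2 : T.dist z x = T.dist x z := T.dist_comm
      have h3 : T.dist x x = 0 := T.dist_self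
      have h4 := hT.connected.dist_triangle (u := y) (v := x) (w := z)
      omega
    · intro a c h ⟨i1, i2, i3⟩
      have a1 := tree_adj hT x h
      have a2 := tree_adj hT y h
      have a3 := tree_adj hT z h
      have s1 := tree_split hT x y _ a c rfl h
      have s2 := tree_split hT y x _ a c rfl h
      have s3 := tree_split hT x z _ a c rfl h
      have s4 := tree_split hT z x _ a c rfl h
      have s5 := tree_split hT y z _ a c rfl h
      have s6 := tree_split hT z y _ a c rfl h
      have c1 : T.dist y x = T.dist x y := T.dist_comm
      have c2 : T.dist z x = T.dist x z := T.dist_comm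
      have c3 : T.dist z y = T.dist y z := T.dist_comm
      have t1 := hT.connected.dist_triangle (u := x) (v := a) (w := y)
      have t2 := hT.connected.dist_triangle (u := x) (v := c) (w := y)
      have t3 := hT.connected.dist_triangle (u := x) (v := a) (w := z)
      have t4 := hT.connected.dist_triangle (u := x) (v := c) (w := z)
      have t5 := hT.connected.dist_triangle (u := y) (v := a) (w := z)
      have t6 := hT.connected.dist_triangle (u := y) (v := c) (w := z)
      have c4 : T.dist a y = T.dist y a := T.dist_comm
      have c5 : T.dist a z = T.dist z a := T.dist_comm
      have c6 : T.dist c y = T.dist y c := T.dist_comm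
      have c7 : T.dist c z = T.dist z c := T.dist_comm
      rcases a1 with a1 | a1 <;> rcases a2 with a2 | a2 <;> rcases a3 with a3 | a3 <;> omega
  exact (key w).1

theorem tree_TD (hT : T.IsTree) : TD T.dist := by
  have geo : ∀ (k : ℕ) (x y : V), k ≤ T.dist x y →
      ∃ z, T.dist x z = k ∧ k + T.dist z y = T.dist x y := by
    intro k
    induction k with
    | zero => intro x y _; exact ⟨x, by simp⟩
    | succ k ih =>
      intro x y hk
      obtain ⟨z, z1, z2⟩ := ih x y (by omega)
      have hzy : z ≠ y := by rintro rfl; omega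
      obtain ⟨w, w1, w2⟩ := tree_closer hT hzy
      have h1 := hT.connected.dist_triangle (u := x) (v := w) (w := y)
      have h2 := tree_adj hT x w1
      have h3 : T.dist y z = T.dist z y := T.dist_comm
      have h4 : T.dist y w = T.dist w y := T.dist_comm
      exact ⟨w, by omega, by omega⟩
  refine ⟨fun x y h => (hT.connected.dist_eq_zero_iff).mp h, fun x => T.dist_self,
    fun x y => T.dist_comm, tree_four hT, fun x y k => geo k x y, fun x y z => ?_⟩
  have par : ∀ z, (T.dist x y + T.dist y z + T.dist x z) % 2 = 0 := by
    refine tree_induct hT y _ ?_ ?_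
    · simp; omega
    · intro a c h hi
      have a1 := tree_adj hT x h
      have a2 := tree_adj hT y h
      omega
  have hp := par z
  have h1 := hT.connected.dist_triangle (u := x) (v := y) (w := z)
  have h2 := hT.connected.dist_triangle (u := x) (v := z) (w := y)
  have h3 := hT.connected.dist_triangle (u := y) (v := x) (w := z)
  have c1 : T.dist y x = T.dist x y := T.dist_comm
  have c2 : T.dist z x = T.dist x z := T.dist_comm
  have c3 : T.dist z y = T.dist y z := T.dist_comm
  obtain ⟨m, m1, m2⟩ := geo ((T.dist x y + T.dist x z - T.dist y z) / 2) x y (by omega)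
  have h4 := tree_four hT m z x y
  have h5 := hT.connected.dist_triangle (u := x) (v := m) (w := z)
  have h6 := hT.connected.dist_triangle (u := y) (v := m) (w := z)
  have c4 : T.dist m x = T.dist x m := T.dist_comm
  have c5 : T.dist m y = T.dist y m := T.dist_comm
  exact ⟨m, by omega, by omega, by omega⟩

theorem acyclic_of_nb (h : ∀ (v : ℕ → V) (k : ℕ), 1 ≤ k → (∀ i < k, T.Adj (v i) (v (i + 1))) →
    (∀ i, i + 2 ≤ k → v i ≠ v (i + 2)) → v 0 ≠ v k) : T.IsAcyclic := by
  intro v c hc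
  have h3 := hc.three_le_length
  refine h c.getVert c.length (by omega) (fun i hi => c.adj_getVert_succ hi) ?_ (by simp)
  intro i hi he
  by_cases h0 : i = 0
  · subst h0
    have := hc.getVert_injOn' (x₁ := 0) (x₂ := 2) (by simp) (by simp; omega) (by simpa using he)
    omega
  · have := hc.getVert_injOn (x₁ := i) (x₂ := i + 2) (by simp; omega) (by simp; omega) he
    omega

end core3
end AmalgamFormalization

namespace AmalgamFormalization
section core4
variable {F : Type u} [Group F] {L G : Subgroup F}

/-- the two factors -/
def fac (L G : Subgroup F) : Bool → Subgroup F
  | true => L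
  | false => G

/-- alternating words -/
def Alt (L G : Subgroup F) : Bool → List F → Prop
  | _, [] => True
  | b, x :: w => x ∈ fac L G b ∧ x ∉ fac L G (!b) ∧ Alt L G (!b) w

theorem Alt.canon : ∀ (w : List F) (b : Bool), Alt L G b w → IsCanonicalWord L G w := by
  intro w
  induction w with
  | nil => intro b _; exact ⟨by simp, List.isChain_nil⟩
  | cons x w ih =>
    rintro b ⟨h1, h2, h3⟩
    obtain ⟨i1, i2⟩ := ih _ h3
    refine ⟨?_, ?_⟩
    · intro y hy
      rcases List.mem_cons.mp hy with rfl | hy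
      · cases b
        · exact .inr h1
        · exact .inl h1
      · exact i1 y hy
    · cases w with
      | nil => exact List.isChain_singleton _
      | cons y w =>
        refine List.isChain_cons_cons.mpr ⟨?_, i2⟩
        obtain ⟨k1, k2, -⟩ := h3
        cases b <;> simp only [fac, Bool.not_true, Bool.not_false] at * <;>
          rintro (⟨a1, a2⟩ | ⟨a1, a2⟩) <;> tauto

theorem Alt.ne (hF : IsAmalgam L G) {w : List F} {b : Bool} (h : Alt L G b w) (hw : w ≠ []) :
    w.prod ≠ 1 := by
  match w, hw, h with
  | [x], _, h =>
    intro h1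
    rw [List.prod_singleton] at h1
    subst h1
    exact h.2.1 (one_mem _)
  | x :: y :: w, _, h => exact hF.2 _ (Alt.canon _ _ h) (by simp)

theorem Alt.not_mem (hF : IsAmalgam L G) {w : List F} {b : Bool} (h : Alt L G (!b) w)
    (hw : w ≠ []) : w.prod ∉ fac L G b := by
  intro hp
  by_cases hy : w.prod ∈ fac L G (!b)
  · cases w with
    | nil => exact hw rfl
    | cons x w =>
      obtain ⟨h1, h2, h3⟩ := h
      rw [Bool.not_not] at h2
      rw [List.prod_cons] at hp hy
      have : Alt L G (!b) (((x * w.prod)⁻¹ * x) :: w) :=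
        ⟨mul_mem (inv_mem hy) h1, by
          rw [Bool.not_not]; exact fun hc => h2 ((Subgroup.mul_mem_cancel_left _ (inv_mem hp)).mp hc), h3⟩
      refine this.ne hF (by simp) ?_
      simp
  · have : Alt L G b ((w.prod)⁻¹ :: w) := ⟨inv_mem hp, fun hc => hy (by simpa using hc), h⟩
    exact this.ne hF (by simp) (by simp)

/-- vertices of the tree -/
abbrev Vt (L G : Subgroup F) := (F ⧸ L) ⊕ (F ⧸ G)

def vert (L G : Subgroup F) : Bool → F → Vt L G
  | true, g => Sum.inl (g : F ⧸ L)
  | false, g => Sum.inr (g : F ⧸ G)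

theorem vert_eq {b : Bool} {g h : F} : vert L G b g = vert L G b h ↔ g⁻¹ * h ∈ fac L G b := by
  cases b <;> simp [vert, fac, QuotientGroup.eq]

theorem vert_type {b c : Bool} {g h : F} (e : vert L G b g = vert L G c h) : b = c := by
  cases b <;> cases c <;> simp [vert] at e ⊢

theorem smul_vert (b : Bool) (g h : F) : g • vert L G b h = vert L G b (g * h) := by
  cases b <;> rfl

theorem vert_surj (v : Vt L G) : ∃ b g, v = vert L G b g := by
  rcases v with v | v
  · obtain ⟨g, rfl⟩ := QuotientGroup.mk_surjective v; exact ⟨true, g, rfl⟩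
  · obtain ⟨g, rfl⟩ := QuotientGroup.mk_surjective v; exact ⟨false, g, rfl⟩

/-- The Bass-Serre tree -/
def tr (L G : Subgroup F) : SimpleGraph (Vt L G) where
  Adj u v := ∃ b g, u = vert L G b g ∧ v = vert L G (!b) g
  symm := by
    constructor
    rintro u v ⟨b, g, rfl, rfl⟩
    exact ⟨!b, g, rfl, by simp⟩
  loopless := by
    constructor
    rintro u ⟨b, g, h1, h2⟩
    have := vert_type (h1.symm.trans h2)
    cases b <;> simp at this

theorem nb_word (k : ℕ) : ∀ (v : ℕ → Vt L G) (b : Bool) (g : F),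
    (∀ i < k + 1, (tr L G).Adj (v i) (v (i + 1))) → (∀ i, i + 2 ≤ k + 1 → v i ≠ v (i + 2)) →
    v 0 = vert L G b g → v 1 = vert L G (!b) g →
    ∃ w b', Alt L G (!b) w ∧ w.length = k ∧ v (k + 1) = vert L G b' (g * w.prod) ∧
      (k = 0 → b' = !b) := by
  induction k with
  | zero =>
    intro v b g _ _ h0 h1
    exact ⟨[], !b, trivial, rfl, by simpa using h1, fun _ => rfl⟩
  | succ k ih =>
    intro v b g hadj hnb h0 h1
    obtain ⟨b1, g1, e1, e2⟩ := hadj 1 (by omega)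
    have hb : b1 = !b := (vert_type (h1.symm.trans e1)).symm
    subst hb
    have hx : g⁻¹ * g1 ∈ fac L G (!b) := vert_eq.mp (h1.symm.trans e1)
    have hx2 : g⁻¹ * g1 ∉ fac L G b := by
      intro hc
      refine hnb 0 (by omega) ?_
      rw [h0]
      rw [Bool.not_not] at e2
      exact (vert_eq.mpr hc).trans e2.symm
    obtain ⟨w, b', w1, w2, w3, -⟩ := ih (fun i => v (i + 1)) (!b) g1 (fun i hi => hadj (i + 1) (by omega))
      (fun i hi => hnb (i + 1) (by omega)) e1 e2
    refine ⟨(g⁻¹ * g1) :: w, b', ⟨hx, by rwa [Bool.not_not], w1⟩, by simp [w2], ?_, by simp⟩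
    rw [w3]; simp [mul_assoc]

theorem tr_connected (hF : IsAmalgam L G) : (tr L G).Connected := by
  have adj : ∀ b g, (tr L G).Reachable (vert L G b g) (vert L G (!b) g) := fun b g =>
    SimpleGraph.Adj.reachable ⟨b, g, rfl, rfl⟩
  have key : ∀ g : F, ∀ h : F, (tr L G).Reachable (vert L G true h) (vert L G true (h * g)) := by
    intro g
    have hg : g ∈ Subgroup.closure ((L : Set F) ∪ (G : Set F)) := by
      rw [Subgroup.closure_union, Subgroup.closure_eq, Subgroup.closure_eq, hF.1]; trivial
    induction hg using Subgroup.closure_induction with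
    | mem x hx =>
      intro h
      rcases hx with hx | hx
      · rw [vert_eq.mpr (show h⁻¹ * (h * x) ∈ fac L G true by simpa [fac] using hx)]
      · have e : vert L G false h = vert L G false (h * x) :=
          vert_eq.mpr (by simpa [fac] using hx)
        refine (adj true h).trans ?_
        have := (adj true (h * x)).symm
        simp only [Bool.not_true] at this ⊢
        rwa [e]
    | one => intro h; simp
    | mul x y _ _ i1 i2 => intro h; rw [← mul_assoc]; exact (i1 h).trans (i2 _)
    | inv x _ i => intro h; have := i (h * x⁻¹); rw [inv_mul_cancel_right] at this; exact this.symm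
  have key2 : ∀ v, (tr L G).Reachable (vert L G true 1) v := by
    intro v
    obtain ⟨b, g, rfl⟩ := vert_surj v
    have h1 := key g 1
    rw [one_mul] at h1
    cases b
    · exact h1.trans (adj true g)
    · exact h1
  have : Nonempty (Vt L G) := ⟨vert L G true 1⟩
  exact ⟨fun u v => (key2 u).symm.trans (key2 v)⟩

theorem tr_tree (hF : IsAmalgam L G) : (tr L G).IsTree := by
  refine ⟨tr_connected hF, acyclic_of_nb ?_⟩
  intro v k hk hadj hnb he
  obtain ⟨k, rfl⟩ : ∃ k', k = k' + 1 := ⟨k - 1, by omega⟩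
  obtain ⟨b, g, e1, e2⟩ := hadj 0 (by omega)
  obtain ⟨w, b', w1, w2, w3, w4⟩ := nb_word k v b g hadj hnb e1 e2
  rw [← he, e1] at w3
  have hb := vert_type w3
  subst hb
  have h1 : w ≠ [] := by
    rintro rfl
    have := w4 (by simpa using w2.symm)
    cases b <;> simp at this
  have := vert_eq.mp w3
  rw [inv_mul_cancel_left] at this
  exact w1.not_mem hF h1 this

theorem tr_iso (hF : IsAmalgam L G) (g : F) (x y : Vt L G) :
    (tr L G).dist (g • x) (g • y) = (tr L G).dist x y := by
  have key : ∀ (g : F) (x y : Vt L G), (tr L G).dist (g • x) (g • y) ≤ (tr L G).dist x y := by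
    intro g x y
    obtain ⟨p, hp⟩ := (tr_connected hF).exists_walk_length_eq_dist x y
    let f : tr L G →g tr L G := ⟨fun v => g • v, by
      rintro u v ⟨b, h, rfl, rfl⟩
      exact ⟨b, g * h, smul_vert _ _ _, smul_vert _ _ _⟩⟩
    have := SimpleGraph.dist_le (p.map f)
    rw [SimpleGraph.Walk.length_map, hp] at this
    exact this
  apply le_antisymm (key g x y)
  have := key g⁻¹ (g • x) (g • y)
  simpa using this

end core4
end AmalgamFormalization

namespace AmalgamFormalization
section core5
variable {F : Type u} [Group F] {L G : Subgroup F}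

theorem exists_rec (f : ℤ → F) : ∃ g : ℤ → F, g 0 = 1 ∧ ∀ k, g (k + 1) = g k * f k := by
  let a : ℕ → F := fun n => Nat.rec 1 (fun n x => x * f n) n
  let b : ℕ → F := fun n => Nat.rec 1 (fun n x => x * (f (-(n + 1 : ℤ)))⁻¹) n
  have ha : ∀ n, a (n + 1) = a n * f n := fun n => rfl
  have hb : ∀ n, b (n + 1) = b n * (f (-(n + 1 : ℤ)))⁻¹ := fun n => rfl
  refine ⟨fun k => if 0 ≤ k then a k.toNat else b (-k).toNat, by simp [a], fun k => ?_⟩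
  by_cases h : 0 ≤ k
  · simp only [h, if_true, show (0 : ℤ) ≤ k + 1 by omega]
    rw [show (k + 1).toNat = k.toNat + 1 by omega, ha, Int.toNat_of_nonneg h]
  · simp only [h, if_false]
    have e : (-k).toNat = (-(k + 1)).toNat + 1 := by omega
    rw [e, hb, show -(((-(k + 1)).toNat : ℤ) + 1) = k by omega, inv_mul_cancel_right]
    split_ifs with h2
    · have : k = -1 := by omega
      subst this
      simp [a, b]
    · rfl

theorem rec_list {f g : ℤ → F} (h0 : g 0 = 1) (hg : ∀ k, g (k + 1) = g k * f k) :
    ∀ (n : ℕ) (h : Fin n → F), (∀ i : Fin n, h i = f (i : ℕ)) → (List.ofFn h).prod = g n := by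
  intro n
  induction n with
  | zero => intro h _; simp [h0]
  | succ n ih =>
    intro h hh
    rw [List.ofFn_succ', List.concat_eq_append, List.prod_append,
      ih (fun i => h i.castSucc) (fun i => hh i.castSucc), List.prod_singleton, hh]
    push_cast
    rw [hg]

/-- bi-infinite reduced words -/
structure IsLn (L G : Subgroup F) (α β g : ℤ → F) : Prop where
  al : ∀ k, α k ∈ L
  ag : ∀ k, α k ∉ G
  bg : ∀ k, β k ∈ G
  bl : ∀ k, β k ∉ L
  rc : ∀ k, g (k + 1) = g k * α k * β k

/-- the line of a bi-infinite word -/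
def Pl (L G : Subgroup F) (α g : ℤ → F) (i : ℤ) : Vt L G :=
  if i % 2 = 0 then vert L G true (g (i / 2)) else vert L G false (g (i / 2) * α (i / 2))

theorem Pl_even {α g : ℤ → F} (k : ℤ) : Pl L G α g (2 * k) = vert L G true (g k) := by
  simp [Pl]

theorem Pl_odd {α g : ℤ → F} (k : ℤ) : Pl L G α g (2 * k + 1) = vert L G false (g k * α k) := by
  have h1 : (2 * k + 1) % 2 = 1 := by omega
  have h2 : (2 * k + 1) / 2 = k := by omega
  simp [Pl, h1, h2]

theorem Pl_type {α g : ℤ → F} (i : ℤ) : ∃ h, Pl L G α g i = vert L G (decide (i % 2 = 0)) h := by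
  unfold Pl
  split_ifs with h
  · exact ⟨_, by simp [h]; rfl⟩
  · exact ⟨_, by simp [h]; rfl⟩

theorem Pl_parity {α g α' g' : ℤ → F} {i j : ℤ} (h : Pl L G α g i = Pl L G α' g' j) :
    i % 2 = j % 2 := by
  obtain ⟨a, ha⟩ := Pl_type (L := L) (G := G) (α := α) (g := g) i
  obtain ⟨b, hb⟩ := Pl_type (L := L) (G := G) (α := α') (g := g') j
  have := vert_type (ha.symm.trans (h.trans hb))
  have h2 : (i % 2 = 0) ↔ (j % 2 = 0) := by simpa using this
  omega

theorem smul_Pl {α g : ℤ → F} (h : F) (i : ℤ) :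
    h • Pl L G α g i = Pl L G α (fun k => h * g k) i := by
  unfold Pl
  split_ifs <;> simp [smul_vert, mul_assoc]

theorem IsLn.pred {α β g : ℤ → F} (h : IsLn L G α β g) (k : ℤ) :
    Pl L G α g (2 * k - 1) = vert L G false (g k) := by
  rw [show 2 * k - 1 = 2 * (k - 1) + 1 by ring, Pl_odd, vert_eq]
  have := h.rc (k - 1)
  rw [sub_add_cancel] at this
  rw [this]
  simpa [fac, mul_assoc] using h.bg (k - 1)

theorem IsLn.line (hF : IsAmalgam L G) {α β g : ℤ → F} (h : IsLn L G α β g) (i j : ℤ) :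
    ((tr L G).dist (Pl L G α g i) (Pl L G α g j) : ℤ) = |i - j| := by
  refine tree_line (tr_tree hF) _ ?_ ?_ i j
  · intro i
    rcases Int.even_or_odd' i with ⟨k, rfl | rfl⟩
    · rw [Pl_even, Pl_odd]
      refine ⟨true, g k * α k, vert_eq.mpr ?_, rfl⟩
      simpa [fac] using h.al k
    · rw [show 2 * k + 1 + 1 = 2 * (k + 1) by ring, Pl_even,
        show 2 * k + 1 = 2 * (k + 1) - 1 by ring, h.pred]
      exact ⟨false, _, rfl, rfl⟩
  · intro i he
    rcases Int.even_or_odd' i with ⟨k, rfl | rfl⟩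
    · rw [show 2 * k + 2 = 2 * (k + 1) by ring, Pl_even, Pl_even, vert_eq, h.rc] at he
      simp only [mul_assoc, inv_mul_cancel_left, fac] at he
      exact h.bl k ((Subgroup.mul_mem_cancel_left _ (h.al k)).mp he)
    · rw [show 2 * k + 1 + 2 = 2 * (k + 1) + 1 by ring, Pl_odd, Pl_odd, vert_eq, h.rc] at he
      simp only [mul_assoc, inv_mul_cancel_left, mul_inv_rev, fac] at he
      exact h.ag (k + 1) ((Subgroup.mul_mem_cancel_left _ (h.bg k)).mp he)

theorem IsLn.smul {α β g : ℤ → F} (h : IsLn L G α β g) (a : F) :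
    IsLn L G α β (fun k => a * g k) :=
  ⟨h.al, h.ag, h.bg, h.bl, fun k => by simp [h.rc, mul_assoc]⟩

/-- Same double coset -/
def Rel (L G : Subgroup F) (a b : F) : Prop := ∃ h ∈ L ⊓ G, ∃ h' ∈ L ⊓ G, b = h * a * h'

theorem Rel.symm {a b : F} : Rel L G a b → Rel L G b a := by
  rintro ⟨h, hh, h', hh', rfl⟩
  exact ⟨h⁻¹, inv_mem hh, h'⁻¹, inv_mem hh', by group⟩

theorem Rel.trans {a b c : F} : Rel L G a b → Rel L G b c → Rel L G a c := by
  rintro ⟨h, hh, h', hh', rfl⟩ ⟨k, hk, k', hk', rfl⟩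
  exact ⟨k * h, mul_mem hk hh, h' * k', mul_mem hh' hk', by group⟩

theorem Rel.inv {a b : F} : Rel L G a b → Rel L G a⁻¹ b⁻¹ := by
  rintro ⟨h, hh, h', hh', rfl⟩
  exact ⟨h'⁻¹, inv_mem hh', h⁻¹, inv_mem hh, by group⟩

/-- turns at an `L`-vertex -/
def Turn (L G : Subgroup F) (a : F) (u v w : Vt L G) : Prop :=
  ∃ g, u = vert L G false g ∧ v = vert L G true g ∧ w = vert L G false (g * a)

theorem Turn.rev {a : F} (ha : a ∈ L) {u v w : Vt L G} : Turn L G a u v w → Turn L G a⁻¹ w v u := by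
  rintro ⟨g, rfl, rfl, rfl⟩
  exact ⟨g * a, rfl, vert_eq.mpr (by simpa [fac] using ha), by simp⟩

theorem Turn.smul {a : F} {u v w : Vt L G} (k : F) : Turn L G a u v w →
    Turn L G a (k • u) (k • v) (k • w) := by
  rintro ⟨g, rfl, rfl, rfl⟩
  exact ⟨k * g, smul_vert _ _ _, smul_vert _ _ _, by rw [smul_vert, mul_assoc]⟩

theorem Turn.rel {a b : F} (ha : a ∈ L) (hb : b ∈ L) {u v w : Vt L G} :
    Turn L G a u v w → Turn L G b u v w → Rel L G a b := by
  rintro ⟨g, rfl, rfl, rfl⟩ ⟨h, e1, e2, e3⟩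
  rw [vert_eq] at e1 e2 e3
  simp only [fac] at e1 e2 e3
  have e4 : a⁻¹ * (g⁻¹ * h) * b ∈ G := by simpa [mul_assoc] using e3
  have e5 : a⁻¹ * (g⁻¹ * h) * b ∈ L := mul_mem (mul_mem (inv_mem ha) e2) hb
  exact ⟨(g⁻¹ * h)⁻¹, inv_mem ⟨e2, e1⟩, _, ⟨e5, e4⟩, by group⟩

theorem IsLn.turn {α β g : ℤ → F} (h : IsLn L G α β g) (k : ℤ) :
    Turn L G (α k) (Pl L G α g (2 * k - 1)) (Pl L G α g (2 * k)) (Pl L G α g (2 * k + 1)) :=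
  ⟨g k, h.pred k, Pl_even k, Pl_odd k⟩

theorem line_overlap {V : Type u} {d : V → V → ℕ} (T : TD d) {P Q : ℤ → V}
    (hP : ∀ i j, (d (P i) (P j) : ℤ) = |i - j|) (hQ : ∀ i j, (d (Q i) (Q j) : ℤ) = |i - j|)
    {i i' j' D : ℤ} (hD : 0 ≤ D) (h1 : P i = Q i') (h2 : P (i + D) = Q j') :
    (∀ t, 0 ≤ t → t ≤ D → P (i + t) = Q (i' + t)) ∨
    (∀ t, 0 ≤ t → t ≤ D → P (i + t) = Q (i' - t)) := by
  have key : ∀ t, 0 ≤ t → t ≤ D → P (i + t) = Q (if i' ≤ j' then i' + t else i' - t) := by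
    intro t t0 tD
    have a1 := hP i (i + t)
    have a2 := hP (i + t) (i + D)
    have a3 := hP i (i + D)
    rw [abs_of_nonpos (by omega)] at a1 a2 a3
    have := line_mid T hQ i' j' (P (i + t)) (by rw [← h1, ← h2]; omega)
    rw [this, ← h1, show (d (P i) (P (i + t)) : ℤ) = t by omega]
  by_cases hij : i' ≤ j'
  · left; simpa [hij] using key
  · right; simpa [hij] using key

/-- aligned overlaps of two lines -/
theorem overlap_turns (hF : IsAmalgam L G) {α β g α' β' g' : ℤ → F} (h : IsLn L G α β g)
    (h' : IsLn L G α' β' g') {p q : Vt L G} (hp : p ∈ Set.range (Pl L G α g))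
    (hq : q ∈ Set.range (Pl L G α g)) (hp' : p ∈ Set.range (Pl L G α' g'))
    (hq' : q ∈ Set.range (Pl L G α' g')) (hd : 5 ≤ (tr L G).dist p q) :
    ∃ k k' : ℤ, (∀ t, -1 ≤ t → t ≤ 3 → Pl L G α g (2 * k + t) = Pl L G α' g' (2 * k' + t)) ∨
      (∀ t, -1 ≤ t → t ≤ 3 → Pl L G α g (2 * k + t) = Pl L G α' g' (2 * k' - t)) := by
  obtain ⟨i, rfl⟩ := hp
  obtain ⟨j, rfl⟩ := hq
  wlog hij : i ≤ j generalizing i j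
  · exact this j hq' i hp' (by rwa [SimpleGraph.dist_comm]) (by omega)
  obtain ⟨i', hi'⟩ := hp'
  obtain ⟨j', hj'⟩ := hq'
  have hl := h.line hF i j
  rw [abs_of_nonpos (by omega)] at hl
  have ov := line_overlap (D := j - i) (i := i) (i' := i') (j' := j') (tree_TD (tr_tree hF))
    (h.line hF) (h'.line hF)
    (by omega) hi'.symm (by rw [hj']; congr 1; ring)
  have par := Pl_parity hi'
  obtain ⟨k, hk⟩ : ∃ k, 2 * k - 1 = i ∨ 2 * k - 1 = i + 1 := ⟨(i + 2) / 2, by omega⟩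
  rcases ov with ov | ov
  · refine ⟨k, k + (i' - i) / 2, .inl fun t t1 t2 => ?_⟩
    have := ov (2 * k + t - i) (by omega) (by omega)
    convert this using 2
    · ring
    · omega
  · refine ⟨k, (i' + i) / 2 - k, .inr fun t t1 t2 => ?_⟩
    have := ov (2 * k + t - i) (by omega) (by omega)
    convert this using 2
    · ring
    · omega

theorem same_rel {α β g α' β' g' : ℤ → F} (h : IsLn L G α β g)
    (h' : IsLn L G α' β' g') {k k' : ℤ}
    (ho : ∀ t, -1 ≤ t → t ≤ 1 → Pl L G α g (2 * k + t) = Pl L G α' g' (2 * k' + t)) :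
    Rel L G (α k) (α' k') := by
  have t1 := h.turn k
  have t2 := h'.turn k'
  have e1 := ho (-1) (by omega) (by omega)
  have e2 := ho 0 (by omega) (by omega)
  have e3 := ho 1 (by omega) (by omega)
  simp only [add_zero, ← sub_eq_add_neg] at e1 e2 e3
  rw [e1, e2, e3] at t1
  exact t1.rel (h.al _) (h'.al _) t2

theorem opp_rel {α β g α' β' g' : ℤ → F} (h : IsLn L G α β g)
    (h' : IsLn L G α' β' g') {k k' : ℤ}
    (ho : ∀ t, -1 ≤ t → t ≤ 1 → Pl L G α g (2 * k + t) = Pl L G α' g' (2 * k' - t)) :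
    Rel L G (α k)⁻¹ (α' k') := by
  have t1 := h.turn k
  have t2 := h'.turn k'
  have e1 := ho (-1) (by omega) (by omega)
  have e2 := ho 0 (by omega) (by omega)
  have e3 := ho 1 (by omega) (by omega)
  simp only [add_zero, sub_zero, sub_neg_eq_add, ← sub_eq_add_neg] at e1 e2 e3
  rw [e1, e2, e3] at t1
  exact (t1.rev (h.al _)).rel (inv_mem (h.al _)) (h'.al _) t2

/-- index modulo 18 -/
def idx (k : ℤ) : Fin 18 := ⟨(k % 18).toNat, by omega⟩

theorem idx_eq {k k' : ℤ} : idx k = idx k' ↔ k % 18 = k' % 18 := by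
  unfold idx; rw [Fin.mk.injEq]; omega

/-- hypothesis bundle -/
structure Hyp (L G : Subgroup F) (A : Fin 18 → F) : Prop where
  am : IsAmalgam L G
  mal : MalnormalIn (L ⊓ G) L
  al : ∀ i, A i ∈ L ∧ A i ∉ L ⊓ G
  sep : HPMSeparated (L ⊓ G) A

variable {A : Fin 18 → F}

theorem Hyp.rel (h : Hyp L G A) {i j : Fin 18} (hr : Rel L G (A j) (A i)) : i = j := by
  by_contra hne
  obtain ⟨a, ha, b, hb, e⟩ := hr
  exact h.sep i j hne (.inl ⟨a * A j, ⟨a, ha, A j, rfl, rfl⟩, b, hb, e.symm⟩)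

theorem Hyp.rel' (h : Hyp L G A) {i j : Fin 18} (hr : Rel L G (A j)⁻¹ (A i)) : i = j := by
  by_contra hne
  obtain ⟨a, ha, b, hb, e⟩ := hr
  exact h.sep i j hne (.inr ⟨a * (A j)⁻¹, ⟨a, ha, _, rfl, rfl⟩, b, hb, e.symm⟩)

/-- axes of relators -/
def RAx (L G : Subgroup F) (A : Fin 18 → F) (s : F) (B : Set (Vt L G)) : Prop :=
  ∃ (x : F) (g : ℤ → F), IsLn L G (fun k => A (idx k)) (fun _ => x) g ∧
    s = g 18 * (g 0)⁻¹ ∧ B = Set.range (Pl L G (fun k => A (idx k)) g)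

theorem period {g : ℤ → F} {x : F} (h : IsLn L G (fun k => A (idx k)) (fun _ => x) g) (k : ℤ) :
    g (k + 18) = g 18 * (g 0)⁻¹ * g k := by
  have hi : ∀ k, idx (k + 18) = idx k := fun k => idx_eq.mpr (by omega)
  induction k using Int.induction_on with
  | zero => simp
  | succ n ih =>
    have h1 := h.rc (n + 18)
    have h2 := h.rc n
    rw [show (n : ℤ) + 1 + 18 = n + 18 + 1 by ring, h1, h2, ih, hi]
    group
  | pred n ih =>
    have h1 := h.rc (-n - 1 + 18)
    have h2 := h.rc (-n - 1)
    rw [show (-n - 1 + 18 : ℤ) + 1 = -n + 18 by ring, ih, hi] at h1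
    rw [sub_add_cancel] at h2
    rw [h2] at h1
    have h3 := congrArg (fun z => z * (A (idx (-n - 1)) * x)⁻¹) h1
    rw [show g (-n - 1 + 18) * A (idx (-n - 1)) * x * (A (idx (-n - 1)) * x)⁻¹ = g (-n - 1 + 18) by
      group] at h3
    rw [← h3]
    group

theorem Hyp.base_eq (h : Hyp L G A) {β g β' g' : ℤ → F}
    (h1 : IsLn L G (fun k => A (idx k)) β g) (h2 : IsLn L G (fun k => A (idx k)) β' g') {k k' : ℤ}
    (ho : ∀ t, -1 ≤ t → t ≤ 1 → Pl L G (fun k => A (idx k)) g (2 * k + t) =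
      Pl L G (fun k => A (idx k)) g' (2 * k' + t)) : idx k' = idx k ∧ g k = g' k' := by
  have hi : idx k' = idx k := h.rel (same_rel h1 h2 ho)
  refine ⟨hi, ?_⟩
  have t1 := h1.turn k
  have t2 := h2.turn k'
  have e1 := ho (-1) (by omega) (by omega)
  have e2 := ho 0 (by omega) (by omega)
  have e3 := ho 1 (by omega) (by omega)
  simp only [add_zero, ← sub_eq_add_neg] at e1 e2 e3
  rw [h1.pred, h2.pred, vert_eq] at e1
  rw [Pl_even, Pl_even, vert_eq] at e2
  rw [Pl_odd, Pl_odd, vert_eq, hi] at e3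
  simp only [fac] at e1 e2 e3
  have hal := h.al (idx k)
  have := h.mal (A (idx k))⁻¹ (inv_mem hal.1) (fun hc => hal.2 (by simpa using inv_mem hc))
    ((g k)⁻¹ * g' k') ⟨e2, e1⟩ ⟨by simpa using mul_mem (mul_mem (inv_mem hal.1) e2) hal.1,
      by simpa [mul_assoc] using e3⟩
  exact (inv_mul_eq_one.mp this)

theorem ln_uniq {α β g g' : ℤ → F} (h1 : ∀ k, g (k + 1) = g k * α k * β k)
    (h2 : ∀ k, g' (k + 1) = g' k * α k * β k) {k : ℤ} (h0 : g k = g' k) (j : ℤ) : g j = g' j := by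
  have hsucc : ∀ k, g k = g' k ↔ g (k + 1) = g' (k + 1) := by
    intro k; rw [h1, h2]; simp
  induction j using Int.inductionOn' (b := k) with
  | zero => exact h0
  | succ n _ ih => exact (hsucc n).mp ih
  | pred n _ ih => exact (hsucc (n - 1)).mpr (by simpa using ih)

theorem Hyp.sys (h : Hyp L G A) : Sys (tr L G).dist (RAx L G A) where
  td := tree_TD (tr_tree h.am)
  iso := tr_iso h.am
  conj := by
    rintro a s _ ⟨x, g, h1, rfl, rfl⟩
    refine ⟨x, fun k => a * g k, h1.smul a, by group, ?_⟩
    ext v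
    simp only [Set.mem_smul_set, Set.mem_range]
    constructor
    · rintro ⟨_, ⟨i, rfl⟩, rfl⟩; exact ⟨i, (smul_Pl a i).symm⟩
    · rintro ⟨i, rfl⟩; exact ⟨_, ⟨i, rfl⟩, smul_Pl a i⟩
  line := by
    rintro s _ ⟨x, g, h1, rfl, rfl⟩
    refine ⟨_, rfl, h1.line h.am, fun i => ?_⟩
    have hi : ∀ k, idx (k + 18) = idx k := fun k => idx_eq.mpr (by omega)
    rw [smul_Pl]
    simp only [← period h1]
    rcases Int.even_or_odd' i with ⟨k, rfl | rfl⟩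
    · rw [show 2 * k + 36 = 2 * (k + 18) by ring, Pl_even, Pl_even]
    · rw [show 2 * k + 1 + 36 = 2 * (k + 18) + 1 by ring, Pl_odd, Pl_odd, hi]
  small := by
    rintro _ _ _ _ ⟨x, g, h1, rfl, rfl⟩ ⟨y, g', h2, rfl, rfl⟩ p q hpA hqA hpB hqB hd
    obtain ⟨k, k', ho | ho⟩ := overlap_turns h.am h1 h2 hpA hqA hpB hqB hd
    · obtain ⟨i1, b1⟩ := h.base_eq h1 h2 (k := k) (k' := k') fun t t1 t2 => ho t (by omega) (by omega)
      obtain ⟨-, b2⟩ := h.base_eq h1 h2 (k := k + 1) (k' := k' + 1) fun t t1 t2 => by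
        have := ho (t + 2) (by omega) (by omega)
        convert this using 2 <;> ring
      have r1 := h1.rc k
      have r2 := h2.rc k'
      rw [b2, r2, b1, i1] at r1
      have hxy : y = x := mul_left_cancel r1
      subst hxy
      rw [idx_eq] at i1
      have hidx : ∀ j, idx (j + (k' - k)) = idx j := fun j => idx_eq.mpr (by omega)
      have hall : ∀ j, g j = g' (j + (k' - k)) := by
        refine ln_uniq (α := fun k => A (idx k)) (β := fun _ => y) (g' := fun j => g' (j + (k' - k)))
          (k := k) h1.rc (fun j => ?_) (by simpa using b1)
        have := h2.rc (j + (k' - k))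
        rw [show j + 1 + (k' - k) = j + (k' - k) + 1 by ring, this, hidx]
      have hP : ∀ i, Pl L G (fun k => A (idx k)) g i =
          Pl L G (fun k => A (idx k)) g' (i + 2 * (k' - k)) := by
        intro i
        rcases Int.even_or_odd' i with ⟨j, rfl | rfl⟩
        · rw [show 2 * j + 2 * (k' - k) = 2 * (j + (k' - k)) by ring, Pl_even, Pl_even, hall]
        · rw [show 2 * j + 1 + 2 * (k' - k) = 2 * (j + (k' - k)) + 1 by ring, Pl_odd, Pl_odd, hall,
            hidx]
      constructor
      · rw [hall 18, hall 0, add_comm (18 : ℤ), period h2, zero_add]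
        group
      · ext v
        constructor
        · rintro ⟨i, rfl⟩; exact ⟨_, (hP i).symm⟩
        · rintro ⟨i, rfl⟩; exact ⟨i - 2 * (k' - k), by rw [hP]; congr 1; ring⟩
    · exfalso
      have a1 := h.rel' (opp_rel h1 h2 (k := k) (k' := k') fun t t1 t2 => ho t (by omega) (by omega))
      have a2 := h.rel' (opp_rel h1 h2 (k := k + 1) (k' := k' - 1) fun t t1 t2 => by
        have := ho (t + 2) (by omega) (by omega)
        convert this using 2 <;> ring)
      rw [idx_eq] at a1 a2
      omega

end core5
end AmalgamFormalization

namespace AmalgamFormalization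
section core6
variable {F : Type u} [Group F] {L G : Subgroup F} {A : Fin 18 → F}

/-- the relators -/
def rset (L G : Subgroup F) (A : Fin 18 → F) : Set F :=
  {w | ∃ x ∈ (G : Set F), x ∉ L ⊓ G ∧ w = (List.ofFn fun i : Fin 18 => A i * x).prod}

theorem Hyp.notG (h : Hyp L G A) (i : Fin 18) : A i ∉ G := fun hc => (h.al i).2 ⟨(h.al i).1, hc⟩

theorem Hyp.std (h : Hyp L G A) {x : F} (hx : x ∈ G) (hx' : x ∉ L) :
    ∃ g : ℤ → F, g 0 = 1 ∧ IsLn L G (fun k => A (idx k)) (fun _ => x) g ∧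
      g 18 = (List.ofFn fun i : Fin 18 => A i * x).prod := by
  obtain ⟨g, g0, gr⟩ := exists_rec (fun k => A (idx k) * x)
  refine ⟨g, g0, ⟨fun k => (h.al _).1, fun k => h.notG _, fun _ => hx, fun _ => hx', fun k => ?_⟩, ?_⟩
  · rw [gr, mul_assoc]
  · refine (rec_list g0 gr 18 (fun i => A i * x) fun i => ?_).symm
    have : idx ((i : ℕ) : ℤ) = i := by
      apply Fin.ext
      have := i.2
      simp only [idx]
      omega
    simp only [this]

theorem Hyp.ax_mem (h : Hyp L G A) {s : F} {B : Set (Vt L G)} (hs : RAx L G A s B) :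
    s ∈ Subgroup.normalClosure (rset L G A) := by
  obtain ⟨x, g, h1, rfl, rfl⟩ := hs
  obtain ⟨g', g0, h2, e⟩ := h.std (h1.bg 0) (h1.bl 0)
  have : ∀ j, g j = g 0 * g' j := by
    refine ln_uniq (α := fun k => A (idx k)) (β := fun _ => x) (g' := fun j => g 0 * g' j)
      (k := 0) h1.rc (fun j => ?_) (by simp [g0])
    simp [h2.rc, mul_assoc]
  rw [this 18]
  refine (Subgroup.normalClosure_normal).conj_mem _ (Subgroup.subset_normalClosure ?_) _
  exact ⟨x, h1.bg 0, fun hc => h1.bl 0 hc.1, e⟩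

theorem Hyp.gr (h : Hyp L G A) (o : Vt L G) {n : F} (hn : n ∈ Subgroup.normalClosure (rset L G A))
    (h1 : n ≠ 1) : Gr (tr L G).dist (RAx L G A) o n := by
  refine greendlinger h.sys o n (Subgroup.closure_mono ?_ hn) h1
  intro s hs
  obtain ⟨r, ⟨x, hx, hx', rfl⟩, hc⟩ := Group.mem_conjugatesOfSet_iff.mp hs
  obtain ⟨c, rfl⟩ := isConj_iff.mp hc
  obtain ⟨g, g0, h2, e⟩ := h.std hx (fun hl => hx' ⟨hl, hx⟩)
  exact ⟨_, h.sys.conj c _ _ ⟨x, g, h2, by rw [g0, e]; simp, rfl⟩⟩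

theorem btw {V : Type u} {d : V → V → ℕ} (T : TD d) {x y u v : V} (h1 : d x u + d u y = d x y)
    (h2 : d x v + d v y = d x y) (h3 : d x u ≤ d x v) :
    d x u + d u v = d x v ∧ d u v + d v y = d u y := by
  have a1 := T.four u v x y
  have a2 := T.tri x v u
  have a3 := T.comm u x
  have a4 := T.comm v x
  omega

theorem Hyp.shorten (h : Hyp L G A) {o z p q : Vt L G} {s : F} {B : Set (Vt L G)}
    (hs : RAx L G A s B) (hp : p ∈ B) (hq : q ∈ B)
    (hd : (tr L G).dist o p + (tr L G).dist p q + (tr L G).dist q z = (tr L G).dist o z)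
    (h19 : 19 ≤ (tr L G).dist p q) : ∃ e : ℤ, (tr L G).dist o (s ^ e • z) < (tr L G).dist o z := by
  obtain ⟨P, rfl, hP, hm⟩ := h.sys.line s B hs
  have T := h.sys.td
  obtain ⟨i, rfl⟩ := hp
  obtain ⟨j, rfl⟩ := hq
  have key : ∀ e : ℤ, |i - (j + 36 * e)| < |i - j| →
      (tr L G).dist o (s ^ e • z) < (tr L G).dist o z := by
    intro e he
    have a1 := T.tri o (s ^ e • z) (P i)
    have a2 := T.tri (P i) (s ^ e • z) (s ^ e • P j)
    rw [h.sys.iso, Sys.zpow_line hm] at a2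
    have a3 := hP i (j + 36 * e)
    have a4 := hP i j
    omega
  have a4 := hP i j
  rcases le_total i j with hij | hij
  · refine ⟨-1, key _ ?_⟩
    rw [← hP i j, abs_lt]
    rw [abs_of_nonpos (by omega)] at a4
    constructor <;> omega
  · refine ⟨1, key _ ?_⟩
    rw [← hP i j, abs_lt]
    rw [abs_of_nonneg (by omega)] at a4
    constructor <;> omega

theorem Hyp.no_reflect (h : Hyp L G A) {β g : ℤ → F} (h1 : IsLn L G (fun k => A (idx k)) β g)
    (k : F) (c : ℤ) (hk : ∀ t, 0 ≤ t → t ≤ 3 → k • Pl L G (fun k => A (idx k)) g (c - t) =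
      Pl L G (fun k => A (idx k)) g (c + t)) : False := by
  rcases Int.even_or_odd' c with ⟨a, rfl | rfl⟩
  · have t1 := (h1.turn (a - 1)).smul k
    have t2 := (h1.turn (a + 1)).rev (h.al _).1
    rw [show 2 * (a - 1) - 1 = 2 * a - 3 by ring, show 2 * (a - 1) = 2 * a - 2 by ring,
      show 2 * a - 2 + 1 = 2 * a - 1 by ring, hk 3 (by omega) (by omega),
      hk 2 (by omega) (by omega), hk 1 (by omega) (by omega)] at t1
    rw [show 2 * (a + 1) - 1 = 2 * a + 1 by ring, show 2 * (a + 1) = 2 * a + 2 by ring,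
      show 2 * a + 2 + 1 = 2 * a + 3 by ring] at t2
    have := h.rel' (t2.rel (inv_mem (h.al _).1) (h.al _).1 t1)
    rw [idx_eq] at this
    omega
  · have t1 := (h1.turn a).smul k
    have t2 := (h1.turn (a + 1)).rev (h.al _).1
    have e2 := hk 2 (by omega) (by omega)
    have e1 := hk 1 (by omega) (by omega)
    have e0 := hk 0 (by omega) (by omega)
    rw [show 2 * a + 1 - 2 = 2 * a - 1 by ring] at e2
    rw [show 2 * a + 1 - 1 = 2 * a by ring] at e1
    rw [show 2 * a + 1 - 0 = 2 * a + 1 by ring] at e0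
    rw [e2, e1, e0] at t1
    rw [show 2 * (a + 1) - 1 = 2 * a + 1 + 0 by ring, show 2 * (a + 1) = 2 * a + 1 + 1 by ring,
      show 2 * a + 1 + 1 + 1 = 2 * a + 1 + 2 by ring] at t2
    have := h.rel' (t2.rel (inv_mem (h.al _).1) (h.al _).1 t1)
    rw [idx_eq] at this
    omega

theorem Hyp.mal_step (h : Hyp L G A) {o z : Vt L G} {k : F} (hz : k • z = z)
    (hgr : Gr (tr L G).dist (RAx L G A) o k) :
    ∃ s B, RAx L G A s B ∧ ∃ e : ℤ, (tr L G).dist o (s ^ e • z) < (tr L G).dist o z := by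
  have S := h.sys
  have T := S.td
  obtain ⟨s, B, hs, p, hp, q, hq, h24, hpq⟩ := hgr
  obtain ⟨c, m1, m2, m3⟩ := T.med o (k • o) z
  have f1 : (tr L G).dist (k • o) z = (tr L G).dist o z := by
    conv_lhs => rw [← hz]
    exact S.iso _ _ _
  have f2 : (tr L G).dist (k • c) z = (tr L G).dist c z := by
    conv_lhs => rw [← hz]
    exact S.iso _ _ _
  have hkc : k • c = c := by
    have := S.iso k o c
    exact T.uniq (x := k • o) (y := z) (by omega) m2 (by omega)
  have c1 := T.comm c (k • o)
  have t1 := T.tri o q p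
  have t2 := T.tri q (k • o) p
  have t3 := T.tri p (k • o) q
  have t4 := T.tri o (k • o) q
  have t5 := T.tri o (k • o) p
  have inv1 : ∀ x y, (tr L G).dist x (k⁻¹ • y) = (tr L G).dist (k • x) y := by
    intro x y
    rw [← S.iso k x (k⁻¹ • y), smul_inv_smul]
  by_cases hB : (tr L G).dist o c ≤ (tr L G).dist o p + 5
  · obtain ⟨p', p1, p2⟩ := T.geo p q 5 (by omega)
    have hp' : p' ∈ B := S.cvx hs p hp q hq p' (by omega)
    have t6 := T.tri o p' p
    have t7 := T.tri p' (k • o) q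
    have t8 := T.tri o (k • o) p'
    obtain ⟨b1, b2⟩ := btw T (x := o) (y := k • o) (u := c) (v := p') m1 (by omega) (by omega)
    refine ⟨_, _, S.conj k⁻¹ s B hs, ?_⟩
    refine h.shorten (S.conj k⁻¹ s B hs) (Set.smul_mem_smul_set hq) (Set.smul_mem_smul_set hp') ?_ ?_
    · rw [S.iso, inv1, T.comm (k⁻¹ • p') z, inv1, hz]
      have := T.tri p' z c
      have := T.comm z p'
      have := T.comm q p'
      have := T.comm (k • o) q
      have := T.comm p' c
      have := T.tri (k • o) z p'
      have := T.tri (k • o) p' q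
      omega
    · rw [S.iso, T.comm]; omega
  by_cases hA : (tr L G).dist o p + (tr L G).dist p q ≤ (tr L G).dist o c + 5
  · obtain ⟨q', p1, p2⟩ := T.geo p q ((tr L G).dist p q - 5) (by omega)
    have hq' : q' ∈ B := S.cvx hs p hp q hq q' (by omega)
    have t6 := T.tri o q' p
    have t7 := T.tri q' (k • o) q
    have t8 := T.tri o (k • o) q'
    obtain ⟨b1, b2⟩ := btw T (x := o) (y := k • o) (u := q') (v := c) (by omega) m1 (by omega)
    refine ⟨s, B, hs, h.shorten hs hp hq' ?_ (by omega)⟩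
    have := T.tri q' z c
    have := T.tri o z q'
    omega
  · exfalso
    obtain ⟨b1, b2⟩ := btw T (x := o) (y := k • o) (u := p) (v := c) (by omega) m1 (by omega)
    obtain ⟨b3, b4⟩ := btw T (x := o) (y := k • o) (u := c) (v := q) m1 (by omega) (by omega)
    have hc : c ∈ B := S.cvx hs p hp q hq c (by omega)
    have c2 := T.comm p c
    have refl : ∀ u v, (tr L G).dist c u + (tr L G).dist u p = (tr L G).dist c p →
        (tr L G).dist c v + (tr L G).dist v q = (tr L G).dist c q →
        (tr L G).dist c u = (tr L G).dist c v → k • u = v := by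
      intro u v hu hv huv
      have i1 := S.iso k c u
      rw [hkc] at i1
      have i2 := S.iso k u o
      have := T.tri u o p
      have := T.tri v (k • o) q
      have := T.tri c (k • o) v
      have := T.tri c (k • o) (k • u)
      have := T.comm p o
      exact T.uniq (x := c) (y := k • o) (by omega) (by omega) (by omega)
    obtain ⟨x, g, h1, -, rfl⟩ := hs
    obtain ⟨i, rfl⟩ := hp
    obtain ⟨j, rfl⟩ := hq
    obtain ⟨ic, rfl⟩ := hc
    have hl := h1.line h.am
    have l1 := hl i ic
    have l2 := hl ic j
    have l3 := hl i j
    have l0 := hl ic i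
    rcases le_total i ic with hi | hi
    · rw [abs_of_nonpos (by omega)] at l1
      rw [abs_of_nonneg (by omega)] at l0
      have hj : ic ≤ j := by
        by_contra hj
        rw [abs_of_nonneg (by omega)] at l2
        rcases abs_cases (i - j) with ⟨e, _⟩ | ⟨e, _⟩ <;> omega
      rw [abs_of_nonpos (by omega)] at l2
      refine h.no_reflect h1 k ic fun t ht0 ht3 => refl _ _ ?_ ?_ ?_
      · have a1 := hl ic (ic - t)
        have a2 := hl (ic - t) i
        rw [abs_of_nonneg (by omega)] at a1 a2
        omega
      · have a1 := hl ic (ic + t)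
        have a2 := hl (ic + t) j
        rw [abs_of_nonpos (by omega)] at a1 a2
        omega
      · have a1 := hl ic (ic - t)
        have a2 := hl ic (ic + t)
        rw [abs_of_nonneg (by omega)] at a1
        rw [abs_of_nonpos (by omega)] at a2
        omega
    · rw [abs_of_nonneg (by omega)] at l1
      rw [abs_of_nonpos (by omega)] at l0
      have hj : j ≤ ic := by
        by_contra hj
        rw [abs_of_nonpos (by omega)] at l2
        rcases abs_cases (i - j) with ⟨e, _⟩ | ⟨e, _⟩ <;> omega
      rw [abs_of_nonneg (by omega)] at l2
      refine h.no_reflect h1 k⁻¹ ic fun t ht0 ht3 => ?_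
      rw [inv_smul_eq_iff]
      symm
      refine refl _ _ ?_ ?_ ?_
      · have a1 := hl ic (ic + t)
        have a2 := hl (ic + t) i
        rw [abs_of_nonpos (by omega)] at a1 a2
        omega
      · have a1 := hl ic (ic - t)
        have a2 := hl (ic - t) j
        rw [abs_of_nonneg (by omega)] at a1 a2
        omega
      · have a1 := hl ic (ic - t)
        have a2 := hl ic (ic + t)
        rw [abs_of_nonneg (by omega)] at a1
        rw [abs_of_nonpos (by omega)] at a2
        omega

theorem fix_base {a : F} (ha : a ∈ G) : a • vert L G false 1 = vert L G false 1 := by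
  rw [smul_vert, vert_eq]; simpa [fac] using ha

/-- malnormality of `G` in the amalgam -/
theorem Hyp.mal_amalgam (h : Hyp L G A) {m g g' : F} (hm : m ∉ G) (hg : g ∈ G) (hg' : g' ∈ G)
    (he : m * g * m⁻¹ = g') : g = 1 := by
  have S := h.sys
  have T := S.td
  have hT := tr_tree h.am
  set o := vert L G false (1 : F) with ho
  have hfo : g' • o = o := fix_base hg'
  have hfz : g' • (m • o) = m • o := by
    rw [← he, ← mul_smul, inv_mul_cancel_right, mul_smul, fix_base hg]
  have hne : o ≠ m • o := by
    intro hc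
    rw [ho, smul_vert, vert_eq] at hc
    exact hm (by simpa [fac] using hc)
  have fixed : ∀ v, (tr L G).dist o v + (tr L G).dist v (m • o) = (tr L G).dist o (m • o) →
      g' • v = v := by
    intro v hv
    have a1 := S.iso g' o v
    have a2 := S.iso g' v (m • o)
    rw [hfo] at a1
    rw [hfz] at a2
    exact T.uniq (x := o) (y := m • o) (by omega) hv a1
  obtain ⟨v, v1, v2⟩ := tree_closer hT hne
  obtain ⟨b, γ, e1, e2⟩ := v1
  have hb := vert_type e1
  subst hb
  have hγ : γ ∈ G := by have := vert_eq.mp e1; simpa [fac] using this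
  have hvz : v ≠ m • o := by
    rintro hc
    rw [e2, ho, smul_vert] at hc
    have := vert_type hc
    simp at this
  obtain ⟨w, w1, w2⟩ := tree_closer hT hvz
  obtain ⟨b, δ, e3, e4⟩ := w1
  have hb := vert_type (e2.symm.trans e3)
  subst hb
  have d1 : (tr L G).dist o v = 1 := SimpleGraph.dist_eq_one_iff_adj.mpr ⟨false, γ, e1, e2⟩
  have d2 : (tr L G).dist v w = 1 := SimpleGraph.dist_eq_one_iff_adj.mpr ⟨_, δ, e3, e4⟩
  have c1 := T.comm (m • o) o
  have c2 := T.comm (m • o) v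
  have c3 := T.comm (m • o) w
  have t1 := T.tri o w v
  have t2 := T.tri o (m • o) w
  have fv := fixed v (by omega)
  have fw := fixed w (by omega)
  have how : o ≠ w := by rintro hc; rw [← hc] at w2; omega
  -- algebra
  have hl : γ⁻¹ * δ ∈ L := by
    have := vert_eq.mp (e2.symm.trans e3); simpa [fac] using this
  have hlG : γ⁻¹ * δ ∉ G := by
    intro hc
    refine how ?_
    rw [e1, e4]
    exact vert_eq.mpr hc
  rw [e2, smul_vert, vert_eq] at fv
  rw [e4, smul_vert, vert_eq] at fw
  simp only [fac, Bool.not_false, Bool.not_true] at fv fw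
  have k1 : γ⁻¹ * g' * γ ∈ L := by
    have := inv_mem fv
    simpa [mul_assoc] using this
  have k2 : γ⁻¹ * g' * γ ∈ G := mul_mem (mul_mem (inv_mem hγ) hg') hγ
  have k3 : δ⁻¹ * g' * δ ∈ G := by
    have := inv_mem fw
    simpa [mul_assoc] using this
  have k4 : (γ⁻¹ * δ)⁻¹ * (γ⁻¹ * g' * γ) * (γ⁻¹ * δ)⁻¹⁻¹ = δ⁻¹ * g' * δ := by group
  have k7 : δ⁻¹ * g' * δ ∈ L := by
    rw [← k4]; exact L.mul_mem (L.mul_mem (L.inv_mem hl) k1) (by simpa using hl)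
  have k8 : (γ⁻¹ * δ)⁻¹ * (γ⁻¹ * g' * γ) * (γ⁻¹ * δ)⁻¹⁻¹ ∈ L ⊓ G := by
    rw [k4]; exact ⟨k7, k3⟩
  have k5 := h.mal (γ⁻¹ * δ)⁻¹ (inv_mem hl) (fun hc => hlG (by simpa using ((L ⊓ G).inv_mem hc).2))
    (γ⁻¹ * g' * γ) ⟨k1, k2⟩ k8
  have k6 : g' = 1 := by
    have : g' = γ * (γ⁻¹ * g' * γ) * γ⁻¹ := by group
    rw [this, k5]; group
  have : g = m⁻¹ * (m * g * m⁻¹) * m := by group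
  rw [this, he, k6]; group

theorem Hyp.short (h : Hyp L G A) {n : F} (hn : n ∈ Subgroup.normalClosure (rset L G A))
    (hd : (tr L G).dist (vert L G false 1) (n • vert L G false 1) < 24) : n = 1 := by
  by_contra h1
  obtain ⟨s, B, -, p, -, q, -, h24, he⟩ := h.gr (vert L G false 1) hn h1
  omega

/-- displacement of the base vertex -/
noncomputable def dsp (L G : Subgroup F) (a : F) : ℕ := (tr L G).dist (vert L G false 1) (a • vert L G false 1)

theorem Hyp.dsp_mul (h : Hyp L G A) (a b : F) : dsp L G (a * b) ≤ dsp L G a + dsp L G b := by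
  unfold dsp
  have := h.sys.td.tri (vert L G false 1) ((a * b) • vert L G false 1) (a • vert L G false 1)
  rw [mul_smul, h.sys.iso] at this
  rwa [mul_smul]

theorem dsp_G {a : F} (ha : a ∈ G) : dsp L G a = 0 := by
  unfold dsp; rw [fix_base ha]; simp

theorem Hyp.dsp_L (h : Hyp L G A) {a : F} (ha : a ∈ L) : dsp L G a ≤ 2 := by
  have e : vert L G true 1 = vert L G true a := vert_eq.mpr (by simpa [fac] using ha)
  have d1 : (tr L G).dist (vert L G false 1) (vert L G true 1) = 1 :=
    SimpleGraph.dist_eq_one_iff_adj.mpr ⟨false, 1, rfl, rfl⟩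
  have d2 : (tr L G).dist (vert L G true 1) (vert L G false a) = 1 :=
    SimpleGraph.dist_eq_one_iff_adj.mpr ⟨true, a, e, rfl⟩
  have := h.sys.td.tri (vert L G false 1) (vert L G false a) (vert L G true 1)
  unfold dsp
  rw [smul_vert, mul_one]
  omega

theorem Hyp.dsp_LG (h : Hyp L G A) {a : F} (ha : a ∈ (L : Set F) ∪ (G : Set F)) :
    dsp L G a ≤ 2 ∧ dsp L G a⁻¹ ≤ 2 := by
  rcases ha with ha | ha
  · exact ⟨h.dsp_L ha, h.dsp_L (inv_mem ha)⟩
  · exact ⟨by rw [dsp_G ha]; omega, by rw [dsp_G (inv_mem ha)]; omega⟩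

/-- separation in the amalgam -/
theorem Hyp.sep_amalgam (h : Hyp L G A) {a b g g' : F} (ha : a ∈ L) (ha' : a ∉ G) (hb : b ∈ L)
    (hb' : b ∉ G) (hg : g ∈ G) (hg' : g' ∈ G) (he : a = g * b * g') : Rel L G b a := by
  have hF := h.am
  have hai : a⁻¹ ∈ L := inv_mem ha
  have hai' : a⁻¹ ∉ G := fun hc => ha' (by simpa using inv_mem hc)
  by_cases h1 : g ∈ L
  · have : g' ∈ L := by
      have e : g' = b⁻¹ * g⁻¹ * a := by rw [he]; group
      rw [e]; exact mul_mem (mul_mem (inv_mem hb) (inv_mem h1)) ha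
    exact ⟨g, ⟨h1, hg⟩, g', ⟨this, hg'⟩, he⟩
  · exfalso
    by_cases h2 : g' ∈ L
    · have : Alt L G true [a⁻¹, g, b * g'] :=
        ⟨hai, hai', hg, h1, mul_mem hb h2,
          fun hc => hb' ((Subgroup.mul_mem_cancel_right _ hg').mp hc), trivial⟩
      refine this.ne hF (by simp) ?_
      simp [he, mul_assoc]
    · have : Alt L G true [a⁻¹, g, b, g'] :=
        ⟨hai, hai', hg, h1, hb, hb', hg', h2, trivial⟩
      refine this.ne hF (by simp) ?_
      simp [he, mul_assoc]

theorem Hyp.six (h : Hyp L G A) {l g : F} (hl : l ∈ L) (hl' : l ∉ L ⊓ G) (hg : g ∈ G)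
    (hg' : g ∉ L ⊓ G) {k : ℕ} (hk : 1 ≤ k) (c : Fin k → F) (hc : ∀ i, c i ∈ L ⊓ G) :
    (List.ofFn fun i : Fin k => l * g * c i).prod ∉ Subgroup.normalClosure (rset L G A) := by
  intro hn
  let c' : ℤ → F := fun j => if hj : j.toNat < k then c ⟨j.toNat, hj⟩ else 1
  have hc' : ∀ j, c' j ∈ L ⊓ G := by
    intro j
    simp only [c']
    split_ifs
    · exact hc _
    · exact one_mem _
  obtain ⟨γ, γ0, γr⟩ := exists_rec (fun j => l * g * c' j)
  have hw : (List.ofFn fun i : Fin k => l * g * c i).prod = γ k :=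
    rec_list γ0 γr k _ (fun i => by simp [c'])
  rw [hw] at hn
  have hln : IsLn L G (fun _ => l) (fun j => g * c' j) γ :=
    ⟨fun _ => hl, fun _ hx => hl' ⟨hl, hx⟩, fun j => mul_mem hg (hc' j).2,
      fun j hx => hg' ⟨(Subgroup.mul_mem_cancel_right _ (hc' j).1).mp hx, hg⟩,
      fun j => by rw [γr]; simp only [mul_assoc]⟩
  have hline := hln.line h.am
  have T := h.sys.td
  have e0 : Pl L G (fun _ => l) γ 0 = vert L G true 1 := by
    have := Pl_even (L := L) (G := G) (α := fun _ => l) (g := γ) 0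
    rw [γ0] at this; simpa using this
  have ek : Pl L G (fun _ => l) γ (2 * k) = γ k • vert L G true 1 := by
    rw [Pl_even, smul_vert, mul_one]
  have hne : γ k ≠ 1 := by
    intro h1
    have := hline 0 (2 * k)
    rw [e0, ek, h1, one_smul, SimpleGraph.dist_self, abs_of_nonpos (by omega)] at this
    omega
  obtain ⟨s, B, ⟨x, g', h1, -, rfl⟩, p, hp, q, hq, h24, he⟩ := h.gr (vert L G true 1) hn hne
  rw [← ek, ← e0] at he
  have t1 := T.tri (Pl L G (fun _ => l) γ 0) q p
  have t2 := T.tri p (Pl L G (fun _ => l) γ (2 * k)) q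
  have t3 := T.tri (Pl L G (fun _ => l) γ 0) (Pl L G (fun _ => l) γ (2 * k)) p
  have t4 := T.tri (Pl L G (fun _ => l) γ 0) (Pl L G (fun _ => l) γ (2 * k)) q
  have hp2 : p ∈ Set.range (Pl L G (fun _ => l) γ) :=
    ⟨_, (line_mid T hline 0 (2 * k) p (by omega)).symm⟩
  have hq2 : q ∈ Set.range (Pl L G (fun _ => l) γ) :=
    ⟨_, (line_mid T hline 0 (2 * k) q (by omega)).symm⟩
  obtain ⟨a, a', ho | ho⟩ := overlap_turns h.am hln h1 hp2 hq2 hp hq (by omega)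
  · have r1 := same_rel hln h1 (k := a) (k' := a') fun t t1 t2 => ho t (by omega) (by omega)
    have r2 := same_rel hln h1 (k := a + 1) (k' := a' + 1) fun t t1 t2 => by
      have := ho (t + 2) (by omega) (by omega)
      convert this using 2 <;> ring
    have := h.rel (r1.symm.trans r2)
    rw [idx_eq] at this
    omega
  · have r1 := opp_rel hln h1 (k := a) (k' := a') fun t t1 t2 => ho t (by omega) (by omega)
    have r2 := opp_rel hln h1 (k := a + 1) (k' := a' - 1) fun t t1 t2 => by
      have := ho (t + 2) (by omega) (by omega)
      convert this using 2 <;> ring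
    have := h.rel (r1.symm.trans r2)
    rw [idx_eq] at this
    omega

theorem Hyp.mal_quot (h : Hyp L G A) {M : Type u} [Group M] (φ : F →* M)
    (hφ : φ.ker = Subgroup.normalClosure (rset L G A)) {m0 g g' : F}
    (hm : φ m0 ∉ Subgroup.map φ G) (hg : g ∈ G) (hg' : g' ∈ G)
    (he : φ m0 * φ g * (φ m0)⁻¹ = φ g') : g = 1 := by
  classical
  have hex : ∃ t, ∃ m, φ m = φ m0 ∧ dsp L G m = t := ⟨_, m0, rfl, rfl⟩
  obtain ⟨m, hmm, hmt⟩ := Nat.find_spec hex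
  have hmin : ∀ m', φ m' = φ m0 → dsp L G m ≤ dsp L G m' := fun m' hm' => by
    rw [hmt]; exact Nat.find_min' hex ⟨m', hm', rfl⟩
  have hmG : m ∉ G := fun hc => hm ⟨m, hc, hmm⟩
  by_cases hu : m * g * m⁻¹ * g'⁻¹ = 1
  · exact h.mal_amalgam hmG hg hg' (mul_inv_eq_one.mp hu)
  · exfalso
    have huN : m * g * m⁻¹ * g'⁻¹ ∈ Subgroup.normalClosure (rset L G A) := by
      rw [← hφ, MonoidHom.mem_ker]
      simp [hmm, he]
    have hgr := h.gr (vert L G false 1) huN hu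
    have hk : Gr (tr L G).dist (RAx L G A) (vert L G false 1) (m * g * m⁻¹) := by
      unfold Gr at hgr ⊢
      rwa [mul_smul _ g'⁻¹, fix_base (inv_mem hg')] at hgr
    have hz : (m * g * m⁻¹) • (m • vert L G false 1) = m • vert L G false 1 := by
      rw [← mul_smul, inv_mul_cancel_right, mul_smul, fix_base hg]
    obtain ⟨s, B, hs, e, hlt⟩ := h.mal_step hz hk
    have hsφ : φ s = 1 := by
      rw [← MonoidHom.mem_ker, hφ]; exact h.ax_mem hs
    have := hmin (s ^ e * m) (by simp [hsφ, hmm])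
    unfold dsp at this
    rw [mul_smul] at this
    omega

theorem Hyp.final (h : Hyp L G A) :
    ∃ (M : Type u) (_ : Group M) (q : F →* M),
      Set.InjOn q ((L : Set F) ∪ (G : Set F)) ∧
      Function.Surjective q ∧
      MonoidHom.ker q = Subgroup.normalClosure
        {w | ∃ x ∈ (G : Set F), x ∉ L ⊓ G ∧
            w = (List.ofFn fun i : Fin 18 => A i * x).prod} ∧
      (∀ m : M, m ∉ Subgroup.map q G → ∀ h ∈ Subgroup.map q G,
        m * h * m⁻¹ ∈ Subgroup.map q G → h = 1) ∧
      (∀ i, q (A i) ∉ Subgroup.map q G) ∧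
      HPMSeparated (Subgroup.map q G) (fun i => q (A i)) ∧
      (∀ x ∈ G, x ∉ L ⊓ G → (List.ofFn fun i : Fin 18 => q (A i) * q x).prod = 1) ∧
      (∀ l ∈ L, l ∉ L ⊓ G → ∀ g ∈ G, g ∉ L ⊓ G → ∀ k : ℕ, 1 ≤ k →
        ∀ c : Fin k → F, (∀ i, c i ∈ L ⊓ G) →
          (List.ofFn fun i : Fin k => q l * q g * q (c i)).prod ≠ 1) := by
  set N := Subgroup.normalClosure (rset L G A) with hN
  have hker : (QuotientGroup.mk' N).ker = N := QuotientGroup.ker_mk' N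
  have hinj : Set.InjOn (QuotientGroup.mk' N) ((L : Set F) ∪ (G : Set F)) := by
    intro a ha b hb hab
    have hn : a⁻¹ * b ∈ N := by
      rw [← hker, MonoidHom.mem_ker, map_mul, map_inv, hab, inv_mul_cancel]
    have := h.dsp_mul a⁻¹ b
    have := (h.dsp_LG ha).2
    have := (h.dsp_LG hb).1
    have := h.short hn (show dsp L G _ < 24 by omega)
    exact inv_mul_eq_one.mp this
  have hsepF : ∀ (a b g g' : F), a ∈ L → b ∈ L → g ∈ G → g' ∈ G →
      QuotientGroup.mk' N a = QuotientGroup.mk' N g * QuotientGroup.mk' N b * QuotientGroup.mk' N g' →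
      a = g * b * g' := by
    intro a b g g' ha hb hg hg' he
    have hn : a⁻¹ * (g * b * g') ∈ N := by
      rw [← hker, MonoidHom.mem_ker, map_mul, map_inv, he]
      simp only [map_mul, inv_mul_cancel]
    have := h.dsp_mul a⁻¹ (g * b * g')
    have := h.dsp_mul (g * b) g'
    have := h.dsp_mul g b
    have := dsp_G (L := L) hg
    have := dsp_G (L := L) hg'
    have := h.dsp_L (inv_mem ha)
    have := h.dsp_L hb
    have := h.short hn (show dsp L G _ < 24 by omega)
    exact inv_mul_eq_one.mp this
  refine ⟨F ⧸ N, inferInstance, QuotientGroup.mk' N, hinj, QuotientGroup.mk'_surjective N, hker,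
    ?_, ?_, ?_, ?_, ?_⟩
  · rintro m hm _ ⟨g, hg, rfl⟩ ⟨g', hg', he⟩
    obtain ⟨m0, rfl⟩ := QuotientGroup.mk'_surjective N m
    rw [h.mal_quot (QuotientGroup.mk' N) hker hm hg hg' he.symm, map_one]
  · rintro i ⟨g, hg, he⟩
    have := hinj (.inr hg) (.inl (h.al i).1) he
    exact h.notG i (this ▸ hg)
  · rintro i j hij (hc | hc)
    · obtain ⟨_, ⟨_, ⟨g, hg, rfl⟩, _, rfl, rfl⟩, _, ⟨g', hg', rfl⟩, e⟩ := hc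
      have := hsepF (A i) (A j) g g' (h.al i).1 (h.al j).1 hg hg' e.symm
      exact hij (h.rel (h.sep_amalgam (h.al i).1 (h.notG i) (h.al j).1 (h.notG j) hg hg' this))
    · obtain ⟨_, ⟨_, ⟨g, hg, rfl⟩, _, rfl, rfl⟩, _, ⟨g', hg', rfl⟩, e⟩ := hc
      have := hsepF (A i) (A j)⁻¹ g g' (h.al i).1 (inv_mem (h.al j).1) hg hg' (by
        rw [map_inv]; exact e.symm)
      exact hij (h.rel' (h.sep_amalgam (h.al i).1 (h.notG i) (inv_mem (h.al j).1)
        (fun hc => h.notG j (by simpa using hc)) hg hg' this))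
  · intro x hx hx'
    have hr : (List.ofFn fun i : Fin 18 => A i * x).prod ∈ N :=
      Subgroup.subset_normalClosure ⟨x, hx, hx', rfl⟩
    rw [← hker, MonoidHom.mem_ker, map_list_prod, List.map_ofFn] at hr
    rw [← hr]
    congr 2
  · intro l hl hl' g hg hg' k hk c hc he
    refine h.six hl hl' hg hg' hk c hc ?_
    rw [← hN, ← hker, MonoidHom.mem_ker, map_list_prod, List.map_ofFn, ← he]
    congr 2

end core6
end AmalgamFormalization

namespace AmalgamFormalization

/-- Lemma 6.2 (second Amalgamation Lemma). -/
theorem amalgamationLemma₂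
    {F : Type u} [Group F] (L G : Subgroup F) (hF : IsAmalgam L G)
    (hmal : MalnormalIn (L ⊓ G) L)
    (A : Fin 18 → F) (hAL : ∀ i, A i ∈ L ∧ A i ∉ L ⊓ G)
    (hAsep : HPMSeparated (L ⊓ G) A) :
    ∃ (M : Type u) (_ : Group M) (q : F →* M),
      -- (1) `L` and `G` are (identified with) subgroups of `M`
      Set.InjOn q ((L : Set F) ∪ (G : Set F)) ∧
      -- (2) `q` is surjective with kernel the normal closure of the special set
      Function.Surjective q ∧
      MonoidHom.ker q = Subgroup.normalClosure
        {w | ∃ x ∈ (G : Set F), x ∉ L ⊓ G ∧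
            w = (List.ofFn fun i : Fin 18 => A i * x).prod} ∧
      -- (3) the subgroup `G` is malnormal in `M`
      (∀ m : M, m ∉ Subgroup.map q G → ∀ h ∈ Subgroup.map q G,
        m * h * m⁻¹ ∈ Subgroup.map q G → h = 1) ∧
      -- (4) the sequence `(a k)` is `G^±`-separated in `M`
      (∀ i, q (A i) ∉ Subgroup.map q G) ∧
      HPMSeparated (Subgroup.map q G) (fun i => q (A i)) ∧
      -- (5) `a₀xa₁x⋯a₁₇x = e` in `M` for every `x ∈ G \ H`
      (∀ x ∈ G, x ∉ L ⊓ G → (List.ofFn fun i : Fin 18 => q (A i) * q x).prod = 1) ∧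
      -- (6) `l g c₁ l g c₂ ⋯ l g cₙ ≠ e` in `M`
      (∀ l ∈ L, l ∉ L ⊓ G → ∀ g ∈ G, g ∉ L ⊓ G → ∀ k : ℕ, 1 ≤ k →
        ∀ c : Fin k → F, (∀ i, c i ∈ L ⊓ G) →
          (List.ofFn fun i : Fin k => q l * q g * q (c i)).prod ≠ 1) := by
  exact Hyp.final ⟨hF, hmal, hAL, hAsep⟩

end AmalgamFormalization
end

section
/- Let H be a subgroup of a group X, let A be a subset of X, and let n ≥ 1 be a natural number. If dim(H; X) + 2n − 2 < dim(A; X), then there exists an H^±-separated sequence (x_i)_{i<n} of elements of A \ H. -/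
open scoped Pointwise

namespace ShelahFormalization

/-- `dim(A; X)`: the least cardinality of a set `B ⊆ X` such that every element of `A`
is a product of finitely many elements of `B`. -/
noncomputable def sdim {X : Type u} [Semigroup X] (A : Set X) : Cardinal.{u} :=
  sInf {c | ∃ B : Set X, A ⊆ (Subsemigroup.closure B : Set X) ∧ Cardinal.mk B = c}

/-- A sequence `(g i)` is `H^±`-separated: `g i ∉ H (g j) H ∪ H (g j)⁻¹ H` for `i ≠ j`. -/
def HPMSeparated {X : Type u} [Group X] (H : Subgroup X) {n : ℕ} (g : Fin n → X) : Prop :=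
  ∀ i j : Fin n, i ≠ j →
    g i ∉ ((H : Set X) * {g j} * (H : Set X)) ∪ ((H : Set X) * {(g j)⁻¹} * (H : Set X))

theorem exists_gen {X : Type u} [Semigroup X] (A : Set X) :
    ∃ B : Set X, A ⊆ (Subsemigroup.closure B : Set X) ∧ Cardinal.mk B = sdim A := by
  have hne : {c | ∃ B : Set X, A ⊆ (Subsemigroup.closure B : Set X) ∧
      Cardinal.mk B = c}.Nonempty := ⟨_, A, Subsemigroup.subset_closure, rfl⟩
  exact csInf_mem hne

theorem sdim_le {X : Type u} [Semigroup X] (A B : Set X)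
    (h : A ⊆ (Subsemigroup.closure B : Set X)) : sdim A ≤ Cardinal.mk B :=
  csInf_le' ⟨B, h, rfl⟩

theorem mem_double {X : Type u} [Group X] (H : Subgroup X) (a b : X) :
    a ∈ (H : Set X) * {b} * (H : Set X) ↔ ∃ p ∈ H, ∃ q ∈ H, p * b * q = a := by
  constructor
  · rintro ⟨_, ⟨p, hp, _, rfl, rfl⟩, q, hq, e⟩
    exact ⟨p, hp, q, hq, e⟩
  · rintro ⟨p, hp, q, hq, e⟩
    exact ⟨_, ⟨p, hp, _, rfl, rfl⟩, q, hq, e⟩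

theorem exists_aux {X : Type u} [Group X] (H : Subgroup X) (A : Set X) (n : ℕ)
    (h : sdim (H : Set X) + ((2 * n - 2 : ℕ) : Cardinal) < sdim A) (k : ℕ) (hk : k ≤ n) :
    ∃ x : Fin k → X, (∀ i, x i ∈ A ∧ x i ∉ H) ∧ HPMSeparated H x := by
  induction k with
  | zero => exact ⟨Fin.elim0, fun i => i.elim0, fun i => i.elim0⟩
  | succ k ih =>
    obtain ⟨x, hx, hs⟩ := ih (by omega)
    obtain ⟨B, hB, hc⟩ := exists_gen (H : Set X)
    set C : Set X := B ∪ Set.range (Sum.elim x (fun i => (x i)⁻¹)) with hC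
    have hcard : Cardinal.mk C < sdim A := by
      refine lt_of_le_of_lt ?_ h
      refine (Cardinal.mk_union_le _ _).trans ?_
      rw [hc]
      gcongr
      have h1 := Cardinal.mk_range_le_lift (f := Sum.elim x (fun i => (x i)⁻¹))
      have h2 : Cardinal.mk (Set.range (Sum.elim x (fun i => (x i)⁻¹))) ≤
          ((k + k : ℕ) : Cardinal) := by simpa using h1
      exact h2.trans (by exact_mod_cast (by omega))
    obtain ⟨a, haA, haC⟩ : ∃ a ∈ A, a ∉ Subsemigroup.closure C := by
      by_contra! hcon
      exact absurd (sdim_le A C hcon) (not_le.mpr hcard)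
    have hH : ∀ p ∈ H, p ∈ Subsemigroup.closure C := fun p hp =>
      Subsemigroup.closure_mono Set.subset_union_left (hB hp)
    have hX : ∀ i, x i ∈ Subsemigroup.closure C := fun i =>
      Subsemigroup.subset_closure (Or.inr ⟨Sum.inl i, rfl⟩)
    have hX' : ∀ i, (x i)⁻¹ ∈ Subsemigroup.closure C := fun i =>
      Subsemigroup.subset_closure (Or.inr ⟨Sum.inr i, rfl⟩)
    have k1 : ∀ i, ∀ p ∈ H, ∀ q ∈ H, p * x i * q ≠ a := by
      rintro i p hp q hq rfl
      exact haC (mul_mem (mul_mem (hH p hp) (hX i)) (hH q hq))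
    have k2 : ∀ i, ∀ p ∈ H, ∀ q ∈ H, p * (x i)⁻¹ * q ≠ a := by
      rintro i p hp q hq rfl
      exact haC (mul_mem (mul_mem (hH p hp) (hX' i)) (hH q hq))
    refine ⟨Fin.cons a x, ?_, ?_⟩
    · intro i
      refine Fin.cases ?_ (fun i => ?_) i
      · exact ⟨haA, fun hm => haC (hH a hm)⟩
      · simpa using hx i
    · intro i
      refine Fin.cases ?_ (fun i => ?_) i
      · intro j
        refine Fin.cases (fun hne => absurd rfl hne) (fun j _ => ?_) j
        simp only [Fin.cons_zero, Fin.cons_succ]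
        rintro (hm | hm)
        · obtain ⟨p, hp, q, hq, e⟩ := (mem_double _ _ _).1 hm
          exact k1 j p hp q hq e
        · obtain ⟨p, hp, q, hq, e⟩ := (mem_double _ _ _).1 hm
          exact k2 j p hp q hq e
      · intro j
        refine Fin.cases (fun _ => ?_) (fun j hne => ?_) j
        · simp only [Fin.cons_zero, Fin.cons_succ]
          rintro (hm | hm)
          · obtain ⟨p, hp, q, hq, e⟩ := (mem_double _ _ _).1 hm
            exact k1 i p⁻¹ (inv_mem hp) q⁻¹ (inv_mem hq) (by rw [← e]; group)
          · obtain ⟨p, hp, q, hq, e⟩ := (mem_double _ _ _).1 hm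
            exact k2 i q hq p hp (by rw [← e]; group)
        · simpa only [Fin.cons_succ] using hs i j (fun e => hne (by rw [e]))

/-- Lemma 7.1: if `dim(H; X) + 2n - 2 < dim(A; X)`, then there exists an
`H^±`-separated sequence `(x i)_{i < n}` in `A \ H`. -/
theorem exists_HPMSeparated_of_dim_lt
    {X : Type u} [Group X] (H : Subgroup X) (A : Set X) (n : ℕ) (hn : 1 ≤ n)
    (h : sdim (H : Set X) + ((2 * n - 2 : ℕ) : Cardinal) < sdim A) :
    ∃ x : Fin n → X, (∀ i, x i ∈ A ∧ x i ∉ H) ∧ HPMSeparated H x := by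
  exact exists_aux H A n h n le_rfl

end ShelahFormalization
end

section
/- Let κ be an infinite cardinal. Every group G of cardinality |G| ≤ κ is isomorphic to a malnormal subgroup of a group M such that dim(M) = |M| = κ. -/
namespace ShelahFormalization

theorem freeGroup_map_fixed {α : Type*} (f : α → α) (hf : Function.Injective f)
    (hfix : ∀ a, f a ≠ a) (w : FreeGroup α) (hw : FreeGroup.map f w = w) : w = 1 := by
  classical
  have h1 : FreeGroup.IsReduced (w.toWord.map fun x => (f x.1, x.2)) := by
    have h := FreeGroup.isReduced_toWord (x := w)
    unfold FreeGroup.IsReduced at h ⊢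
    rw [List.isChain_map]
    exact h.imp fun a b hab he => hab (hf he)
  have h2 : (FreeGroup.map f w).toWord = w.toWord.map fun x => (f x.1, x.2) := by
    conv_lhs => rw [← FreeGroup.mk_toWord (x := w), FreeGroup.map.mk, FreeGroup.toWord_mk]
    exact h1.reduce_eq
  rw [hw] at h2
  rw [← FreeGroup.toWord_eq_nil_iff]
  cases hL : w.toWord with
  | nil => rfl
  | cons a l =>
    rw [hL] at h2
    simp only [List.map_cons, List.cons.injEq] at h2
    exact absurd (congrArg Prod.fst h2.1).symm (hfix a.1)

/-- The action of `G` on the free group on `G × X` by left translation of generators. -/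
def transAct (G X : Type*) [Group G] : G →* MulAut (FreeGroup (G × X)) where
  toFun g := FreeGroup.freeGroupCongr ((Equiv.mulLeft g).prodCongr (Equiv.refl X))
  map_one' := by
    ext w
    change FreeGroup.map _ w = w
    convert FreeGroup.map.id w using 2
    congr 1
    funext p
    simp
  map_mul' a b := by
    ext w
    change FreeGroup.map _ w = FreeGroup.map _ (FreeGroup.map _ w)
    rw [FreeGroup.map.comp]
    congr 2
    funext p
    simp [mul_assoc, Prod.map]

theorem transAct_fixed {G X : Type*} [Group G] (g : G) (hg : g ≠ 1) (w : FreeGroup (G × X))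
    (hw : transAct G X g w = w) : w = 1 := by
  refine freeGroup_map_fixed ((Equiv.mulLeft g).prodCongr (Equiv.refl X))
    (Equiv.injective _) ?_ w hw
  rintro ⟨a, x⟩ h
  simp at h
  exact hg h

/-- The homomorphism counting occurrences of generators. -/
noncomputable def countHom (G X : Type*) [Group G] :
    FreeGroup (G × X) ⋊[transAct G X] G →* Multiplicative (X →₀ ℤ) :=
  SemidirectProduct.lift
    (FreeGroup.lift fun p => Multiplicative.ofAdd (Finsupp.single p.2 1)) 1 (by
      intro g
      ext p : 1
      simp [transAct])

theorem countHom_span {G X : Type u} [Group G]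
    (B : Set (FreeGroup (G × X) ⋊[transAct G X] G))
    (hB : Set.univ ⊆
      (Subsemigroup.closure B : Set (FreeGroup (G × X) ⋊[transAct G X] G))) :
    Cardinal.mk X ≤ Cardinal.mk B := by
  let F : FreeGroup (G × X) ⋊[transAct G X] G → (X →₀ ℤ) :=
    fun m => Multiplicative.toAdd (countHom G X m)
  have key : ∀ m, F m ∈ Submodule.span ℤ (F '' B) := by
    intro m
    have hm : m ∈ Subsemigroup.closure B := hB (Set.mem_univ m)
    induction hm using Subsemigroup.closure_induction with
    | mem x hx => exact Submodule.subset_span ⟨x, hx, rfl⟩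
    | mul x y _ _ hx hy =>
      have : F (x * y) = F x + F y := by simp [F]
      rw [this]
      exact Submodule.add_mem _ hx hy
  have htop : Submodule.span ℤ (F '' B) = ⊤ := by
    rw [eq_top_iff]
    intro v _
    induction v using Finsupp.induction_linear with
    | zero => exact Submodule.zero_mem _
    | add a b ha hb => exact Submodule.add_mem _ (ha trivial) (hb trivial)
    | single x n =>
      have h := key (SemidirectProduct.inl (FreeGroup.of ((1 : G), x)))
      have h2 : F (SemidirectProduct.inl (FreeGroup.of ((1 : G), x))) = Finsupp.single x 1 := by
        simp [F, countHom]
      rw [h2] at h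
      have := Submodule.smul_mem _ n h
      simpa using this
  have h := rank_span_le (R := ℤ) (F '' B)
  rw [htop, rank_top, rank_finsupp_self] at h
  simp only [Cardinal.lift_id, Cardinal.lift_uzero] at h
  exact h.trans Cardinal.mk_image_le

/-- Lemma 7.3: every group `G` of cardinality `≤ κ` embeds as a malnormal subgroup
into a group `M` with `dim(M) = |M| = κ`. -/
theorem exists_malnormal_embedding
    (κ : Cardinal.{u}) (hκ : Cardinal.aleph0 ≤ κ)
    (G : Type u) [Group G] (hG : Cardinal.mk G ≤ κ) :
    ∃ (M : Type u) (_ : Group M) (ι : G →* M),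
      Function.Injective ι ∧
      (∀ x : M, x ∉ MonoidHom.range ι → ∀ h ∈ MonoidHom.range ι,
        x * h * x⁻¹ ∈ MonoidHom.range ι → h = 1) ∧
      sdim (Set.univ : Set M) = Cardinal.mk M ∧ Cardinal.mk M = κ := by
  obtain ⟨X, rfl⟩ : ∃ X : Type u, Cardinal.mk X = κ := ⟨κ.out, Cardinal.mk_out κ⟩
  have hXne : Nonempty X :=
    Cardinal.mk_ne_zero_iff.mp (Cardinal.aleph0_pos.trans_le hκ).ne'
  have hG0 : Cardinal.mk G ≠ 0 := Cardinal.mk_ne_zero G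
  have hcard : Cardinal.mk (FreeGroup (G × X) ⋊[transAct G X] G) = Cardinal.mk X := by
    rw [Cardinal.mk_congr SemidirectProduct.equivProd, Cardinal.mk_prod, Cardinal.mk_freeGroup,
      Cardinal.mk_prod]
    simp only [Cardinal.lift_id]
    rw [Cardinal.mul_eq_right hκ hG hG0, max_eq_left hκ, Cardinal.mul_eq_left hκ hG hG0]
  refine ⟨FreeGroup (G × X) ⋊[transAct G X] G, inferInstance, SemidirectProduct.inr,
    SemidirectProduct.inr_injective, ?_, ?_, hcard⟩
  · rintro x hx _ ⟨g, rfl⟩ ⟨k, hk⟩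
    by_contra hne
    have hg : g ≠ 1 := fun h => hne (by rw [h, map_one])
    apply hx
    have hl := congrArg SemidirectProduct.left hk
    have hr := congrArg SemidirectProduct.right hk
    have hk2 : k * x.right = x.right * g := by
      simp at hr
      rw [hr]; group
    have hk1 : k ≠ 1 := by
      rintro rfl
      apply hg
      simpa using hk2
    have hk' : SemidirectProduct.inr k * x = x * SemidirectProduct.inr g := by
      rw [hk]; group
    have hl := congrArg SemidirectProduct.left hk'
    simp at hl
    have := transAct_fixed k hk1 _ hl
    refine ⟨x.right, ?_⟩
    ext
    · simp [this]
    · simp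
  · apply le_antisymm
    · apply csInf_le'
      refine ⟨Set.univ, ?_, Cardinal.mk_univ⟩
      exact Subsemigroup.subset_closure
    · refine le_csInf ⟨_, Set.univ, Subsemigroup.subset_closure, rfl⟩ ?_
      rintro c ⟨B, hB, rfl⟩
      rw [hcard]
      exact countHom_span B hB

end ShelahFormalization
end

section
/- Let G be an infinite simple group which is 36-Shelah and such that for every subset U ⊆ G with |U| < |G| there exists x ∈ G with U ∩ xUx⁻¹ ⊆ {e}. Then G is projectively T₁S-discrete. -/
namespace ShelahFormalization

universe u v

/-- A group (monoid) `G` is `n`-Shelah if `Aⁿ = G` for every subset `A ⊆ G` with `|A| = |G|`. -/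
def IsNShelah (G : Type u) [Monoid G] (n : ℕ) : Prop :=
  ∀ A : Set G, Cardinal.mk A = Cardinal.mk G →
    ∀ x : G, ∃ f : Fin n → G, (∀ i, f i ∈ A) ∧ (List.ofFn f).prod = x

/-- A semigroup `X` is projectively `T₁S`-discrete if for every homomorphism `h : X → Y`
to a `T₁` topological semigroup `Y` the image `h[X]` is a discrete subspace of `Y`. -/
def ProjectivelyT1SDiscrete (X : Type u) [Semigroup X] : Prop :=
  ∀ (Y : Type v) [Semigroup Y] [TopologicalSpace Y] [ContinuousMul Y] [T1Space Y]
    (h : X →ₙ* Y), DiscreteTopology (Set.range h)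

theorem exists_nhds_prod {G : Type u} [Monoid G] [TopologicalSpace G] [ContinuousMul G] (n : ℕ) :
    ∀ W ∈ nhds (1 : G), ∃ U ∈ nhds (1 : G), ∀ f : Fin n → G, (∀ i, f i ∈ U) →
      (List.ofFn f).prod ∈ W := by
  induction n with
  | zero =>
    intro W hW
    exact ⟨W, hW, fun f _ => by simpa using mem_of_mem_nhds hW⟩
  | succ n ih =>
    intro W hW
    obtain ⟨V, hVo, hV1, hV⟩ := exists_open_nhds_one_split hW
    obtain ⟨U, hU, hUV⟩ := ih V (hVo.mem_nhds hV1)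
    refine ⟨U ∩ V, Filter.inter_mem hU (hVo.mem_nhds hV1), fun f hf => ?_⟩
    rw [List.ofFn_succ, List.prod_cons]
    exact hV _ (hf 0).2 _ (hUV _ fun i => (hf i.succ).1)

theorem discrete_of_shelah (G : Type u) [Group G] [Infinite G]
    (hShelah : IsNShelah G 36)
    (hmal : ∀ U : Set G, Cardinal.mk U < Cardinal.mk G →
      ∃ x : G, U ∩ ((fun u => x * u * x⁻¹) '' U) ⊆ {1})
    [TopologicalSpace G] [ContinuousMul G] [T1Space G] : DiscreteTopology G := by
  obtain ⟨g, hg⟩ := exists_ne (1 : G)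
  obtain ⟨U, hU, hUW⟩ := exists_nhds_prod (G := G) 36 {g}ᶜ (isOpen_compl_singleton.mem_nhds hg.symm)
  have hlt : Cardinal.mk U < Cardinal.mk G := by
    refine lt_of_le_of_ne (Cardinal.mk_set_le U) fun he => ?_
    obtain ⟨f, hf, hfg⟩ := hShelah U he g
    exact hUW f hf hfg
  obtain ⟨x, hx⟩ := hmal U hlt
  have h2 : (fun u => x * u * x⁻¹) '' U ∈ nhds (1 : G) := by
    have hc : Continuous fun u : G => x⁻¹ * u * x := by fun_prop
    have : (fun u : G => x⁻¹ * u * x) ⁻¹' U ∈ nhds (1 : G) :=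
      hc.continuousAt.preimage_mem_nhds (by simpa using hU)
    refine Filter.mem_of_superset this fun u hu => ⟨_, hu, ?_⟩
    group
  have h1 : ({1} : Set G) ∈ nhds (1 : G) := Filter.mem_of_superset (Filter.inter_mem hU h2) hx
  refine discreteTopology_iff_singleton_mem_nhds.2 fun a => ?_
  have hc : Continuous fun u : G => a⁻¹ * u := by fun_prop
  have : (fun u : G => a⁻¹ * u) ⁻¹' {1} ∈ nhds a :=
    hc.continuousAt.preimage_mem_nhds (by simpa using h1)
  refine Filter.mem_of_superset this fun u hu => ?_
  exact (inv_mul_eq_one.1 hu).symm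

/-- Lemma 8.9: an infinite simple `36`-Shelah group in which every small subset can be
conjugated off itself is projectively `T₁S`-discrete. -/
theorem projectivelyT1SDiscrete_of_shelah
    (G : Type u) [Group G] [Infinite G] (hsimple : IsSimpleGroup G)
    (hShelah : IsNShelah G 36)
    (hmal : ∀ U : Set G, Cardinal.mk U < Cardinal.mk G →
      ∃ x : G, U ∩ ((fun u => x * u * x⁻¹) '' U) ⊆ {1}) :
    ProjectivelyT1SDiscrete.{u, v} G := by
  intro Y _ _ _ _ h
  let N : Subgroup G :=
    { carrier := {g | h g = h 1}
      one_mem' := rfl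
      mul_mem' := by
        intro a b ha hb
        change h (a * b) = h 1
        rw [map_mul, show h a = h 1 from ha, show h b = h 1 from hb, ← map_mul, one_mul]
      inv_mem' := by
        intro a ha
        change h a⁻¹ = h 1
        rw [← mul_one a⁻¹, map_mul, ← show h a = h 1 from ha, ← map_mul, inv_mul_cancel, ha] }
  have hN : N.Normal := ⟨by
    intro a ha g
    change h (g * a * g⁻¹) = h 1
    rw [map_mul, map_mul, show h a = h 1 from ha, ← map_mul, ← map_mul, mul_one, mul_inv_cancel]⟩
  rcases hsimple.eq_bot_or_eq_top_of_normal N hN with hb | ht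
  · have hinj : Function.Injective h := by
      intro a b hab
      have : a⁻¹ * b ∈ N := by
        change h (a⁻¹ * b) = h 1
        rw [map_mul, ← hab, ← map_mul, inv_mul_cancel]
      rw [hb, Subgroup.mem_bot] at this
      exact inv_mul_eq_one.1 this
    letI : TopologicalSpace G := TopologicalSpace.induced h inferInstance
    have hemb : Topology.IsEmbedding h := ⟨⟨rfl⟩, hinj⟩
    haveI : ContinuousMul G := continuousMul_induced h
    haveI : T1Space G := hemb.t1Space
    haveI : DiscreteTopology G := discrete_of_shelah G hShelah hmal
    exact hemb.toHomeomorph.symm.isEmbedding.discreteTopology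
  · have hall : ∀ g, h g = h 1 := fun g => by
      have : g ∈ N := ht ▸ Subgroup.mem_top g
      exact this
    haveI : Subsingleton (Set.range h) := ⟨by
      rintro ⟨_, a, rfl⟩ ⟨_, b, rfl⟩
      exact Subtype.ext ((hall a).trans (hall b).symm)⟩
    infer_instance

end ShelahFormalization
end

section
/- Let G be an infinite simple group which is 36-Shelah, projectively T₁S-discrete, and such that every subset X ⊆ G with |X| < |G| is polybounded in G. Then G is absolutely T₁S-closed. -/
namespace ShelahFormalization

universe u v

/-- An algebraic subset of a semigroup `X`: the preimage of a point under a semigroup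
polynomial `p(x) = c₀ x c₁ x ⋯ x cₙ` (`n ≥ 1`, coefficients in `X¹ = X ∪ {1}`). -/
def IsAlgebraicSet {X : Type u} [Semigroup X] (A : Set X) : Prop :=
  ∃ (m : ℕ) (c : Fin (m + 2) → WithOne X) (b : X),
    A = {x : X |
      c 0 * (List.ofFn fun i : Fin (m + 1) => (x : WithOne X) * c i.succ).prod
        = (b : WithOne X)}

/-- A semigroup `X` is absolutely `T₁S`-closed if for every homomorphism `h : X → Y`
to a `T₁` topological semigroup `Y` the image `h[X]` is closed in `Y`. -/
def AbsolutelyT1SClosed (X : Type u) [Semigroup X] : Prop :=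
  ∀ (Y : Type v) [Semigroup Y] [TopologicalSpace Y] [ContinuousMul Y] [T1Space Y]
    (h : X →ₙ* Y), IsClosed (Set.range h)

/-- Evaluation of `a x c₁ x c₂ ⋯ x cₙ`. -/
def pev {Y : Type v} [Mul Y] (l : List Y) (a x : Y) : Y :=
  l.foldl (fun acc c => acc * x * c) a

theorem pev_cont {Y : Type v} [Semigroup Y] [TopologicalSpace Y] [ContinuousMul Y]
    (l : List Y) {Z : Type v} [TopologicalSpace Z] (f g : Z → Y) (hf : Continuous f)
    (hg : Continuous g) : Continuous fun z => pev l (f z) (g z) := by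
  induction l generalizing f with
  | nil => simpa [pev] using hf
  | cons c l ih =>
    have := ih (fun z => f z * g z * c) (by fun_prop)
    simpa [pev] using this

theorem pev_map {G : Type u} [Group G] {Y : Type v} [Semigroup Y] (h : G →ₙ* Y)
    (l : List G) (a x : G) : pev (l.map h) (h a) (h x) = h (pev l a x) := by
  induction l generalizing a with
  | nil => simp [pev]
  | cons c l ih =>
    have := ih (a * x * c)
    simpa [pev] using this

theorem pev_group {G : Type u} [Group G] (l : List G) (a x : G) :
    pev l a x = a * (l.map (fun c => x * c)).prod := by
  induction l generalizing a with
  | nil => simp [pev]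
  | cons c l ih =>
    have := ih (a * x * c)
    simp only [pev, List.foldl_cons, List.map_cons, List.prod_cons] at this ⊢
    rw [this]; group

theorem alg_group {G : Type u} [Group G] {A : Set G} (hA : IsAlgebraicSet A) :
    ∃ (a c : G) (l : List G) (b : G), ∀ x ∈ A, pev (c :: l) a x = b := by
  obtain ⟨m, c, b, rfl⟩ := hA
  let φ : WithOne G →* G := WithOne.lift (MulHom.id G)
  have hφ : ∀ x : G, φ (x : WithOne G) = x := fun x => by simp [φ]
  refine ⟨φ (c 0), φ (c 1), List.ofFn (fun i : Fin m => φ (c i.succ.succ)), b, ?_⟩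
  intro x hx
  have h1 := congrArg φ hx
  rw [map_mul, map_list_prod, hφ, List.map_ofFn] at h1
  rw [← h1, pev_group, List.ofFn_succ]
  simp [Function.comp_def, hφ, List.map_ofFn]

theorem kernel_dichotomy {G : Type u} [Group G] (hs : IsSimpleGroup G) {Y : Type v}
    [Semigroup Y] (h : G →ₙ* Y) : Function.Injective h ∨ ∀ g, h g = h 1 := by
  let N : Subgroup G :=
    { carrier := {g | h g = h 1}
      one_mem' := rfl
      mul_mem' := by
        intro a b ha hb
        simp only [Set.mem_setOf_eq] at *
        rw [map_mul, ha, hb, ← map_mul, one_mul]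
      inv_mem' := by
        intro a ha
        simp only [Set.mem_setOf_eq] at *
        rw [← mul_one a⁻¹, map_mul, ← ha, ← map_mul, inv_mul_cancel, ha] }
  have hN : N.Normal := ⟨by
    intro n hn g
    have hn' : h n = h 1 := hn
    change h (g * n * g⁻¹) = h 1
    rw [map_mul, map_mul, hn', ← map_mul, ← map_mul, mul_one, mul_inv_cancel]⟩
  rcases hN.eq_bot_or_eq_top with hb | ht
  · left
    intro a b hab
    have : a * b⁻¹ ∈ N := by
      change h (a * b⁻¹) = h 1
      rw [map_mul, hab, ← map_mul, mul_inv_cancel]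
    rw [hb, Subgroup.mem_bot] at this
    exact mul_inv_eq_one.mp this
  · right
    intro g
    have : g ∈ N := by rw [ht]; trivial
    exact this

open Filter Topology in
theorem power_point {G : Type u} [Group G] {Y : Type v} [Semigroup Y] [TopologicalSpace Y]
    [ContinuousMul Y] (h : G →ₙ* Y) (F : Filter G) (y : Y) (hF : Tendsto h F (𝓝 y)) (n : ℕ) :
    ∃ z : Y, ∀ W ∈ 𝓝 z, ∃ A ∈ F, ∀ f : Fin (n + 1) → G, (∀ i, f i ∈ A) →
      h (List.ofFn f).prod ∈ W := by
  induction n with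
  | zero =>
    refine ⟨y, fun W hW => ⟨h ⁻¹' W, hF hW, fun f hf => ?_⟩⟩
    simpa using hf 0
  | succ n ih =>
    obtain ⟨z, hz⟩ := ih
    refine ⟨y * z, fun W hW => ?_⟩
    have hm : Tendsto (fun p : Y × Y => p.1 * p.2) (𝓝 y ×ˢ 𝓝 z) (𝓝 (y * z)) := by
      rw [← nhds_prod_eq]; exact continuous_mul.tendsto (y, z)
    obtain ⟨U, hU, V, hV, hUV⟩ := mem_prod_iff.mp (hm hW)
    obtain ⟨A, hA, hA'⟩ := hz V hV
    refine ⟨h ⁻¹' U ∩ A, inter_mem (hF hU) hA, fun f hf => ?_⟩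
    rw [List.ofFn_succ, List.prod_cons, map_mul]
    exact hUV (Set.mk_mem_prod (hf 0).1 (hA' _ fun i => (hf i.succ).2))

open Filter Topology in
/-- Lemma 8.10: an infinite simple `36`-Shelah projectively `T₁S`-discrete group in which
every subset of smaller cardinality is polybounded is absolutely `T₁S`-closed. -/
theorem absolutelyT1SClosed_of_shelah
    (G : Type u) [Group G] [Infinite G] (hsimple : IsSimpleGroup G)
    (hShelah : IsNShelah G 36)
    (hdisc : ProjectivelyT1SDiscrete.{u, v} G)
    (hpb : ∀ X : Set G, Cardinal.mk X < Cardinal.mk G →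
      ∃ (k : ℕ) (A : Fin k → Set G), (∀ i, IsAlgebraicSet (A i)) ∧ X ⊆ ⋃ i, A i) :
    AbsolutelyT1SClosed.{u, v} G := by
  intro Y _ _ _ _ h
  rcases kernel_dichotomy hsimple h with hinj | hconst
  swap
  · have : Set.range h = {h 1} := by
      ext z
      constructor
      · rintro ⟨g, rfl⟩
        exact hconst g
      · rintro rfl
        exact ⟨1, rfl⟩
    rw [this]
    exact isClosed_singleton
  refine isClosed_of_closure_subset fun y hy => ?_
  haveI : (comap h (𝓝 y)).NeBot := by
    rw [mem_closure_iff_nhds] at hy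
    rw [comap_neBot_iff]
    intro t ht
    obtain ⟨_, h1, g, rfl⟩ := hy t ht
    exact ⟨g, h1⟩
  let F : Ultrafilter G := Ultrafilter.of (comap h (𝓝 y))
  have hF : Tendsto h F (𝓝 y) :=
    (tendsto_comap (f := h)).mono_left (Ultrafilter.of_le _)
  -- some member of `F` is small
  have hsmall : ∃ A ∈ F, Cardinal.mk A < Cardinal.mk G := by
    by_contra hcon
    push Not at hcon
    obtain ⟨z, hz⟩ := power_point h F y hF 35
    have hall : ∀ g : G, h g = z := by
      intro g
      by_contra hne
      obtain ⟨A, hA, hA'⟩ := hz {h g}ᶜ (isOpen_compl_singleton.mem_nhds (fun hh => hne hh.symm))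
      obtain ⟨f, hf, hfg⟩ := hShelah A (le_antisymm (Cardinal.mk_set_le A) (hcon A hA)) g
      have := hA' f hf
      rw [hfg] at this
      exact this rfl
    obtain ⟨g, hg⟩ := exists_ne (1 : G)
    exact hg (hinj ((hall g).trans (hall 1).symm))
  obtain ⟨A, hA, hAc⟩ := hsmall
  obtain ⟨k, B, hB, hAB⟩ := hpb A hAc
  have hBF : ∃ i, B i ∈ F := by
    have h1 : (⋃ i ∈ (Set.univ : Set (Fin k)), B i) ∈ F := by
      simpa using mem_of_superset (f := (F : Filter G)) hA hAB
    obtain ⟨i, -, hi⟩ := (Ultrafilter.finite_biUnion_mem_iff Set.finite_univ).mp h1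
    exact ⟨i, hi⟩
  obtain ⟨i, hi⟩ := hBF
  obtain ⟨a, c, l, b, hp⟩ := alg_group (hB i)
  have hlim : Tendsto (fun g => pev ((c :: l).map h) (h a) (h g)) F
      (𝓝 (pev ((c :: l).map h) (h a) y)) :=
    ((pev_cont ((c :: l).map h) (fun _ : Y => h a) id continuous_const continuous_id).tendsto
      y).comp hF
  have hev : (fun g => pev ((c :: l).map h) (h a) (h g)) =ᶠ[(F : Filter G)] fun _ => h b := by
    filter_upwards [hi] with g hg
    rw [pev_map, hp g hg]
  have hyb : h b = pev ((c :: l).map h) (h a) y :=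
    tendsto_const_nhds_iff.mp (hlim.congr' hev)
  haveI := hdisc Y h
  obtain ⟨O, hO, hOb⟩ := isOpen_induced_iff.mp
    (isOpen_discrete ({⟨h b, b, rfl⟩} : Set (Set.range h)))
  have hOmem : ∀ g, h g ∈ O ↔ g = b := by
    intro g
    have := Set.ext_iff.mp hOb ⟨h g, g, rfl⟩
    simp only [Set.mem_preimage, Set.mem_singleton_iff] at this
    rw [this]
    exact Subtype.ext_iff.trans hinj.eq_iff
  have hcont2 : Continuous fun p : Y × Y => pev (l.map h) (h a * p.1 * h c) p.2 :=
    pev_cont (l.map h) (fun p : Y × Y => h a * p.1 * h c) Prod.snd (by fun_prop) continuous_snd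
  have hyO : pev (l.map h) (h a * y * h c) y ∈ O := by
    have : pev (l.map h) (h a * y * h c) y = h b := by
      rw [hyb]; simp [pev]
    rw [this]
    exact (hOmem b).mpr rfl
  have hO2 : (fun p : Y × Y => pev (l.map h) (h a * p.1 * h c) p.2) ⁻¹' O ∈ 𝓝 y ×ˢ 𝓝 y := by
    rw [← nhds_prod_eq]
    exact (hO.preimage hcont2).mem_nhds hyO
  obtain ⟨U, hU, V, hV, hUV⟩ := mem_prod_iff.mp hO2
  have hS : h ⁻¹' (U ∩ V) ∈ (F : Filter G) := hF (inter_mem hU hV)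
  have key : ∀ g ∈ h ⁻¹' (U ∩ V), ∀ g' ∈ h ⁻¹' (U ∩ V), pev l (a * g * c) g' = b := by
    intro g hg g' hg'
    have : pev (l.map h) (h a * h g * h c) (h g') ∈ O := hUV (Set.mk_mem_prod hg.1 hg'.2)
    rw [← map_mul, ← map_mul, pev_map] at this
    exact (hOmem _).mp this
  obtain ⟨g₀, hg₀⟩ := F.nonempty_of_mem hS
  have hev2 : h =ᶠ[(F : Filter G)] fun _ => h g₀ := by
    filter_upwards [hS] with g hg
    have := (key g hg g₀ hg₀).trans (key g₀ hg₀ g₀ hg₀).symm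
    rw [pev_group, pev_group] at this
    have h3 : g = g₀ := by simpa using this
    rw [h3]
  exact ⟨g₀, tendsto_const_nhds_iff.mp (hF.congr' hev2)⟩

end ShelahFormalization
end

section
/- Let G be a group and let λ be an infinite cardinal such that for every subset C ⊆ G with |C| < λ there exists x ∈ G with xc₁xc₂⋯xcₙ ≠ e for all n ≥ 1 and all c₁,…,cₙ ∈ C. Then cov(G; A_G) ≥ λ; in particular, G is not polybounded. -/
namespace ShelahFormalization

theorem alg_normal {G : Type u} [Group G] {A : Set G} (hA : IsAlgebraicSet A) :
    ∃ (n : ℕ) (d : Fin (n + 1) → G), ∀ x ∈ A,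
      (List.ofFn fun i : Fin (n + 1) => x * d i).prod = 1 := by
  obtain ⟨m, c, b, rfl⟩ := hA
  let φ : WithOne G →* G := WithOne.lift (MulHom.id G)
  have hφ : ∀ g : G, φ (g : WithOne G) = g := fun g => by simp [φ]
  refine ⟨m, fun i => φ (c i.succ) * (if i = Fin.last m then b⁻¹ * φ (c 0) else 1), ?_⟩
  intro x hx
  have hx' := congrArg φ (show _ = _ from hx)
  rw [map_mul, map_list_prod, List.map_ofFn, hφ, List.ofFn_succ', List.concat_eq_append,
    List.prod_append, List.prod_singleton] at hx'
  rw [List.ofFn_succ', List.concat_eq_append, List.prod_append, List.prod_singleton]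
  simp only [Function.comp_def, map_mul, hφ] at hx'
  have hne : ∀ i : Fin m, i.castSucc ≠ Fin.last m := fun i => (Fin.castSucc_lt_last i).ne
  simp only [hne, if_false, if_true, mul_one]
  rw [← hx']
  group

/-- If for every subset `C ⊆ G` with `|C| < λ` there exists `x ∈ G` with
`x c₁ x c₂ ⋯ x cₙ ≠ e` for all `n ≥ 1` and `c₁, …, cₙ ∈ C`, then every cover of `G` by
algebraic sets has cardinality `≥ λ`; in particular `G` is not polybounded. -/
theorem cov_ge_of_avoidance
    (G : Type u) [Group G] (lam : Cardinal.{u}) (hlam : Cardinal.aleph0 ≤ lam)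
    (h : ∀ C : Set G, Cardinal.mk C < lam → ∃ x : G, ∀ n : ℕ, 1 ≤ n →
      ∀ c : Fin n → G, (∀ i, c i ∈ C) → (List.ofFn fun i : Fin n => x * c i).prod ≠ 1) :
    (∀ 𝓑 : Set (Set G), (∀ A ∈ 𝓑, IsAlgebraicSet A) → ⋃₀ 𝓑 = Set.univ →
      lam ≤ Cardinal.mk 𝓑) ∧
    ¬ ∃ (k : ℕ) (A : Fin k → Set G), (∀ i, IsAlgebraicSet (A i)) ∧ ⋃ i, A i = Set.univ := by
  have key : ∀ 𝓑 : Set (Set G), (∀ A ∈ 𝓑, IsAlgebraicSet A) → ⋃₀ 𝓑 = Set.univ →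
      lam ≤ Cardinal.mk 𝓑 := by
    intro 𝓑 hB hU
    by_contra hlt
    rw [not_le] at hlt
    choose n d hd using fun A : 𝓑 => alg_normal (hB A.1 A.2)
    let f : (Σ A : 𝓑, Fin (n A + 1)) → G := fun p => d p.1 p.2
    have hC : Cardinal.mk (Set.range f) < lam := by
      rcases lt_or_ge (Cardinal.mk 𝓑) Cardinal.aleph0 with hf | hi
      · haveI : Finite 𝓑 := Cardinal.lt_aleph0_iff_finite.mp hf
        exact lt_of_lt_of_le (Cardinal.lt_aleph0_iff_finite.mpr (Set.finite_range f)) hlam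
      · refine lt_of_le_of_lt ?_ hlt
        refine Cardinal.mk_range_le.trans ?_
        rw [Cardinal.mk_sigma]
        refine (Cardinal.sum_le_sum _ (fun _ => Cardinal.aleph0) fun A => ?_).trans ?_
        · exact Cardinal.mk_le_aleph0
        · simp [Cardinal.mul_aleph0_eq hi]
    obtain ⟨x, hx⟩ := h _ hC
    obtain ⟨A, hA, hxA⟩ : x ∈ ⋃₀ 𝓑 := hU ▸ Set.mem_univ x
    exact hx (n ⟨A, hA⟩ + 1) (by omega) (d ⟨A, hA⟩) (fun i => ⟨⟨⟨A, hA⟩, i⟩, rfl⟩)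
      (hd ⟨A, hA⟩ x hxA)
  refine ⟨key, ?_⟩
  rintro ⟨k, A, hA, hU⟩
  have h1 := key (Set.range A) (by rintro _ ⟨i, rfl⟩; exact hA i) (by rw [Set.sUnion_range, hU])
  exact absurd (hlam.trans h1)
    (not_le.mpr (Cardinal.lt_aleph0_iff_finite.mpr (Set.finite_range A)))

end ShelahFormalization
end

section
/- Every 3-Shelah group is finite; that is, if G is a group such that A³ = G for every subset A ⊆ G with |A| = |G|, then G is finite. -/
theorem shelah_small_union {G : Type u} [Infinite G] {S T : Set G}
    (hS : Cardinal.mk S < Cardinal.mk G) (hT : Cardinal.mk T < Cardinal.mk G) :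
    Cardinal.mk (S ∪ T : Set G) < Cardinal.mk G :=
  (Cardinal.mk_union_le S T).trans_lt
    (Cardinal.add_lt_of_lt (Cardinal.aleph0_le_mk G) hS hT)

theorem shelah_small_image {G : Type u} {S : Set G} (f : G → G)
    (hS : Cardinal.mk S < Cardinal.mk G) :
    Cardinal.mk (f '' S : Set G) < Cardinal.mk G :=
  Cardinal.mk_image_le.trans_lt hS

theorem shelah_small_image2 {G : Type u} [Infinite G] {S : Set G} (f : G → G → G)
    (hS : Cardinal.mk S < Cardinal.mk G) :
    Cardinal.mk (Set.image2 f S S : Set G) < Cardinal.mk G := by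
  refine lt_of_le_of_lt ?_ (Cardinal.mul_lt_of_lt (Cardinal.aleph0_le_mk G) hS hS)
  rw [Cardinal.mul_def]
  refine Cardinal.mk_le_of_surjective (f := fun p : S × S =>
    (⟨f p.1 p.2, Set.mem_image2_of_mem p.1.2 p.2.2⟩ : Set.image2 f S S)) ?_
  rintro ⟨_, a, ha, b, hb, rfl⟩
  exact ⟨(⟨a, ha⟩, ⟨b, hb⟩), rfl⟩

theorem shelah_small_mono {G : Type u} {S T : Set G} (h : S ⊆ T)
    (hT : Cardinal.mk T < Cardinal.mk G) : Cardinal.mk S < Cardinal.mk G :=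
  (Cardinal.mk_le_mk_of_subset h).trans_lt hT

/-- Maximal subsets of `X` avoiding a ternary relation. -/
theorem shelah_zorn {G : Type u} (X : Set G) (R : G → G → G → Prop) :
    ∃ A ⊆ X, (∀ a ∈ A, ∀ b ∈ A, ∀ c ∈ A, ¬ R a b c) ∧
      ∀ x ∈ X, x ∉ A → ∃ a ∈ insert x A, ∃ b ∈ insert x A, ∃ c ∈ insert x A, R a b c := by
  obtain ⟨A, hA⟩ := zorn_subset
    {A : Set G | A ⊆ X ∧ ∀ a ∈ A, ∀ b ∈ A, ∀ c ∈ A, ¬ R a b c} (by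
      intro C hC hch
      refine ⟨⋃₀ C, ⟨Set.sUnion_subset fun s hs => (hC hs).1, ?_⟩,
        fun s hs => Set.subset_sUnion_of_mem hs⟩
      rintro a ⟨s, hs, has⟩ b ⟨t, ht, hbt⟩ c ⟨r, hr, hcr⟩
      obtain ⟨p, hp, hsp, htp⟩ := hch.directedOn s hs t ht
      obtain ⟨q, hq, hpq, hrq⟩ := hch.directedOn p hp r hr
      exact (hC hq).2 a (hpq (hsp has)) b (hpq (htp hbt)) c (hrq hcr))
  refine ⟨A, hA.prop.1, hA.prop.2, fun x hx hxA => ?_⟩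
  by_contra hcon
  push Not at hcon
  exact hxA (hA.le_of_ge (y := insert x A)
    ⟨Set.insert_subset hx hA.prop.1, hcon⟩ (Set.subset_insert x A) (Set.mem_insert x A))

/-- A fixed-point-free function on a large set has a large free set. -/
theorem shelah_free {G : Type u} [Infinite G] (X : Set G)
    (hX : ¬ Cardinal.mk X < Cardinal.mk G) (f : G → G) (hf : ∀ x ∈ X, f x ≠ x) :
    ∃ Y ⊆ X, ¬ Cardinal.mk Y < Cardinal.mk G ∧ ∀ y ∈ Y, f y ∉ Y := by
  obtain ⟨A, hAX, hA, hmax⟩ := shelah_zorn X (fun a b _ => f a = b)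
  by_cases hs : Cardinal.mk A < Cardinal.mk G
  · have hU := shelah_small_union hs (shelah_small_image f hs)
    refine ⟨X \ (A ∪ f '' A), Set.sdiff_subset, fun hlt => hX ?_, ?_⟩
    · refine shelah_small_mono ?_ (shelah_small_union hlt hU)
      rw [Set.sdiff_union_self]
      exact Set.subset_union_left
    · rintro y ⟨hyX, hyU⟩ ⟨_, hfU⟩
      have hyA : y ∉ A := fun h => hyU (Or.inl h)
      obtain ⟨a, ha, b, hb, _, _, hab⟩ := hmax y hyX hyA
      rcases ha with rfl | ha
      · rcases hb with rfl | hb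
        · exact hf _ hyX hab
        · exact hfU (Or.inl (hab ▸ hb))
      · rcases hb with rfl | hb
        · exact hyU (Or.inr ⟨a, ha, hab⟩)
        · exact hA a ha b hb b hb hab
  · exact ⟨A, hAX, hs, fun y hy hfy => hA y hy _ hfy y hy rfl⟩

/-- Cornullier's theorem: every `3`-Shelah group is finite. -/
theorem finite_of_threeShelah (G : Type u) [Group G]
    (h : ∀ A : Set G, Cardinal.mk A = Cardinal.mk G →
      ∀ x : G, ∃ a ∈ A, ∃ b ∈ A, ∃ c ∈ A, a * b * c = x) :
    Finite G := by
  by_contra hfin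
  have : Infinite G := not_finite_iff_infinite.mp hfin
  -- choose the element to be omitted
  obtain ⟨g, X, hX, hg⟩ : ∃ g : G, ∃ X : Set G, ¬ Cardinal.mk X < Cardinal.mk G ∧
      ∀ x ∈ X, x * x * x ≠ g := by
    by_cases h1 : Cardinal.mk {x : G | x * x * x ≠ 1} < Cardinal.mk G
    · obtain ⟨g, hg⟩ := exists_ne (1 : G)
      refine ⟨g, {x : G | x * x * x = 1}, fun h2 => ?_, fun x hx hxg => hg (hxg.symm.trans hx)⟩
      have h3 := shelah_small_union h1 h2
      have h4 : {x : G | x * x * x ≠ 1} ∪ {x : G | x * x * x = 1} = Set.univ := by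
        ext x
        simp only [Set.mem_union, Set.mem_ofPred_eq, Set.mem_univ, iff_true]
        exact (em _).symm
      rw [h4, Cardinal.mk_univ] at h3
      exact lt_irrefl _ h3
    · exact ⟨1, _, h1, fun x hx => hx⟩
  have e1 : ∀ x y : G, x * x * y = g → x⁻¹ * x⁻¹ * g = y := by
    rintro x y rfl; group
  have e2 : ∀ x y : G, x * y * x = g → x⁻¹ * g * x⁻¹ = y := by
    rintro x y rfl; group
  have e3 : ∀ x y : G, y * x * x = g → g * x⁻¹ * x⁻¹ = y := by
    rintro x y rfl; group
  obtain ⟨X1, hX1, hb1, hf1⟩ := shelah_free X hX (fun x => x⁻¹ * x⁻¹ * g) (by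
    intro x hx hh
    apply hg x hx
    have : x * x * (x⁻¹ * x⁻¹ * g) = g := by group
    simpa only [hh] using this)
  obtain ⟨X2, hX2, hb2, hf2⟩ := shelah_free X1 hb1 (fun x => x⁻¹ * g * x⁻¹) (by
    intro x hx hh
    apply hg x (hX1 hx)
    have : x * (x⁻¹ * g * x⁻¹) * x = g := by group
    simpa only [hh] using this)
  obtain ⟨X3, hX3, hb3, hf3⟩ := shelah_free X2 hb2 (fun x => g * x⁻¹ * x⁻¹) (by
    intro x hx hh
    apply hg x (hX1 (hX2 hx))
    have : (g * x⁻¹ * x⁻¹) * x * x = g := by group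
    simpa only [hh] using this)
  have k1 : ∀ x ∈ X3, ∀ y ∈ X3, x * x * y ≠ g := fun x hx y hy hh =>
    hf1 x (hX2 (hX3 hx)) (by simpa only [e1 x y hh] using hX2 (hX3 hy))
  have k2 : ∀ x ∈ X3, ∀ y ∈ X3, x * y * x ≠ g := fun x hx y hy hh =>
    hf2 x (hX3 hx) (by simpa only [e2 x y hh] using hX3 hy)
  have k3 : ∀ x ∈ X3, ∀ y ∈ X3, y * x * x ≠ g := fun x hx y hy hh =>
    hf3 x hx (by simpa only [e3 x y hh] using hy)
  obtain ⟨A, hAX, hA, hmax⟩ := shelah_zorn X3 (fun a b c => a * b * c = g)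
  have hs : Cardinal.mk A < Cardinal.mk G := by
    refine lt_of_le_of_ne (Cardinal.mk_set_le A) fun heq => ?_
    obtain ⟨a, ha, b, hb, c, hc, habc⟩ := h A heq g
    exact hA a ha b hb c hc habc
  apply hb3
  refine shelah_small_mono ?_ (shelah_small_union hs (shelah_small_union
    (shelah_small_image2 (fun b c => g * c⁻¹ * b⁻¹) hs) (shelah_small_union
    (shelah_small_image2 (fun a c => a⁻¹ * g * c⁻¹) hs)
    (shelah_small_image2 (fun a b => b⁻¹ * a⁻¹ * g) hs))))
  intro x hx
  by_cases hxA : x ∈ A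
  · exact Or.inl hxA
  right
  obtain ⟨a, ha, b, hb, c, hc, habc⟩ := hmax x hx hxA
  rcases ha with rfl | ha <;> rcases hb with rfl | hb <;> rcases hc with rfl | hc
  · exact absurd habc (k1 _ hx _ hx)
  · exact absurd habc (k1 _ hx _ (hAX hc))
  · exact absurd habc (k2 _ hx _ (hAX hb))
  · exact Or.inl ⟨b, hb, c, hc, by subst habc; group⟩
  · exact absurd habc (k3 _ hx _ (hAX ha))
  · exact Or.inr (Or.inl ⟨a, ha, c, hc, by subst habc; group⟩)
  · exact Or.inr (Or.inr ⟨a, ha, b, hb, by subst habc; group⟩)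
  · exact absurd habc (hA a ha b hb c hc)
end

section
/- Every zero-closed infinite semigroup X has cov(X; A_X) < |X|. -/
namespace ShelahFormalization

/-- A semigroup `X` is zero-closed if `X` is closed in its zero-extension `X⁰ = X ∪ {0}`
endowed with any Hausdorff semigroup topology. -/
def ZeroClosed (X : Type u) [Semigroup X] : Prop :=
  ∀ τ : TopologicalSpace (WithZero X), @ContinuousMul (WithZero X) τ _ →
    @T2Space (WithZero X) τ →
      @IsClosed (WithZero X) τ (Set.range (fun x : X => (x : WithZero X)))

/-- Neighbourhood systems at zero witness failure of zero-closedness. -/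
theorem not_zeroClosed_of_system {X I : Type u} [Semigroup X] [LinearOrder I] [Nonempty I]
    (U : I → Set X) (anti : ∀ n m, n ≤ m → U m ⊆ U n) (ne : ∀ n, (U n).Nonempty)
    (hmul : ∀ n, ∃ m, ∀ x ∈ U m, ∀ y ∈ U m, x * y ∈ U n)
    (hc : ∀ n x, ∃ m, ∀ y ∈ U m, x * y ∈ U n ∧ y * x ∈ U n)
    (hsep : ∀ x, ∃ n, x ∉ U n) : ¬ ZeroClosed X := by
  intro h
  let τ : TopologicalSpace (WithZero X) :=
    { IsOpen := fun V => (0 : WithZero X) ∈ V → ∃ n, ∀ x ∈ U n, (x : WithZero X) ∈ V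
      isOpen_univ := fun _ => ⟨Classical.arbitrary I, fun _ _ => trivial⟩
      isOpen_inter := by
        rintro s t hs ht ⟨h1, h2⟩
        obtain ⟨n, hn⟩ := hs h1
        obtain ⟨m, hm⟩ := ht h2
        exact ⟨max n m, fun x hx => ⟨hn x (anti _ _ (le_max_left _ _) hx),
          hm x (anti _ _ (le_max_right _ _) hx)⟩⟩
      isOpen_sUnion := by
        rintro S hS ⟨t, ht, h0⟩
        obtain ⟨n, hn⟩ := hS t ht h0
        exact ⟨n, fun x hx => ⟨t, ht, hn x hx⟩⟩ }
  have hopen : ∀ V : Set (WithZero X), @IsOpen _ τ V ↔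
      ((0 : WithZero X) ∈ V → ∃ n, ∀ x ∈ U n, (x : WithZero X) ∈ V) := fun V => Iff.rfl
  have hsing : ∀ x : X, @IsOpen _ τ {(x : WithZero X)} := by
    intro x
    rw [hopen]
    intro h0
    exact absurd h0.symm WithZero.coe_ne_zero
  have hU : ∀ n, @IsOpen _ τ (insert (0 : WithZero X) ((fun x : X => (x : WithZero X)) '' U n)) := by
    intro n
    rw [hopen]
    exact fun _ => ⟨n, fun x hx => Or.inr ⟨x, hx, rfl⟩⟩
  have hT2 : @T2Space (WithZero X) τ := by
    have key : ∀ x : X, ∃ u v : Set (WithZero X), @IsOpen _ τ u ∧ @IsOpen _ τ v ∧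
        (x : WithZero X) ∈ u ∧ (0 : WithZero X) ∈ v ∧ Disjoint u v := by
      intro x
      obtain ⟨n, hn⟩ := hsep x
      refine ⟨_, _, hsing x, hU n, rfl, Or.inl rfl, ?_⟩
      rw [Set.disjoint_singleton_left]
      rintro (h0 | ⟨y, hy, hyx⟩)
      · exact WithZero.coe_ne_zero h0
      · exact hn (WithZero.coe_inj.1 hyx ▸ hy)
    refine ⟨fun a b hab => ?_⟩
    induction a with
    | zero =>
      induction b with
      | zero => exact absurd rfl hab
      | coe y =>
        obtain ⟨u, v, hu, hv, h1, h2, h3⟩ := key y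
        exact ⟨v, u, hv, hu, h2, h1, h3.symm⟩
    | coe x =>
      induction b with
      | zero => exact key x
      | coe y =>
        refine ⟨_, _, hsing x, hsing y, rfl, rfl, ?_⟩
        rw [Set.disjoint_singleton]
        exact hab
  have hCM : @ContinuousMul (WithZero X) τ _ := by
    refine @ContinuousMul.mk _ τ _ ?_
    rw [continuous_def]
    intro V hV
    rw [isOpen_prod_iff]
    intro a b hab
    have hab' : a * b ∈ V := hab
    induction a with
    | zero =>
      have h0 : (0 : WithZero X) ∈ V := by simpa using hab'
      obtain ⟨n, hn⟩ := hV h0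
      induction b with
      | zero =>
        obtain ⟨m, hm⟩ := hmul n
        refine ⟨_, _, hU m, hU m, Or.inl rfl, Or.inl rfl, ?_⟩
        rintro ⟨p, q⟩ ⟨hp, hq⟩
        change p * q ∈ V
        rcases hp with rfl | ⟨x, hx, rfl⟩
        · simpa using h0
        rcases hq with rfl | ⟨y, hy, rfl⟩
        · simpa using h0
        exact hn _ (hm x hx y hy)
      | coe y =>
        obtain ⟨m, hm⟩ := hc n y
        refine ⟨_, _, hU m, hsing y, Or.inl rfl, rfl, ?_⟩
        rintro ⟨p, q⟩ ⟨hp, hq⟩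
        change p * q ∈ V
        obtain rfl : q = y := hq
        rcases hp with rfl | ⟨x, hx, rfl⟩
        · simpa using h0
        exact hn _ (hm x hx).2
    | coe x =>
      induction b with
      | zero =>
        have h0 : (0 : WithZero X) ∈ V := by simpa using hab'
        obtain ⟨n, hn⟩ := hV h0
        obtain ⟨m, hm⟩ := hc n x
        refine ⟨_, _, hsing x, hU m, rfl, Or.inl rfl, ?_⟩
        rintro ⟨p, q⟩ ⟨hp, hq⟩
        change p * q ∈ V
        obtain rfl : p = x := hp
        rcases hq with rfl | ⟨y, hy, rfl⟩
        · simpa using h0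
        exact hn _ (hm y hy).1
      | coe y =>
        refine ⟨_, _, hsing x, hsing y, rfl, rfl, ?_⟩
        rintro ⟨p, q⟩ ⟨hp, hq⟩
        obtain rfl : p = x := hp
        obtain rfl : q = y := hq
        exact hab
  have hcl := (h τ hCM hT2).isOpen_compl
  rw [hopen] at hcl
  obtain ⟨n, hn⟩ := hcl (by rintro ⟨x, hx⟩; exact WithZero.coe_ne_zero hx)
  obtain ⟨x, hx⟩ := ne n
  exact hn x hx ⟨x, rfl⟩

/-- Polynomial maps, in list form. -/
def IsPolyL {X : Type u} [Semigroup X] (p : X → X) : Prop :=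
  ∃ (c : WithOne X) (l : List (WithOne X)) (a : WithOne X),
    ∀ x : X, (p x : WithOne X) = c * ((l ++ [a]).map fun d => (x : WithOne X) * d).prod

theorem IsPolyL.id {X : Type u} [Semigroup X] : IsPolyL (fun x : X => x) :=
  ⟨1, [], 1, fun x => by simp⟩

theorem IsPolyL.mul {X : Type u} [Semigroup X] {p q : X → X} (hp : IsPolyL p) (hq : IsPolyL q) :
    IsPolyL (fun x => p x * q x) := by
  obtain ⟨c, l, a, h⟩ := hp
  obtain ⟨d, m, b, k⟩ := hq
  refine ⟨c, l ++ [a * d] ++ m, b, fun x => ?_⟩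
  rw [WithOne.coe_mul, h, k]
  simp [mul_assoc]

theorem IsPolyL.const_mul {X : Type u} [Semigroup X] {p : X → X} (hp : IsPolyL p) (e : X) :
    IsPolyL (fun x => e * p x) := by
  obtain ⟨c, l, a, h⟩ := hp
  refine ⟨e * c, l, a, fun x => ?_⟩
  rw [WithOne.coe_mul, h]
  simp [mul_assoc]

theorem IsPolyL.mul_const {X : Type u} [Semigroup X] {p : X → X} (hp : IsPolyL p) (e : X) :
    IsPolyL (fun x => p x * e) := by
  obtain ⟨c, l, a, h⟩ := hp
  refine ⟨c, l, a * e, fun x => ?_⟩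
  rw [WithOne.coe_mul, h]
  simp [mul_assoc]

theorem IsPolyL.isAlgebraicSet {X : Type u} [Semigroup X] {p : X → X} (hp : IsPolyL p) (b : X) :
    IsAlgebraicSet {x | p x = b} := by
  obtain ⟨c, l, a, h⟩ := hp
  have hne : l ++ [a] ≠ [] := by simp
  generalize l ++ [a] = L at h hne
  obtain ⟨d, t, rfl⟩ := List.exists_cons_of_ne_nil hne
  refine ⟨t.length, Fin.cons c (fun i : Fin (t.length + 1) => (d :: t).get i), b, ?_⟩
  ext x
  have e : (List.ofFn fun i : Fin (t.length + 1) => (x : WithOne X) * (d :: t).get i)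
      = (d :: t).map fun d => (x : WithOne X) * d := by
    have := List.map_ofFn (f := fun i : Fin (t.length + 1) => (d :: t).get i)
      (g := fun d => (x : WithOne X) * d)
    rw [show (List.ofFn fun i : Fin (t.length + 1) => (d :: t).get i) = d :: t from
      List.ofFn_get (d :: t)] at this
    exact this.symm
  simp only [Set.mem_ofPred_eq, Fin.cons_zero, Fin.cons_succ]
  rw [e, ← h x, WithOne.coe_inj]

/-- Polynomials of complexity at most `j` over the coefficient set `F`. -/
def PB {X : Type u} [Semigroup X] (F : Set X) : ℕ → Set (X → X)
  | 0 => {fun x => x}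
  | j + 1 => PB F j ∪ (Set.image2 (fun p q x => p x * q x) (PB F j) (PB F j) ∪
      (Set.image2 (fun c p x => c * p x) F (PB F j) ∪
        Set.image2 (fun c p x => p x * c) F (PB F j)))

theorem PB_poly {X : Type u} [Semigroup X] (F : Set X) (j : ℕ) : ∀ p ∈ PB F j, IsPolyL p := by
  induction j with
  | zero => rintro p rfl; exact IsPolyL.id
  | succ j ih =>
    rintro p (hp | ⟨q, hq, r, hr, rfl⟩ | ⟨c, hc, q, hq, rfl⟩ | ⟨c, hc, q, hq, rfl⟩)
    · exact ih p hp
    · exact (ih q hq).mul (ih r hr)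
    · exact (ih q hq).const_mul c
    · exact (ih q hq).mul_const c

theorem PB_mono {X : Type u} [Semigroup X] (F : Set X) {i j : ℕ} (h : i ≤ j) : PB F i ⊆ PB F j := by
  induction h with
  | refl => exact subset_rfl
  | step _ ih => exact ih.trans Set.subset_union_left

theorem PB_finite {X : Type u} [Semigroup X] (F : Set X) (hF : F.Finite) (j : ℕ) :
    (PB F j).Finite := by
  induction j with
  | zero => exact Set.finite_singleton _
  | succ j ih =>
    exact ih.union ((ih.image2 _ ih).union ((hF.image2 _ ih).union (hF.image2 _ ih)))

theorem mk_image2_le_of {A B C : Type u} (f : A → B → C) (s : Set A) (t : Set B) (c : Cardinal.{u})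
    (hc : Cardinal.aleph0 ≤ c) (hs : Cardinal.mk s ≤ c) (ht : Cardinal.mk t ≤ c) :
    Cardinal.mk (Set.image2 f s t) ≤ c := by
  rw [← Set.image_prod]
  refine Cardinal.mk_image_le.trans ?_
  rw [Cardinal.mk_setProd]
  simpa using Cardinal.mul_le_of_le hc hs ht

theorem mk_union_le_of {A : Type u} (s t : Set A) (c : Cardinal.{u})
    (hc : Cardinal.aleph0 ≤ c) (hs : Cardinal.mk s ≤ c) (ht : Cardinal.mk t ≤ c) :
    Cardinal.mk (s ∪ t : Set A) ≤ c :=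
  (Cardinal.mk_union_le s t).trans (Cardinal.add_le_of_le hc hs ht)

theorem PB_card {X : Type u} [Semigroup X] (F : Set X) (c : Cardinal.{u})
    (hc : Cardinal.aleph0 ≤ c) (hF : Cardinal.mk F ≤ c) (j : ℕ) :
    Cardinal.mk (PB F j) ≤ c := by
  induction j with
  | zero =>
    change Cardinal.mk ({fun x => x} : Set (X → X)) ≤ c
    rw [Cardinal.mk_singleton]
    exact Cardinal.one_le_aleph0.trans hc
  | succ j ih =>
    refine mk_union_le_of _ _ _ hc ih (mk_union_le_of _ _ _ hc ?_ (mk_union_le_of _ _ _ hc ?_ ?_))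
    · exact mk_image2_le_of _ _ _ _ hc ih ih
    · exact mk_image2_le_of _ _ _ _ hc hF ih
    · exact mk_image2_le_of _ _ _ _ hc hF ih

/-- Polynomials over `F` whose complexity is bounded by the cardinal `d`. -/
def PBC {X : Type u} [Semigroup X] (F : Set X) (d : Cardinal.{u}) : Set (X → X) :=
  {p | ∃ j : ℕ, (j : Cardinal.{u}) ≤ d ∧ p ∈ PB F j}

theorem PBC_finite {X : Type u} [Semigroup X] (F : Set X) (hF : F.Finite) (d : Cardinal.{u})
    (hd : d < Cardinal.aleph0) : (PBC F d).Finite := by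
  obtain ⟨n, rfl⟩ := Cardinal.lt_aleph0.1 hd
  refine (PB_finite F hF n).subset ?_
  rintro p ⟨j, hj, hp⟩
  exact PB_mono F (by exact_mod_cast hj) hp

theorem PBC_card {X : Type u} [Semigroup X] (F : Set X) (c d : Cardinal.{u})
    (hc : Cardinal.aleph0 ≤ c) (hF : Cardinal.mk F ≤ c) : Cardinal.mk (PBC F d) ≤ c := by
  have : PBC F d ⊆ ⋃ j : ULift.{u} ℕ, PB F j.down := by
    rintro p ⟨j, hj, hp⟩
    exact Set.mem_iUnion.2 ⟨⟨j⟩, hp⟩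
  refine (Cardinal.mk_le_mk_of_subset this).trans ((Cardinal.mk_iUnion_le _).trans ?_)
  refine Cardinal.mul_le_of_le hc (by simpa using hc) ?_
  exact ciSup_le' fun j => PB_card F c hc hF _

/-- Coefficients available at stage `k`. -/
def coeffs {X I : Type u} [Semigroup X] [LinearOrder I] (e : I → X) (k : I)
    (r : ∀ l, l < k → X × Set X) : Set X :=
  e '' Set.Iic k ∪ ⋃ l : Set.Iio k, (fun p : X → X => p (r l l.2).1) ''
    PBC (r l l.2).2 (Cardinal.mk (Set.Iio l.1))

open Classical in
/-- One step of the recursive construction. -/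
noncomputable def stepFn {X I : Type u} [Semigroup X] [LinearOrder I] (e : I → X) (k : I)
    (r : ∀ l, l < k → X × Set X) : X × Set X :=
  (if h : ∃ z : X, ∀ p ∈ PBC (coeffs e k r) (Cardinal.mk (Set.Iio k)), p z ∉ e '' Set.Iic k
    then h.choose else e k, coeffs e k r)

/-- Lemma 2.2: every zero-closed infinite semigroup `X` admits a cover by fewer than `|X|`
many algebraic sets, i.e. `cov(X; A_X) < |X|`. -/
theorem cov_lt_of_zeroClosed
    (X : Type u) [Semigroup X] [Infinite X] (h : ZeroClosed X) :
    ∃ 𝓑 : Set (Set X), (∀ A ∈ 𝓑, IsAlgebraicSet A) ∧ ⋃₀ 𝓑 = Set.univ ∧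
      Cardinal.mk 𝓑 < Cardinal.mk X := by
  by_contra hcov
  have hω : Cardinal.aleph0 ≤ Cardinal.mk X := Cardinal.aleph0_le_mk X
  obtain ⟨I, _, _, _, hnomax, hseg, ⟨e⟩⟩ : ∃ (I : Type u) (_ : LinearOrder I)
      (_ : WellFoundedLT I) (_ : Nonempty I), NoMaxOrder I ∧
      (∀ k : I, Cardinal.mk (Set.Iio k) < Cardinal.mk X) ∧ Nonempty (I ≃ X) := by
    refine ⟨(Cardinal.mk X).ord.ToType, inferInstance, inferInstance, ?_,
      Cardinal.noMaxOrder hω, fun k => ?_, ?_⟩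
    · rw [← Cardinal.mk_ne_zero_iff, Cardinal.mk_toType, Cardinal.card_ord]
      exact Cardinal.mk_ne_zero X
    · exact Cardinal.mk_Iio_toType_ord_lt k
    · rw [← Cardinal.eq, Cardinal.mk_toType, Cardinal.card_ord]
  have hseg' : ∀ k : I, Cardinal.mk (Set.Iic k) < Cardinal.mk X := by
    intro k
    obtain ⟨m, hm⟩ := exists_gt k
    exact (Cardinal.mk_le_mk_of_subset fun x hx => lt_of_le_of_lt hx hm).trans_lt (hseg m)
  let G : I → X × Set X := (wellFounded_lt (α := I)).fix (stepFn e)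
  have hG : ∀ k, G k = stepFn e k (fun l _ => G l) := fun k => WellFounded.fix_eq _ _ _
  let z : I → X := fun k => (G k).1
  let F : I → Set X := fun k => (G k).2
  let N : I → Cardinal.{u} := fun k => Cardinal.mk (Set.Iio k)
  have hF : ∀ k, F k = e '' Set.Iic k ∪ ⋃ l : Set.Iio k,
      (fun p : X → X => p (z l)) '' PBC (F l) (N l) := by
    intro k
    change (G k).2 = _
    rw [hG]; rfl
  -- cardinality of the families
  have hcard : ∀ k, Cardinal.mk (PBC (F k) (N k)) < Cardinal.mk X := by
    rcases hω.eq_or_lt with hX | hX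
    · have hfin : ∀ k, (F k).Finite := by
        intro k
        induction k using WellFoundedLT.induction with
        | ind k ih =>
        rw [hF]
        have : Finite (Set.Iio k) := Cardinal.mk_lt_aleph0_iff.1 (hX ▸ hseg k)
        refine Set.Finite.union ?_ (Set.finite_iUnion fun l => ?_)
        · refine Set.Finite.image _ ?_
          exact Cardinal.mk_lt_aleph0_iff.1 (hX ▸ hseg' k)
        · exact (PBC_finite _ (ih l l.2) _ (hX ▸ hseg l)).image _
      intro k
      rw [← hX]
      exact Cardinal.mk_lt_aleph0_iff.2 (PBC_finite _ (hfin k) _ (hX ▸ hseg k))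
    · have hle : ∀ k, Cardinal.mk (F k) ≤ max Cardinal.aleph0 (Cardinal.mk (Set.Iic k)) := by
        intro k
        induction k using WellFoundedLT.induction with
        | ind k ih =>
        rw [hF]
        refine mk_union_le_of _ _ _ (le_max_left _ _) ?_ ?_
        · exact Cardinal.mk_image_le.trans (le_max_right _ _)
        · refine (Cardinal.mk_iUnion_le _).trans (Cardinal.mul_le_of_le (le_max_left _ _) ?_ ?_)
          · exact (Cardinal.mk_le_mk_of_subset Set.Iio_subset_Iic_self).trans (le_max_right _ _)
          · refine ciSup_le' fun l => Cardinal.mk_image_le.trans ?_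
            refine PBC_card _ _ _ (le_max_left _ _) ((ih l l.2).trans ?_)
            exact max_le_max le_rfl (Cardinal.mk_le_mk_of_subset (Set.Iic_subset_Iic.2 l.2.le))
      intro k
      exact (PBC_card _ _ _ (le_max_left _ _) (hle k)).trans_lt (max_lt hX (hseg' k))
  have hz : ∀ k, ∀ p ∈ PBC (F k) (N k), p (z k) ∉ e '' Set.Iic k := by
    intro k
    have hex : ∃ z : X, ∀ p ∈ PBC (F k) (N k), p z ∉ e '' Set.Iic k := by
      by_contra hno
      push Not at hno
      apply hcov
      refine ⟨Set.image2 (fun p b => {x | p x = b}) (PBC (F k) (N k)) (e '' Set.Iic k), ?_, ?_, ?_⟩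
      · rintro A ⟨p, ⟨j, _, hp⟩, b, _, rfl⟩
        exact (PB_poly _ _ p hp).isAlgebraicSet b
      · refine Set.eq_univ_of_forall fun x => ?_
        obtain ⟨p, hp, hx⟩ := hno x
        exact ⟨_, ⟨p, hp, _, hx, rfl⟩, rfl⟩
      · rw [← Set.image_prod]
        refine Cardinal.mk_image_le.trans_lt ?_
        rw [Cardinal.mk_setProd]
        exact Cardinal.mul_lt_of_lt hω (hcard k) (Cardinal.mk_image_le.trans_lt (hseg' k))
    have hFk : F k = coeffs e k (fun l _ => G l) := by
      change (G k).2 = _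
      rw [hG]; rfl
    have hzk : z k = (stepFn e k (fun l _ => G l)).1 := by
      change (G k).1 = _
      rw [hG]
    rw [hFk] at hex ⊢
    rw [hzk]
    unfold stepFn
    rw [dif_pos hex]
    exact hex.choose_spec
  have heF : ∀ i k, i ≤ k → e i ∈ F k := by
    intro i k hik
    rw [hF]
    exact Or.inl ⟨i, hik, rfl⟩
  have hzF : ∀ l k, l < k → ∀ p ∈ PBC (F l) (N l), p (z l) ∈ F k := by
    intro l k hlk p hp
    rw [hF]
    exact Or.inr (Set.mem_iUnion.2 ⟨⟨l, hlk⟩, p, hp, rfl⟩)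
  let D : I → I → Cardinal.{u} := fun n k => Cardinal.mk (Set.Ico n k)
  have hDN : ∀ n k, D n k ≤ N k := fun n k => Cardinal.mk_le_mk_of_subset fun x hx => hx.2
  have hDanti : ∀ n m k, n ≤ m → D m k ≤ D n k := fun n m k hnm =>
    Cardinal.mk_le_mk_of_subset fun x hx => ⟨hnm.trans hx.1, hx.2⟩
  have hDsucc : ∀ n m k, n < m → m ≤ k → D m k + 1 ≤ D n k := by
    intro n m k hnm hmk
    have hn : n ∉ Set.Ico m k := fun hx => absurd hx.1 (not_le.2 hnm)
    change Cardinal.mk (Set.Ico m k) + 1 ≤ _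
    rw [← Cardinal.mk_insert hn]
    refine Cardinal.mk_le_mk_of_subset ?_
    rintro x (rfl | hx)
    · exact ⟨le_rfl, hnm.trans_le hmk⟩
    · exact ⟨hnm.le.trans hx.1, hx.2⟩
  have hmonoC : ∀ (S : Set X) c d, c ≤ d → PBC S c ⊆ PBC S d := by
    rintro S c d hcd p ⟨j, hj, hp⟩
    exact ⟨j, hj.trans hcd, hp⟩
  have hup : ∀ (n m k : I) (j : ℕ), n < m → m ≤ k → (j : Cardinal.{u}) ≤ D m k →
      ∀ p ∈ PB (F k) (j + 1), p ∈ PBC (F k) (D n k) := by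
    intro n m k j h1 h2 hj p hp
    refine ⟨j + 1, ?_, hp⟩
    push_cast
    exact (add_le_add_left hj 1).trans (hDsucc n m k h1 h2)
  refine not_zeroClosed_of_system (I := I)
    (fun n => {w | ∃ k, n ≤ k ∧ ∃ p ∈ PBC (F k) (D n k), w = p (z k)}) ?_ ?_ ?_ ?_ ?_ h
  · rintro n m hnm w ⟨k, hk, p, hp, rfl⟩
    exact ⟨k, hnm.trans hk, p, hmonoC _ _ _ (hDanti _ _ _ hnm) hp, rfl⟩
  · intro n
    exact ⟨z n, n, le_rfl, fun x => x, ⟨0, by simp, rfl⟩, rfl⟩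
  · intro n
    obtain ⟨m, hm⟩ := exists_gt n
    refine ⟨m, ?_⟩
    rintro _ ⟨k, hk, p, hp, rfl⟩ _ ⟨l, hl, q, hq, rfl⟩
    rcases lt_trichotomy k l with hkl | rfl | hkl
    · obtain ⟨j, hj, hq⟩ := hq
      refine ⟨l, hm.le.trans hl, fun x => p (z k) * q x, hup n m l j hm hl hj _ ?_, rfl⟩
      exact Or.inr (Or.inr (Or.inl ⟨_, hzF k l hkl p (hmonoC _ _ _ (hDN _ _) hp), q, hq, rfl⟩))
    · obtain ⟨i, hi, hp⟩ := hp
      obtain ⟨j, hj, hq⟩ := hq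
      refine ⟨k, hm.le.trans hk, fun x => p x * q x, hup n m k (max i j) hm hk ?_ _ ?_, rfl⟩
      · rcases max_choice i j with h | h <;> rw [h] <;> assumption
      · exact Or.inr (Or.inl ⟨p, PB_mono _ (le_max_left _ _) hp, q,
          PB_mono _ (le_max_right _ _) hq, rfl⟩)
    · obtain ⟨j, hj, hp⟩ := hp
      refine ⟨k, hm.le.trans hk, fun x => p x * q (z l), hup n m k j hm hk hj _ ?_, rfl⟩
      exact Or.inr (Or.inr (Or.inr ⟨_, hzF l k hkl q (hmonoC _ _ _ (hDN _ _) hq), p, hp, rfl⟩))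
  · intro n x
    obtain ⟨i, rfl⟩ := e.surjective x
    obtain ⟨m, hm⟩ := exists_gt (max n i)
    have hnm : n < m := (le_max_left _ _).trans_lt hm
    have him : i < m := (le_max_right _ _).trans_lt hm
    refine ⟨m, ?_⟩
    rintro _ ⟨k, hk, p, ⟨j, hj, hp⟩, rfl⟩
    have hiF := heF i k (him.le.trans hk)
    refine ⟨⟨k, hnm.le.trans hk, fun x => e i * p x, hup n m k j hnm hk hj _ ?_, rfl⟩,
      ⟨k, hnm.le.trans hk, fun x => p x * e i, hup n m k j hnm hk hj _ ?_, rfl⟩⟩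
    · exact Or.inr (Or.inr (Or.inl ⟨_, hiF, p, hp, rfl⟩))
    · exact Or.inr (Or.inr (Or.inr ⟨_, hiF, p, hp, rfl⟩))
  · intro x
    obtain ⟨i, rfl⟩ := e.surjective x
    refine ⟨i, ?_⟩
    rintro ⟨k, hk, p, hp, hx⟩
    exact hz k p (hmonoC _ _ _ (hDN _ _) hp) ⟨i, hk, hx⟩

end ShelahFormalization
end
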